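/- For every positive real β and all positive integers k and r, there exist constants C and n₀ such that the following holds. For every integer n ≥ n₀, if m ≥ C·n^{1 − 1/(kr)}, then the number of m-element subsets of {1,…,n} that contain no set of the form {a, a + d^r, a + 2d^r, …, a + k·d^r} with a, d positive integers, is at most binom(⌊βn⌋, m). -/

import Mathlib

section Part1
open Polynomial

namespace PSz

/-- number of leading coefficients in degree `d` -/
noncomputable def wt (Q : Finset ℤ[X]) (d : ℕ) : ℕ :=
  ((Q.filter (fun q => q.natDegree = d)).image Polynomial.leadingCoeff).card

def WLt (Q' Q : Finset ℤ[X]) : Prop :=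
  ∃ d0, wt Q' d0 < wt Q d0 ∧ ∀ d, d0 < d → wt Q' d ≤ wt Q d

lemma wt_ne_zero_le (Q : Finset ℤ[X]) (d : ℕ) (h : wt Q d ≠ 0) : d ≤ Q.sup natDegree := by
  unfold wt at h
  rw [Finset.card_ne_zero] at h
  obtain ⟨c, hc⟩ := h
  rw [Finset.mem_image] at hc
  obtain ⟨q, hq, _⟩ := hc
  rw [Finset.mem_filter] at hq
  rw [← hq.2]
  exact Finset.le_sup hq.1

noncomputable def wtF (Q : Finset ℤ[X]) : ℕ →₀ ℕ :=
  Finsupp.onFinset (Finset.range (Q.sup natDegree + 1)) (wt Q) (fun d hd => by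
    have := wt_ne_zero_le Q d hd
    simp; omega)

lemma wlt_wf : WellFounded WLt := by
  have h : WellFounded (Finsupp.Lex (fun a b : ℕ => b < a) (fun a b : ℕ => a < b)) :=
    Finsupp.Lex.wellFounded' (fun n => Nat.not_lt_zero n) (wellFounded_lt)
      (show WellFounded (fun a b : ℕ => a < b) from wellFounded_lt)
  refine Subrelation.wf ?_ (InvImage.wf wtF h)
  intro Q' Q hQ
  obtain ⟨d0, h0, h1⟩ := hQ
  have hfin : ({d | wt Q' d < wt Q d} : Set ℕ).Finite := by
    refine (Set.finite_Iic (Q.sup natDegree)).subset ?_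
    intro d hd
    exact wt_ne_zero_le Q d (by simp only [Set.mem_ofPred_eq] at hd; omega)
  obtain ⟨m, hm, hmax⟩ := hfin.exists_maximal ⟨d0, h0⟩
  have hd0 : d0 ≤ m := by
    by_contra hc
    push Not at hc
    have := hmax (show d0 ∈ {d | wt Q' d < wt Q d} from h0) hc.le
    omega
  refine ⟨m, ?_, hm⟩
  intro d hd
  have h2 : ¬ wt Q' d < wt Q d := by
    intro hc
    have := hmax (show d ∈ {d | wt Q' d < wt Q d} from hc) (le_of_lt hd)
    omega
  have h3 := h1 d (by omega)
  show wt Q' d = wt Q d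
  omega

/-- relation between new polys and old polys in a PET step -/
lemma wlt_of_step (Q Q' : Finset ℤ[X]) (p : ℤ[X]) (hp : p ∈ Q)
    (h : ∀ q' ∈ Q', q'.natDegree < p.natDegree ∨ ∃ q ∈ Q, q'.natDegree = q.natDegree ∧
      ((p.natDegree < q.natDegree ∧ q'.leadingCoeff = q.leadingCoeff) ∨
       (q.natDegree = p.natDegree ∧ q'.leadingCoeff = q.leadingCoeff - p.leadingCoeff ∧
        q.leadingCoeff ≠ p.leadingCoeff))) : WLt Q' Q := by
  classical
  refine ⟨p.natDegree, ?_, ?_⟩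
  · unfold wt
    set A := (Q.filter (fun q => q.natDegree = p.natDegree)).image Polynomial.leadingCoeff with hA
    have hpA : p.leadingCoeff ∈ A := by
      rw [hA]; exact Finset.mem_image_of_mem _ (by simp [hp])
    have : ((Q'.filter (fun q => q.natDegree = p.natDegree)).image Polynomial.leadingCoeff) ⊆
        (A.erase p.leadingCoeff).image (fun c => c - p.leadingCoeff) := by
      intro c hc
      rw [Finset.mem_image] at hc
      obtain ⟨q', hq', rfl⟩ := hc
      rw [Finset.mem_filter] at hq'
      rcases h q' hq'.1 with h1 | ⟨q, hq, hdeg, h2⟩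
      · omega
      · rcases h2 with h2 | h2
        · omega
        · rw [Finset.mem_image]
          refine ⟨q.leadingCoeff, ?_, h2.2.1.symm⟩
          rw [Finset.mem_erase]
          exact ⟨h2.2.2, Finset.mem_image_of_mem _ (by simp [hq, h2.1])⟩
    calc _ ≤ _ := Finset.card_le_card this
      _ ≤ (A.erase p.leadingCoeff).card := Finset.card_image_le
      _ < A.card := Finset.card_erase_lt_of_mem hpA
  · intro d hd
    unfold wt
    apply Finset.card_le_card
    intro c hc
    rw [Finset.mem_image] at hc ⊢
    obtain ⟨q', hq', rfl⟩ := hc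
    rw [Finset.mem_filter] at hq'
    rcases h q' hq'.1 with h1 | ⟨q, hq, hdeg, h2⟩
    · omega
    · rcases h2 with h2 | h2
      · exact ⟨q, by simp [hq]; omega, h2.2.symm⟩
      · omega

lemma shift_deg (q : ℤ[X]) (h : ℤ) : (q.comp (X + C h)).natDegree = q.natDegree := by
  rw [natDegree_comp, natDegree_X_add_C, mul_one]

lemma shift_lc (q : ℤ[X]) (h : ℤ) : (q.comp (X + C h)).leadingCoeff = q.leadingCoeff := by
  rw [Polynomial.leadingCoeff_comp (by rw [natDegree_X_add_C]; exact one_ne_zero),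
    leadingCoeff_X_add_C, one_pow, mul_one]

lemma step_trichotomy (q p : ℤ[X]) (h c : ℤ) (hp : 1 ≤ p.natDegree)
    (hle : p.natDegree ≤ q.natDegree) :
    (q.comp (X + C h) - C c - p).natDegree < p.natDegree ∨
    ((q.comp (X + C h) - C c - p).natDegree = q.natDegree ∧
      ((p.natDegree < q.natDegree ∧
        (q.comp (X + C h) - C c - p).leadingCoeff = q.leadingCoeff) ∨
       (q.natDegree = p.natDegree ∧
        (q.comp (X + C h) - C c - p).leadingCoeff = q.leadingCoeff - p.leadingCoeff ∧
        q.leadingCoeff ≠ p.leadingCoeff))) := by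
  set q1 := q.comp (X + C h) - C c with hq1
  have hd1 : q1.natDegree = q.natDegree := by rw [hq1, natDegree_sub_C, shift_deg]
  have hl1 : q1.leadingCoeff = q.leadingCoeff := by
    rw [← shift_lc q h, leadingCoeff, leadingCoeff, hd1, shift_deg, hq1, coeff_sub, coeff_C,
      if_neg (by omega), sub_zero]
  rcases lt_or_eq_of_le hle with hlt | heq
  · right
    have hd : (q1 - p).natDegree = q.natDegree := by
      rw [natDegree_sub_eq_left_of_natDegree_lt (by omega), hd1]
    refine ⟨hd, Or.inl ⟨hlt, ?_⟩⟩
    rw [leadingCoeff, hd, coeff_sub, coeff_eq_zero_of_natDegree_lt hlt, sub_zero, ← hd1, ← hl1]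
    rfl
  · by_cases hlc : q.leadingCoeff = p.leadingCoeff
    · left
      have hcoef : (q1 - p).coeff p.natDegree = 0 := by
        have e1 : q1.coeff p.natDegree = p.leadingCoeff := by
          rw [heq, ← hd1, ← hlc, ← hl1]; rfl
        rw [coeff_sub, e1, leadingCoeff, sub_self]
      have hle' : (q1 - p).natDegree ≤ p.natDegree := by
        refine (natDegree_sub_le _ _).trans ?_
        rw [hd1, ← heq, max_self]
      rcases lt_or_eq_of_le hle' with h1 | h1
      · exact h1
      · exfalso
        have : (q1 - p) = 0 := by
          rw [← leadingCoeff_eq_zero, leadingCoeff, h1, hcoef]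
        rw [this] at h1
        simp at h1
        omega
    · right
      have hcoef : (q1 - p).coeff p.natDegree = q.leadingCoeff - p.leadingCoeff := by
        have e1 : q1.coeff p.natDegree = q.leadingCoeff := by
          rw [heq, ← hd1, ← hl1]; rfl
        rw [coeff_sub, e1]; rfl
      have hle' : (q1 - p).natDegree ≤ p.natDegree := by
        refine (natDegree_sub_le _ _).trans ?_
        rw [hd1, ← heq, max_self]
      have hd : (q1 - p).natDegree = p.natDegree :=
        le_antisymm hle' (le_natDegree_of_ne_zero (by rw [hcoef]; exact sub_ne_zero.2 hlc))
      refine ⟨hd.trans heq, Or.inr ⟨heq.symm, ?_, hlc⟩⟩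
      rw [leadingCoeff, hd, hcoef]

lemma exists_eval_bound (Q : Finset ℤ[X]) (N : ℕ) :
    ∃ B : ℕ, ∀ q ∈ Q, ∀ e : ℤ, |e| ≤ N → |q.eval e| ≤ B := by
  refine ⟨∑ q ∈ Q, ∑ e ∈ Finset.Icc (-(N:ℤ)) N, (q.eval e).natAbs, ?_⟩
  intro q hq e he
  have he' : e ∈ Finset.Icc (-(N:ℤ)) N := by rw [Finset.mem_Icc]; exact abs_le.1 he
  have h1 := Finset.single_le_sum (f := fun e : ℤ => (q.eval e).natAbs)
    (fun i _ => Nat.zero_le _) he'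
  have h2 := Finset.single_le_sum
    (f := fun q : ℤ[X] => ∑ e ∈ Finset.Icc (-(N:ℤ)) N, (q.eval e).natAbs)
    (fun i _ => Nat.zero_le _) hq
  have := h1.trans h2
  rw [Int.abs_eq_natAbs]
  exact_mod_cast this

/-- polynomial van der Waerden, finitary -/
theorem poly_vdw (Q : Finset ℤ[X]) : (∀ q ∈ Q, q ≠ 0 ∧ q.eval 0 = 0) →
    ∀ (κ : Type) [Fintype κ], ∃ N : ℕ, ∀ c : ℤ → κ, ∃ a d : ℤ, |a| ≤ N ∧ 1 ≤ d ∧ d ≤ N ∧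
      ∀ q ∈ Q, c (a + q.eval d) = c a := by
  classical
  induction Q using wlt_wf.induction with
  | _ Q ih =>
  intro hQ κ _
  rcases Q.eq_empty_or_nonempty with rfl | hne
  · exact ⟨1, fun c => ⟨0, 1, by simp⟩⟩
  obtain ⟨p, hpQ, hpmin⟩ := Q.exists_min_image natDegree hne
  have hdeg : ∀ q ∈ Q, 1 ≤ q.natDegree := by
    intro q hq
    by_contra hc
    have h0 : q.natDegree = 0 := by omega
    rw [natDegree_eq_zero] at h0
    obtain ⟨x, rfl⟩ := h0
    have := hQ _ hq
    simp at this
  -- focusing claim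
  have key : ∀ s : ℕ, ∃ N : ℕ, ∀ c : ℤ → κ, (∃ a d : ℤ, |a| ≤ N ∧ 1 ≤ d ∧ d ≤ N ∧
      ∀ q ∈ Q, c (a + q.eval d) = c a) ∨
      (∃ (a : ℤ) (D : Fin s → ℤ) (col : Fin s → κ), |a| ≤ N ∧ (∀ i, 1 ≤ D i ∧ D i ≤ N) ∧
        Function.Injective col ∧ ∀ i, ∀ q ∈ Q, c (a + q.eval (D i)) = col i) := by
    intro s
    induction s with
    | zero =>
      refine ⟨0, fun c => Or.inr ⟨0, Fin.elim0, Fin.elim0, by simp, fun i => i.elim0, ?_,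
        fun i => i.elim0⟩⟩
      intro i
      exact i.elim0
    | succ s ihs =>
      obtain ⟨N1, hN1⟩ := ihs
      obtain ⟨B, hB⟩ := exists_eval_bound Q N1
      set R : ℕ := N1 + B with hR
      set Q' : Finset ℤ[X] := ((Q ×ˢ Finset.Icc (0:ℤ) N1).image
        (fun x => x.1.comp (X + C x.2) - C (x.1.eval x.2) - p)).erase 0 with hQ'
      have hlt : WLt Q' Q := by
        apply wlt_of_step Q Q' p hpQ
        intro q' hq'
        rw [hQ', Finset.mem_erase, Finset.mem_image] at hq'
        obtain ⟨_, ⟨q, e⟩, hqe, rfl⟩ := hq'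
        rw [Finset.mem_product] at hqe
        rcases step_trichotomy q p e (q.eval e) (hdeg p hpQ) (hpmin q hqe.1) with h | h
        · exact Or.inl h
        · exact Or.inr ⟨q, hqe.1, h⟩
      have hQ'0 : ∀ q ∈ Q', q ≠ 0 ∧ q.eval 0 = 0 := by
        intro q' hq'
        rw [hQ', Finset.mem_erase, Finset.mem_image] at hq'
        obtain ⟨h0, ⟨q, e⟩, hqe, rfl⟩ := hq'
        refine ⟨h0, ?_⟩
        simp [(hQ p hpQ).2]
      obtain ⟨N2, hN2⟩ := ih Q' hlt hQ'0 (Finset.Icc (-(R:ℤ)) R → κ)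
      obtain ⟨B2, hB2⟩ := exists_eval_bound Q N2
      refine ⟨N1 + N2 + B2, fun c => ?_⟩
      obtain ⟨x, d, hx, hd1, hd2, hxd⟩ := hN2 (fun x t => c (x + t))
      have hsame : ∀ q ∈ Q, ∀ e : ℤ, 0 ≤ e → e ≤ N1 → ∀ t : ℤ, |t| ≤ R →
          c (x - p.eval d + (q.eval (d + e) - q.eval e) + t) = c (x + t) := by
        intro q hq e he0 he1 t ht
        by_cases hz : q.comp (X + C e) - C (q.eval e) - p = 0
        · have h1 := congrArg (Polynomial.eval d) hz
          simp at h1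
          congr 1
          linarith
        · have hmem : q.comp (X + C e) - C (q.eval e) - p ∈ Q' := by
            rw [hQ', Finset.mem_erase, Finset.mem_image]
            exact ⟨hz, (q, e), by simp [hq, he0, he1], rfl⟩
          have h1 := congrFun (hxd _ hmem) ⟨t, by rw [Finset.mem_Icc]; exact abs_le.1 ht⟩
          simp at h1
          rw [← h1]
          congr 1
          ring
      rcases hN1 (fun t => c (x + t)) with ⟨a, d', ha, hd1', hd2', hmono⟩ |
        ⟨a, D, col, ha, hD, hinj, hfoc⟩
      · left
        refine ⟨x + a, d', ?_, hd1', ?_, ?_⟩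
        · have := abs_add_le x a
          push_cast
          have : (0:ℤ) ≤ B2 := by positivity
          linarith
        · push_cast
          have : (0:ℤ) ≤ B2 := by positivity
          have : (0:ℤ) ≤ N2 := by positivity
          linarith
        · intro q hq
          have := hmono q hq
          rw [← this]
          congr 1
          ring
      · by_cases hcol : ∃ i, col i = c (x + a)
        · left
          obtain ⟨i, hi⟩ := hcol
          refine ⟨x + a, D i, ?_, (hD i).1, ?_, ?_⟩
          · have := abs_add_le x a
            push_cast
            have : (0:ℤ) ≤ B2 := by positivity
            linarith
          · have := (hD i).2
            push_cast
            have : (0:ℤ) ≤ B2 := by positivity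
            have : (0:ℤ) ≤ N2 := by positivity
            linarith
          · intro q hq
            have := hfoc i q hq
            rw [← hi, ← this]
            congr 1
            ring
        · right
          push Not at hcol
          have hpd : |p.eval d| ≤ B2 := hB2 p hpQ d (by rw [abs_of_nonneg (by linarith)]; exact hd2)
          refine ⟨x + a - p.eval d, Fin.cons d (fun i => d + D i),
            Fin.cons (c (x + a)) col, ?_, ?_, ?_, ?_⟩
          · rw [abs_le] at *
            push_cast
            constructor <;> linarith [hx.1, hx.2, ha.1, ha.2, hpd.1, hpd.2]
          · intro i
            have : (0:ℤ) ≤ B2 := by positivity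
            have : (0:ℤ) ≤ N1 := by positivity
            refine Fin.cases ?_ ?_ i
            · simp only [Fin.cons_zero]
              push_cast
              constructor <;> linarith
            · intro j
              simp only [Fin.cons_succ]
              have := hD j
              push_cast
              constructor <;> linarith [this.1, this.2]
          · rw [Fin.cons_injective_iff]
            refine ⟨?_, hinj⟩
            rintro ⟨i, hi⟩
            exact hcol i hi
          · intro i
            refine Fin.cases ?_ ?_ i
            · intro q hq
              simp only [Fin.cons_zero]
              have h1 := hsame q hq 0 le_rfl (by positivity) a (by
                rw [hR]; push_cast
                have : (0:ℤ) ≤ B := by positivity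
                linarith)
              rw [← h1, (hQ q hq).2, add_zero]
              congr 1
              ring
            · intro j q hq
              simp only [Fin.cons_succ]
              have hDj := hD j
              have hqD : |q.eval (D j)| ≤ B := hB q hq _ (by
                rw [abs_of_nonneg (by linarith)]; exact hDj.2)
              have h1 := hsame q hq (D j) (by linarith) hDj.2 (a + q.eval (D j)) (by
                rw [hR]; push_cast
                have := abs_add_le a (q.eval (D j))
                linarith)
              have h2 := hfoc j q hq
              rw [← h2, ← h1]
              congr 1
              ring
  obtain ⟨N, hN⟩ := key (Fintype.card κ + 1)
  refine ⟨N, fun c => ?_⟩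
  rcases hN c with h | ⟨a, D, col, _, _, hinj, _⟩
  · exact h
  · have := Fintype.card_le_of_injective col hinj
    simp at this

/-- one-sided version for `i * d^r` -/
theorem power_vdw (k r : ℕ) (hr : 1 ≤ r) (M : ℕ) : ∃ N : ℕ, ∀ c : ℕ → Fin M, ∃ a d : ℕ,
    1 ≤ d ∧ a + k * d ^ r ≤ N ∧ ∀ i ≤ k, c (a + i * d ^ r) = c a := by
  classical
  obtain ⟨N, hN⟩ := poly_vdw ((Finset.Icc 1 k).image (fun i : ℕ => C (i:ℤ) * X ^ r)) (by
    intro q hq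
    rw [Finset.mem_image] at hq
    obtain ⟨i, hi, rfl⟩ := hq
    rw [Finset.mem_Icc] at hi
    constructor
    · rw [Ne, mul_eq_zero, not_or, C_eq_zero]
      exact ⟨by exact_mod_cast (by omega : i ≠ 0), pow_ne_zero _ X_ne_zero⟩
    · simp [show r ≠ 0 by omega]) (Fin M)
  refine ⟨2 * N + k * N ^ r, fun c => ?_⟩
  obtain ⟨a, d, ha, hd1, hd2, hc⟩ := hN (fun x => c (x + N).toNat)
  rw [abs_le] at ha
  refine ⟨(a + N).toNat, d.toNat, by omega, ?_, ?_⟩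
  · have : d.toNat ^ r ≤ N ^ r := Nat.pow_le_pow_left (by omega) r
    have := Nat.mul_le_mul_left k this
    omega
  · intro i hi
    rcases Nat.eq_zero_or_pos i with rfl | hpos
    · simp
    have h := hc (C (i:ℤ) * X ^ r) (Finset.mem_image_of_mem _ (by rw [Finset.mem_Icc]; omega))
    rw [← h]
    congr 1
    rw [eval_mul, eval_C, eval_pow, eval_X]
    obtain ⟨e, rfl⟩ := Int.eq_ofNat_of_zero_le (by omega : 0 ≤ d)
    have : (a + (i:ℤ) * (e:ℤ) ^ r + N) = ((a + N) + ((i * e ^ r : ℕ) : ℤ)) := by push_cast; ring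
    rw [this, Int.toNat_natCast]
    omega

end PSz
end Part1

section Part2
open MeasureTheory ProbabilityTheory Filter Topology

namespace PSz

section vdc

lemma vdc_pointwise (u : ℕ → ℝ) (hu : ∀ n, |u n| ≤ 1) (N H : ℕ) (hN : 1 ≤ N) (hH : 1 ≤ H) :
    ((∑ n ∈ Finset.range N, u n) / N) ^ 2 ≤
      2 / (H:ℝ) ^ 2 * ∑ h ∈ Finset.range H, ∑ h' ∈ Finset.range H,
        (∑ n ∈ Finset.range N, u (n + h) * u (n + h')) / N + 8 * (H:ℝ) ^ 2 / (N:ℝ) ^ 2 := by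
  have hN' : (0:ℝ) < N := by exact_mod_cast hN
  have hH' : (0:ℝ) < H := by exact_mod_cast hH
  -- shift error
  have hshift : ∀ h, |(∑ n ∈ Finset.range N, u n) - ∑ n ∈ Finset.range N, u (n + h)| ≤ 2 * h := by
    intro h
    induction h with
    | zero => simp
    | succ h ih =>
      have e : ∑ n ∈ Finset.range N, u (n + h) - ∑ n ∈ Finset.range N, u (n + (h+1))
          = u h - u (N + h) := by
        rw [← Finset.sum_sub_distrib]
        have := Finset.sum_range_sub' (fun n => u (n + h)) N
        simp only [zero_add] at this
        rw [← this]
        refine Finset.sum_congr rfl fun n _ => ?_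
        congr 2
        ring
      have h1 : |u h - u (N + h)| ≤ 2 := by
        have := abs_sub (u h) (u (N+h))
        linarith [hu h, hu (N+h)]
      have h2 : (∑ n ∈ Finset.range N, u n) - ∑ n ∈ Finset.range N, u (n + (h+1)) =
        ((∑ n ∈ Finset.range N, u n) - ∑ n ∈ Finset.range N, u (n + h)) +
          (u h - u (N + h)) := by rw [← e]; ring
      rw [h2]
      have := abs_add_le ((∑ n ∈ Finset.range N, u n) - ∑ n ∈ Finset.range N, u (n + h))
        (u h - u (N + h))
      push_cast
      linarith
  set A := ∑ n ∈ Finset.range N, u n with hA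
  set Bs := ∑ n ∈ Finset.range N, ∑ h ∈ Finset.range H, u (n + h) with hBs
  have herr : |H * A - Bs| ≤ 2 * (H:ℝ) ^ 2 := by
    rw [hBs, Finset.sum_comm]
    have : (H:ℝ) * A = ∑ h ∈ Finset.range H, A := by simp
    rw [this, ← Finset.sum_sub_distrib]
    refine (Finset.abs_sum_le_sum_abs _ _).trans ?_
    calc _ ≤ ∑ h ∈ Finset.range H, (2 * (H:ℝ)) := by
          refine Finset.sum_le_sum fun h hh => (hshift h).trans ?_
          have : (h:ℝ) ≤ H := by exact_mod_cast (Finset.mem_range.1 hh).le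
          linarith
      _ = 2 * (H:ℝ)^2 := by simp; ring
  have hcs : Bs ^ 2 ≤ N * ∑ n ∈ Finset.range N, (∑ h ∈ Finset.range H, u (n + h)) ^ 2 := by
    have := sq_sum_le_card_mul_sum_sq (s := Finset.range N)
      (f := fun n => ∑ h ∈ Finset.range H, u (n + h))
    simpa using this
  have hexp : ∑ n ∈ Finset.range N, (∑ h ∈ Finset.range H, u (n + h)) ^ 2 =
      ∑ h ∈ Finset.range H, ∑ h' ∈ Finset.range H, ∑ n ∈ Finset.range N, u (n + h) * u (n + h') := by
    simp_rw [sq, Finset.sum_mul_sum]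
    rw [Finset.sum_comm]
    refine Finset.sum_congr rfl fun h _ => ?_
    rw [Finset.sum_comm]
  have h3 : ((H:ℝ) * A) ^ 2 ≤ 2 * Bs ^ 2 + 8 * (H:ℝ) ^ 4 := by
    have h4 : (H * A - Bs) ^ 2 ≤ (2 * (H:ℝ) ^ 2) ^ 2 := by
      rw [← sq_abs]
      exact pow_le_pow_left₀ (abs_nonneg _) herr 2
    nlinarith [sq_nonneg (H * A - 2 * Bs)]
  have h5 : ((H:ℝ) * A) ^ 2 ≤ 2 * (N * ∑ h ∈ Finset.range H, ∑ h' ∈ Finset.range H,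
      ∑ n ∈ Finset.range N, u (n + h) * u (n + h')) + 8 * (H:ℝ) ^ 4 := by
    rw [← hexp]; linarith
  simp_rw [← Finset.sum_div]
  set Z := ∑ h ∈ Finset.range H, ∑ h' ∈ Finset.range H,
      ∑ n ∈ Finset.range N, u (n + h) * u (n + h') with hZ
  have e1 : (A / N) ^ 2 = ((H:ℝ) * A) ^ 2 / ((H:ℝ)^2 * (N:ℝ)^2) := by
    field_simp
  have e2 : 2 / (H:ℝ) ^ 2 * (Z / N) + 8 * (H:ℝ) ^ 2 / (N:ℝ) ^ 2 =
      (2 * (N * Z) + 8 * (H:ℝ)^4) / ((H:ℝ)^2 * (N:ℝ)^2) := by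
    field_simp
  rw [e1, e2]
  gcongr

/-- Averages tend to zero. -/
def AvZ (u : ℕ → ℝ) : Prop :=
  Tendsto (fun N : ℕ => (∑ n ∈ Finset.range N, u n) / N) atTop (𝓝 0)

lemma vdc_abstract (c : ℕ → ℕ → ℝ) (hsymm : ∀ m n, c m n = c n m) (hc : ∀ m n, |c m n| ≤ 1)
    (J : ℕ → ℝ) (hJ0 : ∀ N, 0 ≤ J N)
    (hJ : ∀ N H : ℕ, 1 ≤ N → 1 ≤ H → J N ≤ 2 / (H:ℝ) ^ 2 * ∑ h ∈ Finset.range H,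
      ∑ h' ∈ Finset.range H, (∑ n ∈ Finset.range N, c (n + h) (n + h')) / N
        + 8 * (H:ℝ) ^ 2 / (N:ℝ) ^ 2)
    (b : ℕ → ℝ) (hb0 : ∀ h, 0 ≤ b h)
    (hb : ∀ h, ∀ ε > 0, ∀ᶠ N : ℕ in atTop, (∑ n ∈ Finset.range N, c n (n + h)) / N ≤ b h + ε)
    (hbav : AvZ b) : Tendsto J atTop (𝓝 0) := by
  -- shifted version
  have hb' : ∀ h h', ∀ ε > 0, ∀ᶠ N : ℕ in atTop,
      (∑ n ∈ Finset.range N, c (n + h) (n + h')) / N ≤ b ((h - h') + (h' - h)) + ε := by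
    have main : ∀ h j, ∀ ε > 0, ∀ᶠ N : ℕ in atTop,
        (∑ n ∈ Finset.range N, c (n + h) (n + h + j)) / N ≤ b j + ε := by
      intro h j ε hε
      induction h generalizing ε with
      | zero => simpa using hb j ε hε
      | succ h ih =>
        have hlim : ∀ᶠ N : ℕ in atTop, (2:ℝ) / N ≤ ε / 2 :=
          (tendsto_const_div_atTop_nhds_zero_nat (2:ℝ)).eventually_le_const (by linarith)
        filter_upwards [ih (ε/2) (by linarith), hlim, eventually_gt_atTop 0] with N h1 h2 h3
        have hN' : (0:ℝ) < N := by exact_mod_cast h3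
        have e : ∑ n ∈ Finset.range N, c (n + (h+1)) (n + (h+1) + j) =
          ∑ n ∈ Finset.range N, c (n + h) (n + h + j) +
            (c (N + h) (N + h + j) - c h (h + j)) := by
          have := Finset.sum_range_sub (fun n => c (n + h) (n + h + j)) N
          simp only [zero_add] at this
          rw [← this, ← Finset.sum_add_distrib]
          refine Finset.sum_congr rfl fun n _ => ?_
          rw [show n + (h+1) = n + 1 + h by ring]
          ring
        rw [e, add_div]
        have h4 : (c (N + h) (N + h + j) - c h (h + j)) / N ≤ 2 / N := by
          gcongr
          have a1 := abs_le.1 (hc (N + h) (N + h + j))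
          have a2 := abs_le.1 (hc h (h + j))
          linarith [a1.2, a2.1]
        linarith
    intro h h' ε hε
    rcases le_total h h' with hle | hle
    · obtain ⟨j, rfl⟩ := Nat.exists_eq_add_of_le hle
      filter_upwards [main h j ε hε] with N hN
      have : h - (h + j) + (h + j - h) = j := by omega
      rw [this]
      simp only [← add_assoc]
      linarith
    · obtain ⟨j, rfl⟩ := Nat.exists_eq_add_of_le hle
      filter_upwards [main h' j ε hε] with N hN
      have : h' + j - h' + (h' - (h' + j)) = j := by omega
      rw [this]
      simp_rw [hsymm _ (_ + h'), ← add_assoc]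
      linarith
  rw [Metric.tendsto_nhds]
  intro ε hε
  have hH : ∀ᶠ H : ℕ in atTop, (∑ n ∈ Finset.range H, b n) / H < ε / 16 :=
    hbav.eventually_lt_const (by linarith)
  obtain ⟨H, hH1, hH2⟩ := (hH.and (eventually_ge_atTop 1)).exists
  have hHpos : (0:ℝ) < H := by exact_mod_cast hH2
  have hsum : ∑ h ∈ Finset.range H, ∑ h' ∈ Finset.range H, b ((h - h') + (h' - h)) ≤
      (H:ℝ) * (2 * ∑ n ∈ Finset.range H, b n) := by
    have one : ∀ h ∈ Finset.range H, ∑ h' ∈ Finset.range H, b ((h - h') + (h' - h)) ≤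
        2 * ∑ n ∈ Finset.range H, b n := by
      intro h hh
      rw [Finset.mem_range] at hh
      have hS : ∀ t : Finset ℕ, ∀ g : ℕ → ℕ, Set.InjOn g t → (∀ x ∈ t, g x < H) →
          ∑ x ∈ t, b (g x) ≤ ∑ n ∈ Finset.range H, b n := by
        intro t g hg hlt
        rw [← Finset.sum_image hg]
        refine Finset.sum_le_sum_of_subset_of_nonneg ?_ (fun i _ _ => hb0 i)
        intro x hx
        rw [Finset.mem_image] at hx
        obtain ⟨y, hy, rfl⟩ := hx
        exact Finset.mem_range.2 (hlt y hy)
      rw [← Finset.sum_filter_add_sum_filter_not (Finset.range H) (fun x => x ≤ h)]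
      have a1 := hS ((Finset.range H).filter (fun x => x ≤ h)) (fun x => (h - x) + (x - h))
        (by
          intro x hx y hy hxy
          simp only [Finset.coe_filter, Finset.mem_range, Set.mem_ofPred_eq] at hx hy
          simp only at hxy
          omega) (by
          intro x hx
          simp only [Finset.mem_filter, Finset.mem_range] at hx
          omega)
      have a2 := hS ((Finset.range H).filter (fun x => ¬ x ≤ h)) (fun x => (h - x) + (x - h))
        (by
          intro x hx y hy hxy
          simp only [Finset.coe_filter, Finset.mem_range, Set.mem_ofPred_eq] at hx hy
          simp only at hxy
          omega) (by
          intro x hx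
          simp only [Finset.mem_filter, Finset.mem_range] at hx
          omega)
      linarith
    calc _ ≤ ∑ h ∈ Finset.range H, (2 * ∑ n ∈ Finset.range H, b n) := Finset.sum_le_sum one
      _ = _ := by simp
  have hev : ∀ᶠ N : ℕ in atTop, ∀ h ∈ Finset.range H, ∀ h' ∈ Finset.range H,
      (∑ n ∈ Finset.range N, c (n + h) (n + h')) / N ≤ b ((h - h') + (h' - h)) + ε / 16 := by
    rw [Filter.eventually_all_finset]
    intro h _
    rw [Filter.eventually_all_finset]
    intro h' _
    exact hb' h h' _ (by linarith)
  have hlim : ∀ᶠ N : ℕ in atTop, 8 * (H:ℝ) ^ 2 / (N:ℝ) ^ 2 ≤ ε / 4 := by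
    have : Tendsto (fun N : ℕ => 8 * (H:ℝ) ^ 2 / (N:ℝ) ^ 2) atTop (𝓝 0) := by
      refine Tendsto.const_div_atTop ?_ _
      exact (tendsto_pow_atTop (by norm_num)).comp tendsto_natCast_atTop_atTop
    exact this.eventually_le_const (by linarith)
  filter_upwards [hev, hlim, eventually_ge_atTop 1] with N h1 h2 h3
  have h4 := hJ N H h3 hH2
  have h5 : ∑ h ∈ Finset.range H, ∑ h' ∈ Finset.range H,
      (∑ n ∈ Finset.range N, c (n + h) (n + h')) / N ≤
      (H:ℝ) * (2 * ∑ n ∈ Finset.range H, b n) + (H:ℝ) ^ 2 * (ε / 16) := by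
    calc _ ≤ ∑ h ∈ Finset.range H, ∑ h' ∈ Finset.range H, (b ((h - h') + (h' - h)) + ε / 16) :=
          Finset.sum_le_sum fun h hh => Finset.sum_le_sum fun h' hh' => h1 h hh h' hh'
      _ ≤ _ := by
          simp only [Finset.sum_add_distrib]
          simp only [Finset.sum_const, Finset.card_range, nsmul_eq_mul]
          nlinarith [hsum]
  have h6 : ∑ n ∈ Finset.range H, b n ≤ ε / 16 * H := by
    rw [div_lt_iff₀ hHpos] at hH1
    exact hH1.le
  have h7 : 2 / (H:ℝ) ^ 2 * ∑ h ∈ Finset.range H, ∑ h' ∈ Finset.range H,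
      (∑ n ∈ Finset.range N, c (n + h) (n + h')) / N ≤
      2 / (H:ℝ) ^ 2 * ((H:ℝ) ^ 2 * (3 * ε / 16)) := by
    gcongr
    nlinarith
  have h8 : 2 / (H:ℝ) ^ 2 * ((H:ℝ) ^ 2 * (3 * ε / 16)) = 3 * ε / 8 := by
    field_simp
    ring
  rw [Real.dist_eq, sub_zero, abs_of_nonneg (hJ0 N)]
  linarith

end vdc
end PSz
end Part2

section Part3
open MeasureTheory ProbabilityTheory Filter Topology

namespace PSz

set_option linter.unusedSectionVars false
set_option linter.unusedVariables false

section avz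

lemma AvZ.add {u v : ℕ → ℝ} (hu : AvZ u) (hv : AvZ v) : AvZ (fun n => u n + v n) := by
  unfold AvZ at *
  simpa [Finset.sum_add_distrib, add_div] using! hu.add hv

lemma AvZ.const_mul {u : ℕ → ℝ} (hu : AvZ u) (c : ℝ) : AvZ (fun n => c * u n) := by
  unfold AvZ at *
  simpa [← Finset.mul_sum, mul_div_assoc] using! Tendsto.const_mul c hu

lemma avz_zero : AvZ (fun _ => (0:ℝ)) := by
  unfold AvZ; simp

lemma AvZ.sum {ι : Type*} (s : Finset ι) (u : ι → ℕ → ℝ) (h : ∀ i ∈ s, AvZ (u i)) :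
    AvZ (fun n => ∑ i ∈ s, u i n) := by
  classical
  induction s using Finset.induction_on with
  | empty => simpa using avz_zero
  | insert a s ha ih =>
    simp only [Finset.sum_insert ha]
    exact (h a (by simp)).add (ih fun i hi => h i (by simp [hi]))

lemma AvZ.squeeze {u v : ℕ → ℝ} (hv : AvZ v) (h0 : ∀ n, 0 ≤ u n) (h : ∀ n, u n ≤ v n) : AvZ u := by
  unfold AvZ at *
  refine squeeze_zero (fun N => ?_) (fun N => ?_) hv
  · exact div_nonneg (Finset.sum_nonneg fun i _ => h0 i) (by positivity)
  · gcongr with i _; exact h i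

lemma AvZ.congr {u v : ℕ → ℝ} (hv : AvZ v) (h : ∀ n, u n = v n) : AvZ u := by
  have : u = v := funext h
  rwa [this]

/-- Cauchy-Schwarz: averages of squares go to zero implies averages of abs do. -/
lemma AvZ.of_sq {u : ℕ → ℝ} (hu : AvZ (fun n => u n ^ 2)) : AvZ (fun n => |u n|) := by
  unfold AvZ at *
  have h1 : Tendsto (fun N : ℕ => Real.sqrt ((∑ n ∈ Finset.range N, u n ^ 2) / N)) atTop (𝓝 0) := by
    simpa using hu.sqrt
  refine squeeze_zero (fun N => ?_) (fun N => ?_) h1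
  · positivity
  · rcases Nat.eq_zero_or_pos N with rfl | hN
    · simp
    have hN' : (0:ℝ) < N := by exact_mod_cast hN
    apply Real.le_sqrt_of_sq_le
    have := sq_sum_le_card_mul_sum_sq (s := Finset.range N) (f := fun n => |u n|)
    simp only [sq_abs, Finset.card_range] at this
    rw [div_pow, div_le_div_iff₀ (by positivity) hN']
    nlinarith

/-- modifying finitely many terms -/
lemma AvZ.finite {u v : ℕ → ℝ} (hv : AvZ v) (F : Finset ℕ) (h : ∀ n ∉ F, u n = v n) : AvZ u := by
  have e : ∀ n, u n = v n + (u n - v n) := fun n => by ring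
  refine AvZ.congr (hv.add ?_) e
  unfold AvZ
  have hb : ∀ N : ℕ, ‖(∑ n ∈ Finset.range N, (u n - v n)) / N‖ ≤ (∑ n ∈ F, |u n - v n|) / N := by
    intro N
    rw [Real.norm_eq_abs, abs_div, Nat.abs_cast]
    gcongr
    refine (Finset.abs_sum_le_sum_abs _ _).trans ?_
    rw [← Finset.sum_filter_add_sum_filter_not (Finset.range N) (fun n => n ∈ F)]
    have : ∑ n ∈ (Finset.range N).filter (fun n => ¬ n ∈ F), |u n - v n| = 0 := by
      refine Finset.sum_eq_zero fun n hn => ?_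
      rw [Finset.mem_filter] at hn
      rw [h n hn.2]; simp
    rw [this, add_zero]
    exact Finset.sum_le_sum_of_subset_of_nonneg (fun n hn => (Finset.mem_filter.1 hn).2)
      (fun _ _ _ => abs_nonneg _)
  exact squeeze_zero_norm hb (tendsto_const_div_atTop_nhds_zero_nat _)

/-- multiples subsequence for nonneg sequences -/
lemma AvZ.mul_index {u : ℕ → ℝ} (hu : AvZ u) (h0 : ∀ n, 0 ≤ u n) (c : ℕ) (hc : 1 ≤ c) :
    AvZ (fun n => u (c * n)) := by
  unfold AvZ at *
  have h1 : Tendsto (fun N : ℕ => c * ((∑ n ∈ Finset.range (c * N), u n) / (c * N : ℕ)))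
      atTop (𝓝 0) := by
    have : Tendsto (fun N : ℕ => c * N) atTop atTop :=
      tendsto_id.const_mul_atTop' (by omega)
    simpa using! Tendsto.const_mul (c:ℝ) (hu.comp this)
  refine squeeze_zero (fun N => div_nonneg (Finset.sum_nonneg fun i _ => h0 _) (by positivity))
    (fun N => ?_) h1
  have hc' : (0:ℝ) < c := by exact_mod_cast hc
  have e : c * ((∑ n ∈ Finset.range (c * N), u n) / (c * N : ℕ)) =
      (∑ n ∈ Finset.range (c * N), u n) / N := by
    push_cast
    rcases Nat.eq_zero_or_pos N with rfl | hN
    · simp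
    have hN' : (0:ℝ) < N := by exact_mod_cast hN
    field_simp
  rw [e]
  gcongr
  rw [← Finset.sum_image (f := u) (g := fun n => c * n) (s := Finset.range N)]
  · refine Finset.sum_le_sum_of_subset_of_nonneg ?_ (fun i _ _ => h0 i)
    intro x hx
    simp only [Finset.mem_image, Finset.mem_range] at hx ⊢
    obtain ⟨y, hy, rfl⟩ := hx
    exact Nat.mul_lt_mul_of_pos_left hy (by omega)
  · intro x _ y _ hxy
    exact Nat.eq_of_mul_eq_mul_left (by omega) hxy

end avz

structure Act {X : Type} [MeasurableSpace X] (μ : Measure X) (S : ℤ → X → X) : Prop where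
  zero : ∀ x, S 0 x = x
  add : ∀ m n x, S (m + n) x = S m (S n x)
  mp : ∀ n, MeasurePreserving (S n) μ μ

/-- bounded measurable functions -/
def Bd {X : Type} [MeasurableSpace X] (f : X → ℝ) : Prop := Measurable f ∧ ∀ x, |f x| ≤ 1

section bd
variable {X : Type} [MeasurableSpace X]

lemma Bd.mul {f g : X → ℝ} (hf : Bd f) (hg : Bd g) : Bd (fun x => f x * g x) :=
  ⟨hf.1.mul hg.1, fun x => by
    rw [abs_mul]; exact mul_le_one₀ (hf.2 x) (abs_nonneg _) (hg.2 x)⟩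

lemma Bd.comp {f : X → ℝ} (hf : Bd f) {T : X → X} (hT : Measurable T) : Bd (fun x => f (T x)) :=
  ⟨hf.1.comp hT, fun x => hf.2 _⟩

lemma Bd.prod {ι : Type*} (s : Finset ι) {f : ι → X → ℝ} (hf : ∀ i ∈ s, Bd (f i)) :
    Bd (fun x => ∏ i ∈ s, f i x) :=
  ⟨Finset.measurable_fun_prod s fun i hi => (hf i hi).1, fun x => by
    rw [Finset.abs_prod]
    exact Finset.prod_le_one (fun i _ => abs_nonneg _) fun i hi => (hf i hi).2 x⟩

lemma Bd.half_sub {f g : X → ℝ} (hf : Bd f) (hg : Bd g) : Bd (fun x => (f x - g x) / 2) :=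
  ⟨(hf.1.sub hg.1).div_const 2, fun x => by
    have h1 := abs_le.1 (hf.2 x)
    have h2 := abs_le.1 (hg.2 x)
    rw [abs_le]; constructor <;> linarith⟩

lemma Bd.sq {f : X → ℝ} (hf : Bd f) : Bd (fun x => f x ^ 2) := by
  simpa [_root_.sq] using hf.mul hf

lemma Bd.abs {f : X → ℝ} (hf : Bd f) : Bd (fun x => |f x|) :=
  ⟨hf.1.abs, fun x => by simpa using hf.2 x⟩

lemma Bd.integrable {f : X → ℝ} (hf : Bd f) (μ : Measure X) [IsFiniteMeasure μ] :
    Integrable f μ :=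
  Integrable.of_bound hf.1.aestronglyMeasurable 1 (ae_of_all _ fun x => hf.2 x)

lemma Bd.integral_le {f : X → ℝ} (hf : Bd f) (μ : Measure X) [IsProbabilityMeasure μ] :
    |∫ x, f x ∂μ| ≤ 1 := by
  have := norm_integral_le_of_norm_le_const (μ := μ) (f := f) (C := 1) (ae_of_all _ fun x => hf.2 x)
  simpa using this

lemma bd_one : Bd (fun _ : X => (1:ℝ)) := ⟨measurable_const, fun x => by simp⟩
lemma bd_zero : Bd (fun _ : X => (0:ℝ)) := ⟨measurable_const, fun x => by simp⟩

lemma bd_ind {A : Set X} (hA : MeasurableSet A) : Bd (A.indicator fun _ => (1:ℝ)) :=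
  ⟨measurable_const.indicator hA, fun x => by
    by_cases h : x ∈ A <;> simp [h]⟩

end bd

section ce
variable {X : Type} {Y : MeasurableSpace X} [mX : MeasurableSpace X] [StandardBorelSpace X]
  {μ : Measure X} [IsProbabilityMeasure μ]

/-- everywhere-defined conditional expectation -/
noncomputable def cE {X : Type} [mX : MeasurableSpace X] [StandardBorelSpace X] (μ : Measure X) [IsProbabilityMeasure μ] (Y : MeasurableSpace X)
    (f : X → ℝ) : X → ℝ := fun y => ∫ x, f x ∂(condExpKernel (mΩ := mX) μ Y y)

/-- `Y`-measurable bounded functions -/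
def BdY {X : Type} (Y : MeasurableSpace X) (f : X → ℝ) : Prop := Measurable[Y] f ∧ ∀ x, |f x| ≤ 1

lemma BdY.bd (hY : Y ≤ mX) {f : X → ℝ} (hf : BdY Y f) : Bd f := ⟨hf.1.mono hY le_rfl, hf.2⟩

lemma cE_bdY {f : X → ℝ} (hf : Bd f) : BdY Y (cE μ Y f) := by
  refine ⟨?_, fun y => hf.integral_le _⟩
  exact (hf.1.stronglyMeasurable.integral_condExpKernel).measurable

lemma cE_bd (hY : Y ≤ mX) {f : X → ℝ} (hf : Bd f) : Bd (cE μ Y f) := (cE_bdY hf).bd hY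

lemma cE_ae (hY : Y ≤ mX) {f : X → ℝ} (hf : Bd f) : cE μ Y f =ᵐ[μ] μ[f | Y] :=
  (condExp_ae_eq_integral_condExpKernel hY (hf.integrable μ)).symm

lemma cE_mul (hY : Y ≤ mX) {f g : X → ℝ} (hf : Bd f) (hg : BdY Y g) :
    cE μ Y (fun x => g x * f x) =ᵐ[μ] fun x => g x * cE μ Y f x := by
  have h1 := cE_ae (μ := μ) hY ((hg.bd hY).mul hf)
  have h2 := cE_ae (μ := μ) hY hf
  have h3 : μ[g * f | Y] =ᵐ[μ] g * μ[f | Y] :=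
    condExp_mul_of_stronglyMeasurable_left hg.1.stronglyMeasurable
      (((hg.bd hY).mul hf).integrable μ) (hf.integrable μ)
  refine h1.trans (h3.trans ?_)
  filter_upwards [h2] with x hx
  simp [hx]

lemma int_cE (hY : Y ≤ mX) {f : X → ℝ} (hf : Bd f) : ∫ x, cE μ Y f x ∂μ = ∫ x, f x ∂μ := by
  rw [integral_congr_ae (cE_ae hY hf), integral_condExp hY]

lemma int_mul_cE (hY : Y ≤ mX) {f g : X → ℝ} (hf : Bd f) (hg : BdY Y g) :
    ∫ x, g x * f x ∂μ = ∫ x, g x * cE μ Y f x ∂μ := by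
  rw [← int_cE hY ((hg.bd hY).mul hf), integral_congr_ae (cE_mul hY hf hg)]

lemma cE_self (hY : Y ≤ mX) {g : X → ℝ} (hg : BdY Y g) : cE μ Y g =ᵐ[μ] g := by
  have := cE_mul (μ := μ) hY (bd_one) hg
  simpa [cE] using this

lemma cE_congr (hY : Y ≤ mX) {f g : X → ℝ} (hf : Bd f) (hg : Bd g) (h : f =ᵐ[μ] g) :
    cE μ Y f =ᵐ[μ] cE μ Y g :=
  (cE_ae hY hf).trans ((condExp_congr_ae h).trans (cE_ae hY hg).symm)

lemma cE_unique (hY : Y ≤ mX) {f g : X → ℝ} (hf : Bd f) (hg : BdY Y g)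
    (h : ∀ B, MeasurableSet[Y] B → ∫ x in B, g x ∂μ = ∫ x in B, f x ∂μ) : cE μ Y f =ᵐ[μ] g := by
  refine (cE_ae hY hf).trans ?_
  refine (ae_eq_condExp_of_forall_setIntegral_eq hY (hf.integrable μ) ?_ ?_ ?_).symm
  · intro s _ _; exact ((hg.bd hY).integrable μ).integrableOn
  · intro s hs _; exact h s hs
  · exact hg.1.stronglyMeasurable.aestronglyMeasurable

lemma cE_sub {f g : X → ℝ} (hf : Bd f) (hg : Bd g) (y : X) :
    cE μ Y (fun x => f x - g x) y = cE μ Y f y - cE μ Y g y :=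
  integral_sub (hf.integrable _) (hg.integrable _)

/-- invariance of a σ-algebra -/
def Inv {X : Type} (S : ℤ → X → X) (Y : MeasurableSpace X) : Prop := ∀ n, @Measurable _ _ Y Y (S n)

variable {S : ℤ → X → X}

lemma Act.measurable (h : Act μ S) (n : ℤ) : Measurable (S n) := (h.mp n).measurable

lemma Act.cancel (h : Act μ S) (n : ℤ) (x : X) : S n (S (-n) x) = x := by
  rw [← h.add, add_neg_cancel, h.zero]

lemma Act.cancel' (h : Act μ S) (n : ℤ) (x : X) : S (-n) (S n x) = x := by
  rw [← h.add, neg_add_cancel, h.zero]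

lemma Act.integral (h : Act μ S) (n : ℤ) {f : X → ℝ} (hf : Bd f) :
    ∫ x, f (S n x) ∂μ = ∫ x, f x ∂μ := by
  have := integral_map (μ := μ) (h.mp n).aemeasurable (f := f)
    hf.1.aestronglyMeasurable
  rw [(h.mp n).map_eq] at this
  exact this.symm

lemma Act.ae (h : Act μ S) (n : ℤ) {p : X → Prop} (hp : ∀ᵐ x ∂μ, p x) : ∀ᵐ x ∂μ, p (S n x) :=
  (h.mp n).quasiMeasurePreserving.ae hp

lemma cE_comp (h : Act μ S) (hY : Y ≤ mX) (hI : Inv S Y) (n : ℤ) {f : X → ℝ} (hf : Bd f) :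
    cE μ Y (fun x => f (S n x)) =ᵐ[μ] fun x => cE μ Y f (S n x) := by
  refine cE_unique hY (hf.comp (h.measurable n)) ⟨(cE_bdY hf).1.comp (hI n), fun x => (cE_bdY hf).2 _⟩ ?_
  intro B hB
  have hB' : MeasurableSet[Y] (S (-n) ⁻¹' B) := hI (-n) hB
  have key : ∀ g : X → ℝ, Bd g → ∫ x in B, g (S n x) ∂μ = ∫ x in S (-n) ⁻¹' B, g x ∂μ := by
    intro g hg
    rw [← integral_indicator (hY _ hB), ← integral_indicator (hY _ hB')]
    rw [← h.integral n (f := (S (-n) ⁻¹' B).indicator g)]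
    · congr 1
      ext x
      have e : (S n x ∈ S (-n) ⁻¹' B) = (x ∈ B) := by
        rw [Set.mem_preimage, h.cancel']
      by_cases hx : x ∈ B
      · rw [Set.indicator_of_mem hx, Set.indicator_of_mem (e.symm ▸ hx)]
      · rw [Set.indicator_of_notMem hx, Set.indicator_of_notMem (e.symm ▸ hx)]
    · refine ⟨hg.1.indicator (hY _ hB'), fun x => ?_⟩
      by_cases hx : x ∈ S (-n) ⁻¹' B
      · simpa [Set.indicator_of_mem hx] using hg.2 x
      · simp [Set.indicator_of_notMem hx]
  rw [key _ (cE_bd hY hf), key _ hf, setIntegral_congr_ae (hY _ hB')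
    ((cE_ae hY hf).mono fun x hx _ => hx), setIntegral_condExp hY (hf.integrable μ) hB']

def WM {X : Type} [mX : MeasurableSpace X] [StandardBorelSpace X] (μ : Measure X) [IsProbabilityMeasure μ] (S : ℤ → X → X) (Y : MeasurableSpace X) : Prop :=
  ∀ f : X → ℝ, @Bd X mX f → cE (mX := mX) μ Y f =ᵐ[μ] 0 →
    AvZ (fun n => ∫ x, (cE (mX := mX) μ Y (fun x => f x * f (S n x)) x) ^ 2 ∂μ)

end ce
end PSz
end Part3

section Part4
open MeasureTheory ProbabilityTheory Filter Topology
open scoped Polynomial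

namespace PSz

section pet
set_option linter.unusedSectionVars false
set_option linter.unusedVariables false

lemma shift_nonconst (q : ℤ[X]) (hq : 2 ≤ q.natDegree) (h h' : ℤ) (hne : h ≠ h') :
    1 ≤ (q.comp (Polynomial.X + Polynomial.C h) - q.comp (Polynomial.X + Polynomial.C h')).natDegree := by
  by_contra hcon
  have h0 : (q.comp (Polynomial.X + Polynomial.C h) - q.comp (Polynomial.X + Polynomial.C h')).natDegree = 0 := by omega
  rw [Polynomial.natDegree_eq_zero] at h0
  obtain ⟨c, hc⟩ := h0
  have hev : ∀ x : ℤ, q.eval (x + h) = q.eval (x + h') + c := by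
    intro x
    have := congrArg (Polynomial.eval x) hc
    simp at this
    linarith
  have hn : ∀ n : ℕ, q.eval (h' + n * (h - h')) = q.eval h' + n * c := by
    intro n
    induction n with
    | zero => simp
    | succ n ih =>
      have := hev (h' + n * (h - h') - h')
      rw [show h' + n * (h - h') - h' + h = h' + (n+1:ℕ) * (h - h') by push_cast; ring,
        show h' + n * (h - h') - h' + h' = h' + n * (h - h') by ring, ih] at this
      rw [this]; push_cast; ring
  have heq : q.comp (Polynomial.C h' + Polynomial.C (h - h') * Polynomial.X) =
      Polynomial.C (q.eval h') + Polynomial.C c * Polynomial.X := by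
    apply Polynomial.eq_of_infinite_eval_eq
    refine Set.Infinite.mono (s := Set.range (fun n : ℕ => (n:ℤ))) ?_
      (Set.infinite_range_of_injective Nat.cast_injective)
    rintro _ ⟨n, rfl⟩
    have := hn n
    simp only [Set.mem_ofPred_eq, Polynomial.eval_comp, Polynomial.eval_add, Polynomial.eval_mul,
      Polynomial.eval_C, Polynomial.eval_X]
    rw [mul_comm (h - h'), this]; ring
  have hd := congrArg Polynomial.natDegree heq
  rw [Polynomial.natDegree_comp] at hd
  have h1 : (Polynomial.C h' + Polynomial.C (h - h') * Polynomial.X).natDegree = 1 := by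
    rw [add_comm]
    exact Polynomial.natDegree_linear (sub_ne_zero.2 hne)
  have h2 : (Polynomial.C (q.eval h') + Polynomial.C c * Polynomial.X).natDegree ≤ 1 := by
    rw [add_comm]
    exact Polynomial.natDegree_linear_le
  rw [h1] at hd
  omega

variable {X : Type} {Y : MeasurableSpace X} [mX : MeasurableSpace X] [StandardBorelSpace X]
  {μ : Measure X} [IsProbabilityMeasure μ] {S : ℤ → X → X}

lemma bd_corr (hA : Act μ S) {ι : Type} [Fintype ι] (Q : ι → ℤ) (f : ι → X → ℝ)
    (hf : ∀ i, Bd (f i)) : Bd (fun x => ∏ i, f i (S (Q i) x)) :=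
  Bd.prod _ fun i _ => (hf i).comp (hA.measurable _)

/-- unrooting -/
lemma corr_root (hA : Act μ S) {ι : Type} [Fintype ι] [DecidableEq ι] (P : ι → ℤ) (g : ι → X → ℝ)
    (hg : ∀ i, Bd (g i)) (r : ι) :
    ∫ x, ∏ i, g i (S (P i) x) ∂μ =
      ∫ x, g r x * ∏ i : {i // i ≠ r}, g i (S (P i - P r) x) ∂μ := by
  have hb : Bd (fun x => g r x * ∏ i : {i // i ≠ r}, g i (S (P i - P r) x)) :=
    (hg r).mul (bd_corr hA (fun i : {i // i ≠ r} => P i - P r) (fun i => g i) fun i => hg i)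
  rw [← hA.integral (P r) hb]
  congr 1
  ext x
  rw [Fintype.prod_eq_mul_prod_subtype_ne _ r]
  congr 1
  refine Finset.prod_congr rfl fun i _ => ?_
  rw [← hA.add, sub_add_cancel]

/-- the two-sided correlation statement -/
def PetS {X : Type} [mX : MeasurableSpace X] [StandardBorelSpace X] (μ : Measure X)
    [IsProbabilityMeasure μ] (S : ℤ → X → X) (Y : MeasurableSpace X)
    {ι : Type} [Fintype ι] (Q : ι → ℤ[X]) : Prop :=
  ∀ (f0 : X → ℝ) (f : ι → X → ℝ), @Bd X mX f0 → (∀ i, @Bd X mX (f i)) →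
    AvZ (fun n => ∫ x, f0 x * ∏ i, f i (S ((Q i).eval (n:ℤ)) x) ∂μ -
      ∫ x, cE (mX := mX) μ Y f0 x * ∏ i, cE (mX := mX) μ Y (f i) (S ((Q i).eval (n:ℤ)) x) ∂μ)

lemma pet_telescope (hA : Act μ S) (hY : Y ≤ mX) (hI : Inv S Y)
    {ι : Type} [Fintype ι] [DecidableEq ι] (Q : ι → ℤ[X])
    (H : ∀ (f0 : X → ℝ) (f : ι → X → ℝ), Bd f0 → (∀ i, Bd (f i)) → ∀ j, cE μ Y (f j) =ᵐ[μ] 0 →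
      AvZ (fun n => ∫ x, f0 x * ∏ i, f i (S ((Q i).eval (n:ℤ)) x) ∂μ)) : PetS μ S Y Q := by
  intro f0 f hf0 hf
  have main : ∀ s : Finset ι, AvZ (fun n => ∫ x, f0 x * ∏ i, f i (S ((Q i).eval (n:ℤ)) x) ∂μ -
      ∫ x, f0 x * ∏ i, (if i ∈ s then cE μ Y (f i) else f i) (S ((Q i).eval (n:ℤ)) x) ∂μ) := by
    intro s
    induction s using Finset.induction_on with
    | empty => simpa using avz_zero
    | insert j s hj ih =>
      set g : ι → X → ℝ := fun i => if i ∈ s then cE μ Y (f i) else f i with hg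
      have hgB : ∀ i, Bd (g i) := by
        intro i
        simp only [hg]
        split_ifs
        · exact cE_bd hY (hf i)
        · exact hf i
      set d : X → ℝ := fun x => (f j x - cE μ Y (f j) x) / 2 with hd
      have hdB : Bd d := (hf j).half_sub (cE_bd hY (hf j))
      have hd0 : cE μ Y d =ᵐ[μ] 0 := by
        have h1 := cE_self (μ := μ) hY (cE_bdY (μ := μ) (Y := Y) (hf j))
        filter_upwards [h1] with x hx
        have e : d = fun x => (1/2 : ℝ) * (f j x - cE μ Y (f j) x) := by
          ext x; simp only [hd]; ring
        have e2 : cE μ Y d x = (1/2) * (cE μ Y (fun x => f j x - cE μ Y (f j) x) x) := by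
          rw [e]; exact integral_const_mul _ _
        rw [e2, cE_sub (hf j) (cE_bd hY (hf j)), hx]
        simp
      have hupB : ∀ i, Bd (Function.update g j d i) := by
        intro i
        by_cases hij : i = j
        · subst hij; simpa using hdB
        · simpa [Function.update_of_ne hij] using hgB i
      have h1 := H f0 (Function.update g j d) hf0 hupB j (by simpa using hd0)
      refine AvZ.congr (ih.add (h1.const_mul 2)) fun n => ?_
      have key : 2 * ∫ x, f0 x * ∏ i, Function.update g j d i (S ((Q i).eval (n:ℤ)) x) ∂μ =
          ∫ x, f0 x * ∏ i, g i (S ((Q i).eval (n:ℤ)) x) ∂μ -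
          ∫ x, f0 x * ∏ i, (if i ∈ insert j s then cE μ Y (f i) else f i)
            (S ((Q i).eval (n:ℤ)) x) ∂μ := by
        rw [← integral_const_mul, ← integral_sub]
        · congr 1
          ext x
          rw [Fintype.prod_eq_mul_prod_subtype_ne (fun i => Function.update g j d i (S ((Q i).eval (n:ℤ)) x)) j,
            Fintype.prod_eq_mul_prod_subtype_ne (fun i => g i (S ((Q i).eval (n:ℤ)) x)) j,
            Fintype.prod_eq_mul_prod_subtype_ne (fun i => (if i ∈ insert j s then cE μ Y (f i) else f i)
            (S ((Q i).eval (n:ℤ)) x)) j]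
          have e1 : ∏ i : {i // i ≠ j}, Function.update g j d i (S ((Q i).eval (n:ℤ)) x) =
              ∏ i : {i // i ≠ j}, g i (S ((Q i).eval (n:ℤ)) x) := by
            refine Finset.prod_congr rfl fun i _ => ?_
            rw [Function.update_of_ne i.2]
          have e2 : ∏ i : {i // i ≠ j}, (if (i:ι) ∈ insert j s then cE μ Y (f i) else f i) (S ((Q i).eval (n:ℤ)) x) =
              ∏ i : {i // i ≠ j}, g i (S ((Q i).eval (n:ℤ)) x) := by
            refine Finset.prod_congr rfl fun i _ => ?_
            simp only [hg, Finset.mem_insert, i.2, false_or]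
          rw [e1, e2]
          simp only [Function.update_self, Finset.mem_insert_self, if_true]
          have e3 : g j = f j := by simp [hg, hj]
          rw [e3]
          simp only [hd]
          ring
        · exact (hf0.mul (bd_corr hA _ _ hgB)).integrable μ
        · refine (hf0.mul (bd_corr hA (fun i => (Q i).eval (n:ℤ)) (fun i => if i ∈ insert j s then cE μ Y (f i) else f i) ?_)).integrable μ
          intro i
          split_ifs
          · exact cE_bd hY (hf i)
          · exact hf i
      rw [key]
      ring
  refine AvZ.congr (main Finset.univ) fun n => ?_
  congr 1
  have hp : BdY Y (fun x => ∏ i, cE μ Y (f i) (S ((Q i).eval (n:ℤ)) x)) := by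
    refine ⟨?_, (bd_corr hA _ _ fun i => cE_bd hY (hf i)).2⟩
    exact Finset.measurable_fun_prod _ fun i _ => (cE_bdY (hf i)).1.comp (hI _)
  have := int_mul_cE (μ := μ) hY hf0 hp
  simp only [Finset.mem_univ, if_true]
  simp_rw [mul_comm (f0 _), mul_comm (cE μ Y f0 _)]
  exact this.symm

/-- averages of the relative correlations along multiples go to zero. -/
lemma wm_linear (hA : Act μ S) (hY : Y ≤ mX) (hI : Inv S Y) (hwm : WM μ S Y) {f : X → ℝ}
    (hf : Bd f) (h0 : cE μ Y f =ᵐ[μ] 0) (c : ℤ) (hc : c ≠ 0) :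
    AvZ (fun h => ∫ x, |cE μ Y (fun x => f x * f (S (c * h) x)) x| ∂μ) := by
  have hfm : ∀ m : ℤ, Bd (fun x => f x * f (S m x)) := fun m => hf.mul (hf.comp (hA.measurable m))
  set w : ℤ → ℝ := fun m => ∫ x, (cE μ Y (fun x => f x * f (S m x)) x) ^ 2 ∂μ with hw
  have hneg : ∀ m, w (-m) = w m := by
    intro m
    have h1 := cE_comp hA hY hI m (hfm (-m))
    have h2 : (fun x => f (S m x) * f (S (-m) (S m x))) = fun x => f x * f (S m x) := by
      ext x; rw [hA.cancel']; ring
    rw [h2] at h1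
    simp only [hw]
    rw [← hA.integral m (cE_bd hY (hfm (-m))).sq]
    refine integral_congr_ae ?_
    filter_upwards [h1] with x hx
    rw [hx]
  have h1 : AvZ (fun n => w n) := hwm f hf h0
  have hnn : ∀ n, 0 ≤ w n := fun n => integral_nonneg fun x => sq_nonneg _
  have h2 := h1.mul_index (fun n => hnn n) c.natAbs (by omega)
  have h3 : ∀ h : ℕ, w (c * h) = w ((c.natAbs * h : ℕ):ℤ) := by
    intro h
    push_cast
    rcases abs_choice c with e | e
    · rw [e]
    · rw [e, neg_mul, hneg]
  have h4 : AvZ (fun h => (∫ x, |cE μ Y (fun x => f x * f (S (c * h) x)) x| ∂μ) ^ 2) := by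
    refine AvZ.squeeze h2 (fun n => sq_nonneg _) fun h => ?_
    rw [← h3]
    have hb := cE_bd (μ := μ) hY (hfm (c * h))
    have := variance_nonneg (fun x => |cE μ Y (fun x => f x * f (S (c * h) x)) x|) μ
    rw [variance_eq_sub] at this
    · simp only [Pi.pow_apply, sq_abs] at this
      linarith
    · exact MemLp.of_bound hb.abs.1.aestronglyMeasurable 1 (ae_of_all _ fun x => hb.abs.2 x)
  refine AvZ.congr h4.of_sq fun h => ?_
  rw [abs_of_nonneg]
  exact integral_nonneg fun x => abs_nonneg _

theorem pet (hA : Act μ S) (hY : Y ≤ mX) (hI : Inv S Y) (hwm : WM μ S Y) (W : Finset ℤ[X]) :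
    ∀ (ι : Type) [Fintype ι] [DecidableEq ι] (Q : ι → ℤ[X]), (∀ q, q ∈ W ↔ ∃ i, Q i = q) →
      (∀ i, 1 ≤ (Q i).natDegree) → (∀ i j, i ≠ j → 1 ≤ (Q i - Q j).natDegree) →
      PetS μ S Y Q := by
  classical
  induction W using wlt_wf.induction with
  | h W ih =>
  intro ι _ _ Q hW hdeg hdiff
  apply pet_telescope hA hY hI
  intro f0 f hf0 hf j hj
  obtain ⟨s, -, hs⟩ := Finset.exists_min_image Finset.univ (fun i => (Q i).natDegree) ⟨j, by simp⟩
  replace hs : ∀ i, (Q s).natDegree ≤ (Q i).natDegree := fun i => hs i (by simp)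
  set sh : ℤ[X] → ℕ → ℤ[X] := fun q h => q.comp (Polynomial.X + Polynomial.C (h:ℤ)) with hsh
  -- bad shifts
  set bad : Set ℕ := {h | ∃ i k, 2 ≤ (Q i).natDegree ∧ (sh (Q i) h - Q k).natDegree = 0} with hbad
  have hbadfin : bad.Finite := by
    have e : bad = ⋃ i, ⋃ k, {h | 2 ≤ (Q i).natDegree ∧ (sh (Q i) h - Q k).natDegree = 0} := by
      ext h; simp [hbad]
    rw [e]
    refine Set.finite_iUnion fun i => Set.finite_iUnion fun k => Set.Subsingleton.finite ?_
    rintro h ⟨h1, h2⟩ h' ⟨_, h2'⟩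
    by_contra hne
    have := shift_nonconst (Q i) h1 h h' (by exact_mod_cast hne)
    have e : sh (Q i) h - sh (Q i) h' = (sh (Q i) h - Q k) - (sh (Q i) h' - Q k) := by ring
    have h3 := Polynomial.natDegree_sub_le (sh (Q i) h - Q k) (sh (Q i) h' - Q k)
    rw [← e, h2, h2'] at h3
    exact absurd (this.trans h3) (by simp)
  set u : ℕ → X → ℝ := fun n x => ∏ i, f i (S ((Q i).eval (n:ℤ)) x) with hu
  have huB : ∀ n, Bd (u n) := fun n => bd_corr hA _ _ hf
  set c : ℕ → ℕ → ℝ := fun m n => ∫ x, u m x * u n x ∂μ with hc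
  have hcB : ∀ m n, |c m n| ≤ 1 := fun m n => ((huB m).mul (huB n)).integral_le μ
  set J : ℕ → ℝ := fun N => ∫ x, ((∑ n ∈ Finset.range N, u n x) / N) ^ 2 ∂μ with hJ
  have hmeas : ∀ N : ℕ, Bd (fun x => (∑ n ∈ Finset.range N, u n x) / N) := by
    intro N
    refine ⟨(Finset.measurable_fun_sum _ fun n _ => (huB n).1).div_const _, fun x => ?_⟩
    rw [abs_div, Nat.abs_cast]
    rcases Nat.eq_zero_or_pos N with rfl | hN
    · simp
    rw [div_le_one (by exact_mod_cast hN)]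
    refine (Finset.abs_sum_le_sum_abs _ _).trans ?_
    refine (Finset.sum_le_sum fun n _ => (huB n).2 x).trans ?_
    simp
  -- the coefficient functions
  set lc : ι → ℤ := fun i => (Q i).leadingCoeff with hlc
  set b : ℕ → ℝ := fun h => if h ∈ bad then 1 else
    if 2 ≤ (Q j).natDegree then 0 else
      ∫ x, |cE μ Y (fun x => f j x * f j (S (lc j * h) x)) x| ∂μ with hb
  have hb0 : ∀ h, 0 ≤ b h := by
    intro h
    simp only [hb]
    split_ifs
    · norm_num
    · norm_num
    · exact integral_nonneg fun x => abs_nonneg _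
  have hbav : AvZ b := by
    refine AvZ.finite (v := fun h => if 2 ≤ (Q j).natDegree then 0 else
      ∫ x, |cE μ Y (fun x => f j x * f j (S (lc j * h) x)) x| ∂μ) ?_ hbadfin.toFinset ?_
    · split_ifs with h2
      · exact avz_zero
      · refine wm_linear hA hY hI hwm (hf j) hj (lc j) ?_
        simp only [hlc]
        rw [Polynomial.leadingCoeff_ne_zero]
        rintro h0
        have := hdeg j
        rw [h0] at this
        simp at this
    · intro n hn
      simp only [Set.Finite.mem_toFinset] at hn
      simp only [hb, if_neg hn]
  have hJlim : Tendsto J atTop (𝓝 0) := by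
    refine vdc_abstract c (fun m n => by simp only [hc]; congr 1; ext x; ring) hcB J
      (fun N => integral_nonneg fun x => sq_nonneg _) ?_ b hb0 ?_ hbav
    · intro N H hN hH
      have hpt : ∀ x, ((∑ n ∈ Finset.range N, u n x) / N) ^ 2 ≤
          2 / (H:ℝ) ^ 2 * ∑ h ∈ Finset.range H, ∑ h' ∈ Finset.range H,
          (∑ n ∈ Finset.range N, u (n + h) x * u (n + h') x) / N + 8 * (H:ℝ) ^ 2 / (N:ℝ) ^ 2 :=
        fun x => vdc_pointwise (fun n => u n x) (fun n => (huB n).2 x) N H hN hH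
      have hintg : ∀ h h', Integrable (fun x => (∑ n ∈ Finset.range N, u (n + h) x * u (n + h') x) / N) μ :=
        fun h h' => (integrable_finsetSum _ fun n _ => ((huB _).mul (huB _)).integrable μ).div_const _
      have hint2 : Integrable (fun x => 2 / (H:ℝ) ^ 2 * ∑ h ∈ Finset.range H, ∑ h' ∈ Finset.range H,
          (∑ n ∈ Finset.range N, u (n + h) x * u (n + h') x) / N) μ :=
        (integrable_finsetSum _ fun h _ => integrable_finsetSum _ fun h' _ => hintg h h').const_mul _
      refine (integral_mono ((hmeas N).sq.integrable μ) (hint2.add (integrable_const _)) hpt).trans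
        (le_of_eq ?_)
      simp only [Pi.add_apply]
      rw [integral_add hint2 (integrable_const _), integral_const_mul, integral_finsetSum _
        (fun h _ => integrable_finsetSum _ fun h' _ => hintg h h')]
      simp only [integral_const, probReal_univ, one_smul]
      congr 2
      refine Finset.sum_congr rfl fun h _ => ?_
      rw [integral_finsetSum _ fun h' _ => hintg h h']
      refine Finset.sum_congr rfl fun h' _ => ?_
      rw [integral_div, integral_finsetSum _ fun n _ => ((huB _).mul (huB _)).integrable μ]
    · intro h ε hε
      by_cases hbd : h ∈ bad
      · filter_upwards [eventually_gt_atTop 0] with N hN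
        simp only [hb, if_pos hbd]
        have hN' : (0:ℝ) < N := by exact_mod_cast hN
        rw [div_le_iff₀ hN']
        have : ∑ n ∈ Finset.range N, c n (n + h) ≤ ∑ n ∈ Finset.range N, (1:ℝ) :=
          Finset.sum_le_sum fun n _ => (abs_le.1 (hcB _ _)).2
        simp at this
        nlinarith
      -- the good case
      set P : ι ⊕ {i // 2 ≤ (Q i).natDegree} → ℤ[X] :=
        Sum.elim Q (fun i => sh (Q i) h) with hP
      set g : ι ⊕ {i // 2 ≤ (Q i).natDegree} → X → ℝ :=
        Sum.elim (fun i => if 2 ≤ (Q i).natDegree then f i else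
          fun x => f i x * f i (S (lc i * h) x)) (fun i => f i) with hg
      have hgB : ∀ x, Bd (g x) := by
        rintro (i | i)
        · simp only [hg, Sum.elim_inl]
          split_ifs
          · exact hf i
          · exact (hf i).mul ((hf i).comp (hA.measurable _))
        · exact hf i
      have hceB : ∀ x, Bd (cE μ Y (g x)) := fun x => cE_bd hY (hgB x)
      have hcn : ∀ n : ℕ, c n (n + h) = ∫ x, ∏ i, g i (S ((P i).eval (n:ℤ)) x) ∂μ := by
        intro n
        simp only [hc]
        congr 1
        ext x
        rw [Fintype.prod_sum_type]
        simp only [hu, hg, hP, Sum.elim_inl, Sum.elim_inr]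
        have e1 : ∏ a : {i // 2 ≤ (Q i).natDegree}, f a (S ((sh (Q a) h).eval (n:ℤ)) x) =
            ∏ i, if 2 ≤ (Q i).natDegree then f i (S ((sh (Q i) h).eval (n:ℤ)) x) else 1 := by
          rw [← Finset.prod_filter, Finset.prod_subtype (p := fun i => 2 ≤ (Q i).natDegree)
            (Finset.univ.filter fun i => 2 ≤ (Q i).natDegree) (by simp)]
        rw [e1, ← Finset.prod_mul_distrib, ← Finset.prod_mul_distrib]
        refine Finset.prod_congr rfl fun i _ => ?_
        split_ifs with h2
        · simp [hsh]
        · simp only [mul_one]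
          rw [← hA.add]
          congr 3
          have h1 : (Q i).natDegree = 1 := by have := hdeg i; omega
          have h3 := Polynomial.eq_X_add_C_of_natDegree_le_one h1.le
          have h4 : lc i = (Q i).coeff 1 := by simp only [hlc]; rw [Polynomial.leadingCoeff, h1]
          have h5 : ∀ z : ℤ, (Q i).eval z = (Q i).coeff 1 * z + (Q i).coeff 0 := by
            intro z
            conv_lhs => rw [h3]
            simp
          rw [h4, h5, h5]
          push_cast
          ring
      have hroot := fun n : ℕ => corr_root hA (fun i => (P i).eval (n:ℤ)) g hgB (Sum.inl s)
      have hroot' := fun n : ℕ => corr_root hA (fun i => (P i).eval (n:ℤ)) (fun i => cE μ Y (g i)) hceB (Sum.inl s)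
      have hne : ∀ x y, x ≠ y → 1 ≤ (P x - P y).natDegree := by
        have hns : ∀ (i : ι) (k : ι), 2 ≤ (Q i).natDegree → 1 ≤ (sh (Q i) h - Q k).natDegree := by
          intro i k hi
          by_contra hcon
          exact hbd ⟨i, k, hi, by omega⟩
        rintro (i | i) (k | k) hik
        · exact hdiff i k fun e => hik (by rw [e])
        · have := hns k i k.2
          rw [← Polynomial.natDegree_neg] at this
          simpa [hP] using this
        · exact hns i k i.2
        · have : (sh (Q i) h - sh (Q k) h) = (Q i - Q k).comp (Polynomial.X + Polynomial.C (h:ℤ)) := by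
            simp [hsh]
          simp only [hP, Sum.elim_inr]
          rw [this, shift_deg]
          refine hdiff _ _ fun e => hik ?_
          rw [Subtype.ext e]
      set Q2 : {x // x ≠ Sum.inl (β := {i // 2 ≤ (Q i).natDegree}) s} → ℤ[X] :=
        fun x => P x - P (Sum.inl s) with hQ2
      have hlt : WLt (Finset.univ.image Q2) W := by
        refine wlt_of_step _ _ (Q s) ((hW _).2 ⟨s, rfl⟩) ?_
        intro q' hq'
        rw [Finset.mem_image] at hq'
        obtain ⟨⟨x, hx⟩, -, rfl⟩ := hq'
        rcases x with i | i
        · have := step_trichotomy (Q i) (Q s) 0 0 (hdeg s) (hs i)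
          simp only [map_zero, add_zero, Polynomial.comp_X, sub_zero] at this
          rcases this with h1 | h1
          · exact Or.inl h1
          · exact Or.inr ⟨Q i, (hW _).2 ⟨i, rfl⟩, h1⟩
        · have := step_trichotomy (Q i) (Q s) h 0 (hdeg s) (hs i)
          simp only [map_zero, sub_zero] at this
          rcases this with h1 | h1
          · exact Or.inl h1
          · exact Or.inr ⟨Q i, (hW _).2 ⟨i, rfl⟩, h1⟩
      have hpet := ih _ hlt {x // x ≠ Sum.inl (β := {i // 2 ≤ (Q i).natDegree}) s} Q2
        (by intro q; simp) (fun x => hne _ _ x.2) (by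
          intro x y hxy
          have e : Q2 x - Q2 y = P x - P y := by simp only [hQ2]; ring
          rw [e]
          exact hne _ _ fun e => hxy (Subtype.ext e)) (g (Sum.inl s)) (fun x => g x)
          (hgB _) (fun x => hgB x)
      have hpet2 : AvZ (fun n => c n (n + h) -
          ∫ x, ∏ i, cE μ Y (g i) (S ((P i).eval (n:ℤ)) x) ∂μ) := by
        refine AvZ.congr hpet fun n => ?_
        rw [hcn, hroot, hroot']
        simp only [hQ2, Polynomial.eval_sub]
      have hbound : ∀ n : ℕ, ∫ x, ∏ i, cE μ Y (g i) (S ((P i).eval (n:ℤ)) x) ∂μ ≤ b h := by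
        intro n
        have h1 : ∫ x, ∏ i, cE μ Y (g i) (S ((P i).eval (n:ℤ)) x) ∂μ ≤
            ∫ x, |cE μ Y (g (Sum.inl j)) (S ((Q j).eval (n:ℤ)) x)| ∂μ := by
          refine integral_mono ((bd_corr hA _ _ hceB).integrable μ)
            (((hceB (Sum.inl j)).comp (hA.measurable _)).abs.integrable μ) fun x => ?_
          refine (le_abs_self _).trans ?_
          simp only
          rw [Fintype.prod_eq_mul_prod_subtype_ne _ (Sum.inl j), abs_mul]
          have := (bd_corr hA (fun i : {i // i ≠ Sum.inl (β := {i // 2 ≤ (Q i).natDegree}) j} => (P i).eval (n:ℤ))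
            (fun i => cE μ Y (g i)) (fun i => hceB i)).2 x
          exact mul_le_of_le_one_right (abs_nonneg _) this
        rw [hA.integral ((Q j).eval (n:ℤ)) (hceB (Sum.inl j)).abs] at h1
        refine h1.trans ?_
        simp only [hb, if_neg hbd]
        split_ifs with h2
        · have : ∫ x, |cE μ Y (g (Sum.inl j)) x| ∂μ = 0 := by
            have e : g (Sum.inl j) = f j := by simp [hg, h2]
            rw [e, integral_congr_ae (g := fun _ => (0:ℝ))]
            · simp
            · filter_upwards [hj] with x hx
              simp [hx]
          exact this.le
        · have e : g (Sum.inl j) = fun x => f j x * f j (S (lc j * h) x) := by simp [hg, h2]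
          rw [e]
      have := (hpet2.eventually_le_const (show (0:ℝ) < ε from hε))
      filter_upwards [this, eventually_gt_atTop 0] with N h1 hN
      have hN' : (0:ℝ) < N := by exact_mod_cast hN
      rw [div_le_iff₀ hN'] at h1 ⊢
      rw [Finset.sum_sub_distrib] at h1
      have h2 : ∑ n ∈ Finset.range N, ∫ x, ∏ i, cE μ Y (g i) (S ((P i).eval (n:ℤ)) x) ∂μ ≤
          ∑ n ∈ Finset.range N, b h := Finset.sum_le_sum fun n _ => hbound n
      simp only [Finset.sum_const, Finset.card_range, nsmul_eq_mul] at h2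
      linarith
  -- conclude
  unfold AvZ
  have hsq : Tendsto (fun N => Real.sqrt (J N)) atTop (𝓝 0) := by simpa using hJlim.sqrt
  refine squeeze_zero_norm (fun N => ?_) hsq
  rw [Real.norm_eq_abs]
  apply Real.abs_le_sqrt
  have e : (∑ n ∈ Finset.range N, ∫ x, f0 x * ∏ i, f i (S ((Q i).eval (n:ℤ)) x) ∂μ) / N =
      ∫ x, f0 x * ((∑ n ∈ Finset.range N, u n x) / N) ∂μ := by
    rw [← integral_finsetSum _ fun n _ => (hf0.mul (huB n)).integrable μ, ← integral_div]
    congr 1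
    ext x
    rw [← Finset.mul_sum, mul_div_assoc]
  rw [e]
  have hB := hf0.mul (hmeas N)
  have := variance_nonneg (fun x => f0 x * ((∑ n ∈ Finset.range N, u n x) / N)) μ
  rw [variance_eq_sub] at this
  · simp only [Pi.pow_apply] at this
    have h2 : ∫ x, (f0 x * ((∑ n ∈ Finset.range N, u n x) / N)) ^ 2 ∂μ ≤ J N := by
      refine integral_mono (hB.sq.integrable μ) ((hmeas N).sq.integrable μ) fun x => ?_
      simp only [mul_pow]
      refine mul_le_of_le_one_left (sq_nonneg _) ?_
      rw [← sq_abs]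
      exact pow_le_one₀ (abs_nonneg _) (hf0.2 x)
    linarith
  · exact MemLp.of_bound hB.1.aestronglyMeasurable 1 (ae_of_all _ fun x => hB.2 x)

end pet
end PSz
end Part4

section Part5
open MeasureTheory ProbabilityTheory Filter Topology
open scoped Polynomial

namespace PSz

section sz
set_option linter.unusedSectionVars false
set_option linter.unusedVariables false

/-- return set -/
def RS {X : Type} (S : ℤ → X → X) (r k : ℕ) (A : Set X) (d : ℕ) : Set X :=
  {x | ∀ i ≤ k, S ((i:ℤ) * (d:ℤ) ^ r) x ∈ A}

def SZ {X : Type} [mX : MeasurableSpace X] (μ : Measure X) (S : ℤ → X → X) (r : ℕ)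
    (Y : MeasurableSpace X) : Prop :=
  ∀ A, MeasurableSet[Y] A → 0 < μ.real A → ∀ k, ¬ AvZ (fun d => μ.real (RS S r k A d))

variable {X : Type} {Y : MeasurableSpace X} [mX : MeasurableSpace X] [StandardBorelSpace X]
  {μ : Measure X} [IsProbabilityMeasure μ] {S : ℤ → X → X}

lemma RS_eq (S : ℤ → X → X) (r k : ℕ) (A : Set X) (d : ℕ) :
    RS S r k A d = ⋂ i ∈ Finset.range (k+1), S ((i:ℤ) * (d:ℤ) ^ r) ⁻¹' A := by
  ext x; simp [RS]

lemma RS_meas (hI : Inv S Y) {r k : ℕ} {A : Set X} (hA : MeasurableSet[Y] A) (d : ℕ) :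
    MeasurableSet[Y] (RS S r k A d) := by
  rw [RS_eq]
  exact Finset.measurableSet_biInter _ fun i _ => hI _ hA

lemma Act.inv (h : Act μ S) : Inv S mX := fun n => h.measurable n

lemma RS_le_of_eq {c : ℝ} (hc : 0 < c) {r k k' : ℕ} {A A' : Set X}
    (h : ∀ d, c * μ.real (RS S r k' A' d) ≤ μ.real (RS S r k A d))
    (hA : AvZ (fun d => μ.real (RS S r k A d))) : AvZ (fun d => μ.real (RS S r k' A' d)) := by
  refine AvZ.squeeze (hA.const_mul c⁻¹) (fun n => measureReal_nonneg) fun n => ?_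
  rw [inv_mul_eq_div, le_div_iff₀ hc, mul_comm]
  exact h n

lemma SZ_bot (hA : Act μ S) (r : ℕ) : SZ μ S r ⊥ := by
  intro A hAm hpos k hav
  rw [MeasurableSpace.measurableSet_bot_iff] at hAm
  rcases hAm with rfl | rfl
  · simp at hpos
  · have : ∀ d, μ.real (RS S r k Set.univ d) = 1 := by
      intro d
      have : RS S r k Set.univ d = Set.univ := by ext x; simp [RS]
      rw [this]; simp
    simp only [this, AvZ] at hav
    have h1 : Tendsto (fun N : ℕ => (∑ n ∈ Finset.range N, (1:ℝ)) / N) atTop (𝓝 1) := by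
      refine tendsto_const_nhds.congr' ?_
      filter_upwards [eventually_gt_atTop 0] with N hN
      have : (N:ℝ) ≠ 0 := by positivity
      simp [this]
    exact zero_ne_one (tendsto_nhds_unique hav h1)

/-- `E(1_A | Y)` -/
lemma int_ind {A : Set X} (hA : MeasurableSet A) (ν : Measure X) :
    ∫ x, A.indicator (fun _ => (1:ℝ)) x ∂ν = ν.real A := by
  rw [integral_indicator hA]; simp

lemma cE_ind_nonneg {A : Set X} (y : X) : 0 ≤ cE μ Y (A.indicator fun _ => (1:ℝ)) y :=
  integral_nonneg fun x => Set.indicator_nonneg (fun _ _ => zero_le_one) _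

/-- the set where the conditional probability is large -/
lemma exists_large (hY : Y ≤ mX) {A : Set X} (hA : MeasurableSet A) {η : ℝ} (hη : 0 ≤ η) :
    μ.real A ≤ μ.real {y | η < cE μ Y (A.indicator fun _ => (1:ℝ)) y} + η := by
  have hB := bd_ind hA
  set φ := cE μ Y (A.indicator fun _ => (1:ℝ)) with hφ
  have hφB : Bd φ := cE_bd hY hB
  have hm : MeasurableSet {y | η < φ y} := measurableSet_lt measurable_const hφB.1
  have h1 : μ.real A = ∫ x, φ x ∂μ := by rw [int_cE hY hB, int_ind hA]
  rw [h1, ← int_ind hm]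
  have h2 : ∫ x, {y | η < φ y}.indicator (fun _ => (1:ℝ)) x ∂μ + η =
      ∫ x, ({y | η < φ y}.indicator (fun _ => (1:ℝ)) x + η) ∂μ := by
    rw [integral_add ((bd_ind hm).integrable μ) (integrable_const _)]; simp
  rw [h2]
  refine integral_mono (hφB.integrable μ) (((bd_ind hm).integrable μ).add (integrable_const _)) ?_
  intro x
  show φ x ≤ {y | η < φ y}.indicator (fun _ => (1:ℝ)) x + η
  by_cases hx : η < φ x
  · rw [Set.indicator_of_mem (by exact hx)]
    have := (abs_le.1 (hφB.2 x)).2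
    linarith
  · rw [Set.indicator_of_notMem (by exact hx)]
    linarith

lemma prod_ind (k : ℕ) (A : Set X) (T : ℕ → X → X) (x : X) :
    A.indicator (fun _ => (1:ℝ)) (T 0 x) * ∏ i : Fin k, A.indicator (fun _ => (1:ℝ)) (T (i+1) x) =
      {x | ∀ i ≤ k, T i x ∈ A}.indicator (fun _ => (1:ℝ)) x := by
  by_cases hx : ∀ i ≤ k, T i x ∈ A
  · rw [Set.indicator_of_mem (show x ∈ {x | ∀ i ≤ k, T i x ∈ A} from hx),
      Set.indicator_of_mem (hx 0 (Nat.zero_le _)), one_mul]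
    refine Finset.prod_eq_one fun i _ => ?_
    rw [Set.indicator_of_mem (hx (i+1) (by omega))]
  · rw [Set.indicator_of_notMem (show x ∉ {x | ∀ i ≤ k, T i x ∈ A} from hx)]
    push Not at hx
    obtain ⟨i, hi, hiA⟩ := hx
    rcases i with _ | i
    · rw [Set.indicator_of_notMem hiA, zero_mul]
    · rw [Finset.prod_eq_zero (Finset.mem_univ (⟨i, by omega⟩ : Fin k)), mul_zero]
      exact Set.indicator_of_notMem hiA _

theorem SZ_of_wm (hA : Act μ S) (hY : Y ≤ mX) (hI : Inv S Y) (hwm : WM μ S Y) {r : ℕ}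
    (hr : 1 ≤ r) (hsz : SZ μ S r Y) : SZ μ S r mX := by
  intro A hAm hpos k hav
  set φ := cE μ Y (A.indicator fun _ => (1:ℝ)) with hφ
  have hB := bd_ind hAm
  set η := μ.real A / 2 with hη
  have hηpos : 0 < η := by positivity
  set B := {y | η < φ y} with hBdef
  have hφY : BdY Y φ := cE_bdY hB
  have hBm : MeasurableSet[Y] B := hφY.1 measurableSet_Ioi
  have hBpos : 0 < μ.real B := by
    have := exists_large (μ := μ) (Y := Y) hY hAm hηpos.le
    simp only [← hφ, ← hBdef] at this
    linarith
  set Q : Fin k → ℤ[X] := fun i => Polynomial.C ((i:ℤ) + 1) * Polynomial.X ^ r with hQ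
  have hpet := pet hA hY hI hwm (Finset.univ.image Q) (Fin k) Q (by simp) (by
    intro i
    simp only [hQ]
    rw [Polynomial.natDegree_C_mul_X_pow _ _ (by positivity)]
    exact hr) (by
    intro i j hij
    simp only [hQ]
    rw [← sub_mul, ← map_sub, Polynomial.natDegree_C_mul_X_pow]
    · exact hr
    · intro h0
      apply hij
      ext
      have : (i:ℤ) = j := by linarith
      exact_mod_cast this) (A.indicator fun _ => (1:ℝ)) (fun _ => A.indicator fun _ => (1:ℝ)) hB (fun _ => hB)
  have e1 : ∀ d : ℕ, ∫ x, A.indicator (fun _ => (1:ℝ)) x * ∏ i : Fin k, A.indicator (fun _ => (1:ℝ))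
      (S ((Q i).eval (d:ℤ)) x) ∂μ = μ.real (RS S r k A d) := by
    intro d
    rw [← int_ind (RS_meas hA.inv hAm d)]
    congr 1
    ext x
    have := prod_ind k A (fun i => S ((i:ℤ) * (d:ℤ)^r)) x
    simp only [Nat.cast_zero, zero_mul, hA.zero] at this
    unfold RS
    rw [← this]
    simp [hQ]
  have h2 : AvZ (fun d => ∫ x, φ x * ∏ i : Fin k, φ (S ((Q i).eval (d:ℤ)) x) ∂μ) := by
    refine AvZ.congr (hav.add (hpet.const_mul (-1))) fun d => ?_
    rw [e1]; ring
  refine hsz B hBm hBpos k ?_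
  refine AvZ.squeeze (h2.const_mul (η ^ (k+1))⁻¹) (fun d => measureReal_nonneg) fun d => ?_
  rw [inv_mul_eq_div, le_div_iff₀ (by positivity)]
  have hRm : MeasurableSet (RS S r k B d) := hY _ (RS_meas hI hBm d)
  rw [← int_ind hRm, ← integral_mul_const]
  refine integral_mono (((bd_ind hRm).integrable μ).mul_const _)
    (((hφY.bd hY).mul (bd_corr hA (fun i => (Q i).eval (d:ℤ)) _ fun i => hφY.bd hY)).integrable μ) ?_
  intro x
  have hφ0 : ∀ y, 0 ≤ φ y := fun y => cE_ind_nonneg y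
  simp only
  by_cases hx : x ∈ RS S r k B d
  · rw [Set.indicator_of_mem hx, one_mul, pow_succ']
    have h0 : η < φ x := by
      have := hx 0 (Nat.zero_le _)
      simp only [Nat.cast_zero, zero_mul, hA.zero] at this
      exact this
    have h3 : η ^ k ≤ ∏ i : Fin k, φ (S ((Q i).eval (d:ℤ)) x) := by
      calc η ^ k = ∏ i : Fin k, η := by simp
        _ ≤ _ := by
          refine Finset.prod_le_prod (fun _ _ => hηpos.le) fun i _ => ?_
          have := hx (i+1) (by omega)
          simp only [hBdef, Set.mem_ofPred_eq] at this
          simp only [hQ, Polynomial.eval_mul, Polynomial.eval_C, Polynomial.eval_pow, Polynomial.eval_X]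
          push_cast at this
          exact this.le
    exact mul_le_mul h0.le h3 (by positivity) (hφ0 x)
  · rw [Set.indicator_of_notMem hx, zero_mul]
    exact mul_nonneg (hφ0 _) (Finset.prod_nonneg fun i _ => hφ0 _)

lemma ind_mul (A B : Set X) (x : X) : A.indicator (fun _ => (1:ℝ)) x * B.indicator (fun _ => (1:ℝ)) x
    = (A ∩ B).indicator (fun _ => (1:ℝ)) x := by
  by_cases h1 : x ∈ A <;> by_cases h2 : x ∈ B <;> simp [h1, h2]

/-- if the conditional probability of `S n ⁻¹ A` is at least `c` on `E` -/
lemma cond_lower (hA : Act μ S) (hY : Y ≤ mX) (hI : Inv S Y) {A E : Set X} (hAm : MeasurableSet A)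
    (hE : MeasurableSet[Y] E) (n : ℤ) {c : ℝ}
    (h : ∀ x ∈ E, c ≤ cE μ Y (A.indicator fun _ => (1:ℝ)) (S n x)) :
    c * μ.real E ≤ μ.real (E ∩ S n ⁻¹' A) := by
  have hEm := hY _ hE
  have hSA : MeasurableSet (S n ⁻¹' A) := hA.measurable n hAm
  have hB := bd_ind hAm
  have hBY : BdY Y (E.indicator fun _ => (1:ℝ)) := @bd_ind X Y E hE
  have h1 : μ.real (E ∩ S n ⁻¹' A) = ∫ x, E.indicator (fun _ => (1:ℝ)) x *
      (fun x => A.indicator (fun _ => (1:ℝ)) (S n x)) x ∂μ := by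
    rw [← int_ind (hEm.inter hSA)]
    congr 1; ext x
    rw [← ind_mul]; rfl
  rw [h1, int_mul_cE hY (hB.comp (hA.measurable n)) hBY, ← int_ind hEm, ← integral_const_mul]
  refine integral_mono_ae (((bd_ind hEm).integrable μ).const_mul c)
    (((bd_ind hEm).mul (cE_bd hY (hB.comp (hA.measurable n)))).integrable μ) ?_
  filter_upwards [cE_comp hA hY hI n hB] with x hx
  simp only [hx]
  by_cases hxE : x ∈ E
  · rw [Set.indicator_of_mem hxE, mul_one, one_mul]; exact h x hxE
  · rw [Set.indicator_of_notMem hxE]; simp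

lemma real_inter_ge {E : Set X} {k : ℕ} {F : ℕ → Set X} (hE : MeasurableSet E)
    (hF : ∀ i, MeasurableSet (F i)) {δ : ℝ}
    (h : ∀ i ≤ k, (1 - δ) * μ.real E ≤ μ.real (E ∩ F i)) :
    (1 - (k+1) * δ) * μ.real E ≤ μ.real (E ∩ ⋂ i ∈ Finset.range (k+1), F i) := by
  have h1 : E \ (⋂ i ∈ Finset.range (k+1), F i) ⊆ ⋃ i ∈ Finset.range (k+1), E \ F i := by
    intro x hx
    simp only [Set.mem_sdiff, Set.mem_iInter, not_forall, Set.mem_iUnion] at hx ⊢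
    obtain ⟨hx, i, hi, h⟩ := hx
    exact ⟨i, hi, hx, h⟩
  have h2 : μ.real (E \ (⋂ i ∈ Finset.range (k+1), F i)) ≤ (k+1) * (δ * μ.real E) := by
    refine (measureReal_mono h1 (measure_ne_top _ _)).trans ((measureReal_biUnion_finset_le _ _).trans ?_)
    calc _ ≤ ∑ i ∈ Finset.range (k+1), δ * μ.real E := by
          refine Finset.sum_le_sum fun i hi => ?_
          have := measureReal_inter_add_sdiff (μ := μ) (s := E) (hF i)
          have h3 := h i (by simpa [Nat.lt_succ_iff] using hi)
          linarith
      _ = _ := by simp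
  have := measureReal_inter_add_sdiff (μ := μ) (s := E)
    (Finset.measurableSet_biInter (Finset.range (k+1)) fun i _ => hF i)
  linarith

lemma SZ_approx (hA : Act μ S) (hY : Y ≤ mX) (hI : Inv S Y) {r : ℕ} (hsz : SZ μ S r Y)
    {A B : Set X} (hAm : MeasurableSet A) (hpos : 0 < μ.real A) (k : ℕ) (hB : MeasurableSet[Y] B)
    (hAB : μ.real (symmDiff A B) < μ.real A / (6 * (k+1))) :
    ¬ AvZ (fun d => μ.real (RS S r k A d)) := by
  set δ : ℝ := 1 / (2 * (k+1)) with hδ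
  have hδpos : 0 < δ := by positivity
  have hδ1 : δ ≤ 1/2 := by
    rw [hδ]; apply one_div_le_one_div_of_le (by norm_num)
    have : (0:ℝ) ≤ k := by positivity
    linarith
  set φ := cE μ Y (A.indicator fun _ => (1:ℝ)) with hφ
  have hφY : BdY Y φ := cE_bdY (bd_ind hAm)
  set C := {y | 1 - δ < φ y} with hC
  have hCm : MeasurableSet[Y] C := hφY.1 measurableSet_Ioi
  have hBY : BdY Y (B.indicator fun _ => (1:ℝ)) := @bd_ind X Y B hB
  have hBm := hY _ hB
  have hCpos : 0 < μ.real C := by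
    have h1 : μ.real (B ∩ A) = ∫ x, B.indicator (fun _ => (1:ℝ)) x * φ x ∂μ := by
      rw [← int_mul_cE hY (bd_ind hAm) hBY, ← int_ind (hBm.inter hAm)]
      simp only [ind_mul]
    have h2 : μ.real (B ∩ A) ≤ (1-δ) * μ.real B + μ.real C := by
      rw [h1, ← int_ind hBm, ← int_ind (hY _ hCm), ← integral_const_mul, ← integral_add
        (((bd_ind hBm).integrable μ).const_mul _) ((bd_ind (hY _ hCm)).integrable μ)]
      refine integral_mono (((bd_ind hBm).mul (hφY.bd hY)).integrable μ)
        ((((bd_ind hBm).integrable μ).const_mul _).add ((bd_ind (hY _ hCm)).integrable μ)) ?_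
      intro x
      simp only
      have hx1 := (abs_le.1 (hφY.2 x)).2
      by_cases hxB : x ∈ B <;> by_cases hxC : x ∈ C
      · rw [Set.indicator_of_mem hxB, Set.indicator_of_mem hxC]; linarith
      · rw [Set.indicator_of_mem hxB, Set.indicator_of_notMem hxC]
        simp only [hC, Set.mem_ofPred_eq, not_lt] at hxC
        linarith
      · rw [Set.indicator_of_notMem hxB, Set.indicator_of_mem hxC]; simp
      · rw [Set.indicator_of_notMem hxB, Set.indicator_of_notMem hxC]; simp
    have h3 := measureReal_inter_add_sdiff (μ := μ) (s := A) hBm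
    have h4 := measureReal_inter_add_sdiff (μ := μ) (s := B) hAm
    have h5 : μ.real (A \ B) ≤ μ.real (symmDiff A B) := measureReal_mono (by
      rw [Set.symmDiff_def]; exact Set.subset_union_left)
    have h6 : μ.real (B \ A) ≤ μ.real (symmDiff A B) := measureReal_mono (by
      rw [Set.symmDiff_def]; exact Set.subset_union_right)
    rw [Set.inter_comm] at h3
    have h7 : μ.real A / (6 * (k+1)) = δ * μ.real A / 3 := by rw [hδ]; field_simp; norm_num
    rw [h7] at hAB
    have h8 : (0:ℝ) ≤ μ.real (B \ A) := measureReal_nonneg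
    nlinarith
  intro hav
  refine hsz C hCm hCpos k (RS_le_of_eq (c := 1/2) (by norm_num) (fun d => ?_) hav)
  have hR := RS_meas (r := r) (k := k) hI hCm d
  have h1 := real_inter_ge (μ := μ) (k := k) (δ := δ) (E := RS S r k C d)
    (F := fun i => S ((i:ℤ) * (d:ℤ)^r) ⁻¹' A) (hY _ hR) (fun i => hA.measurable _ hAm) (by
      intro i hi
      refine cond_lower hA hY hI hAm hR _ ?_
      intro x hx
      exact (show 1 - δ < φ _ from hx i hi).le)
  have h2 : 1 - ((k:ℝ)+1) * δ = 1/2 := by rw [hδ]; field_simp; norm_num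
  rw [h2] at h1
  refine h1.trans (measureReal_mono ?_)
  rw [← RS_eq]; exact Set.inter_subset_right

lemma chain_approx {c : Set (MeasurableSpace X)} (hc : IsChain (· ≤ ·) c) (hne : c.Nonempty)
    (hle : ∀ Y ∈ c, Y ≤ mX) {A : Set X} (hA : MeasurableSet[sSup c] A) {ε : ℝ} (hε : 0 < ε) :
    ∃ Y ∈ c, ∃ B, MeasurableSet[Y] B ∧ μ.real (symmDiff A B) < ε := by
  have hs : sSup c ≤ mX := sSup_le hle
  set 𝒜 : Set (Set X) := {s | ∃ m ∈ c, MeasurableSet[m] s} with h𝒜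
  have halg : IsSetAlgebra 𝒜 := by
    refine ⟨?_, ?_, ?_⟩
    · obtain ⟨Y, hY⟩ := hne
      exact ⟨Y, hY, @MeasurableSet.empty _ Y⟩
    · rintro s ⟨m, hm, hs⟩
      exact ⟨m, hm, hs.compl⟩
    · rintro s t ⟨m, hm, hs⟩ ⟨m', hm', ht⟩
      rcases hc.total hm hm' with h | h
      · exact ⟨m', hm', (h _ hs).union ht⟩
      · exact ⟨m, hm, hs.union (h _ ht)⟩
  have hgen : sSup c = MeasurableSpace.generateFrom 𝒜 := by
    ext s
    rw [MeasurableSpace.measurableSet_sSup]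
    rfl
  have hd := @Measure.MeasureDense.of_generateFrom_isSetAlgebra_finite X (sSup c) (μ.trim hs) 𝒜
    (isFiniteMeasure_trim hs) halg hgen
  obtain ⟨B, ⟨Y, hY, hB⟩, h⟩ := @Measure.MeasureDense.approx _ (sSup c) _ _ hd A hA (@measure_ne_top _ (sSup c) _ (isFiniteMeasure_trim hs) _) ε hε
  refine ⟨Y, hY, B, hB, ?_⟩
  have hBs : MeasurableSet[sSup c] B := le_sSup hY _ hB
  rw [trim_measurableSet_eq hs (hA.symmDiff hBs)] at h
  rw [measureReal_def]
  exact (ENNReal.toReal_lt_of_lt_ofReal h)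

structure Good {X : Type} {mX : MeasurableSpace X} (μ : Measure X) (S : ℤ → X → X) (r : ℕ) (Y : MeasurableSpace X) : Prop where
  le : Y ≤ mX
  inv : Inv S Y
  sz : SZ (mX := mX) μ S r Y

lemma chain_sz (hA : Act μ S) {r : ℕ} {c : Set (MeasurableSpace X)} (hc : IsChain (· ≤ ·) c)
    (hne : c.Nonempty) (hg : ∀ Y ∈ c, Good μ S r Y) : SZ μ S r (sSup c) := by
  intro A hAm hpos k
  have hAm' : MeasurableSet A := (sSup_le fun Y hY => (hg Y hY).le : sSup c ≤ mX) _ hAm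
  obtain ⟨Y, hY, B, hB, h⟩ := chain_approx (μ := μ) hc hne (fun Y hY => (hg Y hY).le) hAm
    (ε := μ.real A / (6 * (k+1))) (by positivity)
  exact SZ_approx (mX := mX) hA (hg Y hY).le (hg Y hY).inv (hg Y hY).sz hAm' hpos k hB h

lemma exists_max (hA : Act μ S) (r : ℕ) : ∃ Y, Good (mX := mX) μ S r Y ∧ ∀ Z, Good (mX := mX) μ S r Z → Y ≤ Z → Z ≤ Y := by
  have := zorn_le_nonempty₀ {Y : MeasurableSpace X | Good (mX := mX) μ S r Y} (by
    intro c hcs hc y hy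
    refine ⟨sSup c, ⟨sSup_le fun Y hY => (hcs hY).le, ?_, ?_⟩, fun z hz => le_sSup hz⟩
    · intro n
      rw [measurable_iff_comap_le]
      have : sSup c = ⨆ i : c, (i : MeasurableSpace X) := sSup_eq_iSup'  c
      conv_lhs => rw [this]
      rw [MeasurableSpace.comap_iSup]
      refine iSup_le fun i => ?_
      exact (measurable_iff_comap_le.1 ((hcs i.2).inv n)).trans (le_sSup i.2)
    · exact chain_sz (mX := mX) hA hc ⟨y, hy⟩ fun Y hY => hcs hY) ⊥
    ⟨bot_le, fun n => by
      intro s hs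
      rw [MeasurableSpace.measurableSet_bot_iff] at hs ⊢
      rcases hs with rfl | rfl <;> simp, SZ_bot hA r⟩
  obtain ⟨Y, _, hY⟩ := this
  exact ⟨Y, hY.1, fun Z hZ h => hY.2 hZ h⟩

end sz
end PSz
end Part5

section Part6
open MeasureTheory ProbabilityTheory Filter Topology
open scoped Polynomial

namespace PSz

section cap
set_option linter.unusedSectionVars false
set_option linter.unusedVariables false

/-- total boundedness of a distance on `ℤ` through colourings -/
def TB (ρ : ℤ → ℤ → ℝ) : Prop :=
  ∀ ε > 0, ∃ (M : ℕ) (χ : ℤ → Fin M), ∀ n m, χ n = χ m → ρ n m < ε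

lemma TB.of_fin {ρ : ℤ → ℤ → ℝ}
    (h : ∀ ε > 0, ∃ (α : Type) (_ : Finite α) (χ : ℤ → α), ∀ n m, χ n = χ m → ρ n m < ε) : TB ρ := by
  intro ε hε
  obtain ⟨α, hα, χ, hχ⟩ := h ε hε
  refine ⟨Nat.card α, fun n => Finite.equivFin α (χ n), fun n m hnm => hχ n m ?_⟩
  simpa using hnm

lemma TB.le2 {ρ ρ1 ρ2 : ℤ → ℤ → ℝ} (h1 : TB ρ1) (h2 : TB ρ2) {C : ℝ} (hC : 0 < C)
    (h : ∀ n m, ρ n m ≤ C * (ρ1 n m + ρ2 n m)) : TB ρ := by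
  refine TB.of_fin fun ε hε => ?_
  obtain ⟨M, χ, hχ⟩ := h1 (ε / (2 * C)) (by positivity)
  obtain ⟨M', χ', hχ'⟩ := h2 (ε / (2 * C)) (by positivity)
  refine ⟨Fin M × Fin M', inferInstance, fun n => (χ n, χ' n), fun n m hnm => ?_⟩
  rw [Prod.mk.injEq] at hnm
  have a1 := hχ n m hnm.1
  have a2 := hχ' n m hnm.2
  refine (h n m).trans_lt ?_
  rw [lt_div_iff₀ (by positivity)] at a1 a2
  nlinarith

lemma TB.centers {ρ : ℤ → ℤ → ℝ} (h : TB ρ) {ε : ℝ} (hε : 0 < ε) :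
    ∃ L : ℕ, ∀ n, ∃ c ∈ Finset.Icc (-(L:ℤ)) L, ρ n c < ε := by
  classical
  obtain ⟨M, χ, hχ⟩ := h ε hε
  have : ∀ i : Fin M, ∃ c : ℤ, (∃ n, χ n = i) → χ c = i := by
    intro i
    by_cases hi : ∃ n, χ n = i
    · obtain ⟨n, hn⟩ := hi
      exact ⟨n, fun _ => hn⟩
    · exact ⟨0, fun h => absurd h hi⟩
  choose c hc using this
  refine ⟨∑ i, (c i).natAbs, fun n => ⟨c (χ n), ?_, hχ _ _ (hc _ ⟨n, rfl⟩).symm⟩⟩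
  have : (c (χ n)).natAbs ≤ ∑ i, (c i).natAbs :=
    Finset.single_le_sum (f := fun i => (c i).natAbs) (fun i _ => Nat.zero_le _) (Finset.mem_univ _)
  rw [Finset.mem_Icc]
  omega

variable {X : Type} {Y : MeasurableSpace X} [mX : MeasurableSpace X] [StandardBorelSpace X]
  {μ : Measure X} [IsProbabilityMeasure μ] {S : ℤ → X → X}

noncomputable def rho {X : Type} {mX : MeasurableSpace X} [StandardBorelSpace X] (μ : Measure X)
    [IsProbabilityMeasure μ] (S : ℤ → X → X) (Y : MeasurableSpace X) (F : X → ℝ) (y : X)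
    (n m : ℤ) : ℝ := cE (mX := mX) μ Y (fun x => |(F (S n x) - F (S m x)) / 2|) y

/-- conditionally almost periodic functions -/
def CAP {X : Type} {mX : MeasurableSpace X} [StandardBorelSpace X] (μ : Measure X)
    [IsProbabilityMeasure μ] (S : ℤ → X → X) (Y : MeasurableSpace X) (F : X → ℝ) : Prop :=
  @Bd X mX F ∧ ∀ᵐ y ∂μ, TB (rho μ S Y F y)

lemma rho_bd (hA : Act μ S) {F : X → ℝ} (hF : Bd F) (n m : ℤ) :
    Bd (fun x => |(F (S n x) - F (S m x)) / 2|) :=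
  ((hF.comp (hA.measurable n)).half_sub (hF.comp (hA.measurable m))).abs

lemma CAP.lip (hA : Act μ S) {F G H : X → ℝ} (hF : CAP μ S Y F) (hG : CAP μ S Y G) (hH : Bd H) {C : ℝ}
    (hC : 0 < C) (h : ∀ x x', |H x - H x'| ≤ C * (|F x - F x'| + |G x - G x'|)) : CAP μ S Y H := by
  refine ⟨hH, ?_⟩
  filter_upwards [hF.2, hG.2] with y h1 h2
  refine h1.le2 h2 hC fun n m => ?_
  unfold rho cE
  rw [← integral_add ((rho_bd hA hF.1 n m).integrable _) ((rho_bd hA hG.1 n m).integrable _),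
    ← integral_const_mul]
  refine integral_mono ((rho_bd hA hH n m).integrable _) ((((rho_bd hA hF.1 n m).integrable _).add
    ((rho_bd hA hG.1 n m).integrable _)).const_mul _) fun x => ?_
  have := h (S n x) (S m x)
  simp only [abs_div, abs_two]
  linarith

lemma CAP.comp (hA : Act μ S) {F : X → ℝ} (hF : CAP μ S Y F) (n : ℤ) :
    CAP μ S Y (fun x => F (S n x)) := by
  refine ⟨hF.1.comp (hA.measurable n), ?_⟩
  filter_upwards [hF.2] with y h1 ε hε
  obtain ⟨M, χ, hχ⟩ := h1 ε hε
  refine ⟨M, fun a => χ (n + a), fun a b hab => ?_⟩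
  have := hχ _ _ hab
  unfold rho at this ⊢
  simpa only [hA.add] using this

lemma CAP.of_Y (hA : Act μ S) (hY : Y ≤ mX) (hI : Inv S Y) {A : Set X} (hAm : MeasurableSet[Y] A) :
    CAP μ S Y (A.indicator fun _ => (1:ℝ)) := by
  classical
  refine ⟨bd_ind (hY _ hAm), ?_⟩
  have hB : BdY Y (A.indicator fun _ => (1:ℝ)) := @bd_ind X Y A hAm
  have : ∀ᵐ y ∂μ, ∀ n m : ℤ, rho μ S Y (A.indicator fun _ => (1:ℝ)) y n m =
      |(A.indicator (fun _ => (1:ℝ)) (S n y) - A.indicator (fun _ => (1:ℝ)) (S m y)) / 2| := by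
    rw [ae_all_iff]; intro n
    rw [ae_all_iff]; intro m
    exact cE_self hY (Y := Y) (@Bd.abs X Y _ (@Bd.half_sub X Y _ _ (@Bd.comp X Y _ hB _ (hI n))
      (@Bd.comp X Y _ hB _ (hI m))))
  filter_upwards [this] with y hy
  refine TB.of_fin fun ε hε => ⟨Prop, inferInstance, fun n => S n y ∈ A, fun n m hnm => ?_⟩
  rw [hy]
  by_cases h : S n y ∈ A
  · have h' : S m y ∈ A := (show (S n y ∈ A) = (S m y ∈ A) from hnm) ▸ h
    rw [Set.indicator_of_mem h, Set.indicator_of_mem h']; simpa using hε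
  · have h' : S m y ∉ A := (show (S n y ∈ A) = (S m y ∈ A) from hnm) ▸ h
    rw [Set.indicator_of_notMem h, Set.indicator_of_notMem h']; simpa using hε

/-- sets approximable by CAP functions -/
def ZS {X : Type} {mX : MeasurableSpace X} [StandardBorelSpace X] (μ : Measure X)
    [IsProbabilityMeasure μ] (S : ℤ → X → X) (Y : MeasurableSpace X) (A : Set X) : Prop :=
  MeasurableSet[mX] A ∧ ∀ ε > 0, ∃ g, CAP μ S Y g ∧ ∫ x, |A.indicator (fun _ => (1:ℝ)) x - g x| ∂μ < ε

lemma cap_const (hA : Act μ S) : CAP μ S Y (fun _ => (0:ℝ)) := by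
  refine ⟨bd_zero, ae_of_all _ fun y ε hε => ⟨1, fun _ => 0, fun n m _ => ?_⟩⟩
  simpa [rho, cE] using hε

lemma abs_int {f g : X → ℝ} (hf : Bd f) (hg : Bd g) : Integrable (fun x => |f x - g x|) μ :=
  ((hf.integrable μ).sub (hg.integrable μ)).abs

lemma ZS.compl (hA : Act μ S) {A : Set X} (h : ZS μ S Y A) : ZS μ S Y Aᶜ := by
  refine ⟨h.1.compl, fun ε hε => ?_⟩
  obtain ⟨g, hg, hgε⟩ := h.2 ε hε
  have hbd : Bd (fun x => 1 - max (g x) 0) := by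
    refine ⟨measurable_const.sub (hg.1.1.max measurable_const), fun x => ?_⟩
    have := abs_le.1 (hg.1.2 x)
    have h1 : max (g x) 0 ≤ 1 := max_le this.2 zero_le_one
    have h2 : 0 ≤ max (g x) 0 := le_max_right _ _
    rw [abs_le]; constructor <;> linarith
  refine ⟨fun x => 1 - max (g x) 0, CAP.lip hA hg hg hbd one_pos fun x x' => ?_, ?_⟩
  · have := abs_max_sub_max_le_abs (g x') (g x) 0
    rw [abs_sub_comm (g x') (g x)] at this
    have e : 1 - max (g x) 0 - (1 - max (g x') 0) = max (g x') 0 - max (g x) 0 := by ring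
    rw [e]
    have := abs_nonneg (g x - g x')
    linarith
  · refine lt_of_le_of_lt ?_ hgε
    refine integral_mono (abs_int (bd_ind h.1.compl) hbd) (abs_int (bd_ind h.1) hg.1) fun x => ?_
    simp only
    by_cases hx : x ∈ A
    · rw [Set.indicator_of_mem hx, Set.indicator_of_notMem (by simpa using hx)]
      have := abs_max_sub_max_le_abs 1 (g x) 0
      rw [max_eq_left zero_le_one] at this
      rwa [zero_sub, abs_neg]
    · rw [Set.indicator_of_notMem hx, Set.indicator_of_mem (by simpa using hx)]
      have := abs_max_sub_max_le_abs 0 (g x) 0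
      rw [max_self] at this
      have e : (1:ℝ) - (1 - max (g x) 0) = -(0 - max (g x) 0) := by ring
      rwa [e, abs_neg]

lemma abs_max_max (a b c d : ℝ) : |max a b - max c d| ≤ |a - c| + |b - d| :=
  (abs_max_sub_max_le_max a b c d).trans (max_le_add_of_nonneg (abs_nonneg _) (abs_nonneg _))

lemma ZS.union (hA : Act μ S) {A B : Set X} (h : ZS μ S Y A) (h' : ZS μ S Y B) : ZS μ S Y (A ∪ B) := by
  refine ⟨h.1.union h'.1, fun ε hε => ?_⟩
  obtain ⟨g, hg, hgε⟩ := h.2 (ε/2) (by positivity)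
  obtain ⟨g', hg', hgε'⟩ := h'.2 (ε/2) (by positivity)
  have hbd : Bd (fun x => max (g x) (g' x)) := by
    refine ⟨hg.1.1.max hg'.1.1, fun x => ?_⟩
    have h1 := abs_le.1 (hg.1.2 x)
    have h2 := abs_le.1 (hg'.1.2 x)
    rw [abs_le]
    exact ⟨h1.1.trans (le_max_left _ _), max_le h1.2 h2.2⟩
  refine ⟨fun x => max (g x) (g' x), CAP.lip hA hg hg' hbd one_pos fun x x' => ?_, ?_⟩
  · rw [one_mul]; exact abs_max_max _ _ _ _
  · calc _ ≤ ∫ x, (|A.indicator (fun _ => (1:ℝ)) x - g x| + |B.indicator (fun _ => (1:ℝ)) x - g' x|) ∂μ := by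
          refine integral_mono (abs_int (bd_ind (h.1.union h'.1)) hbd)
            ((abs_int (bd_ind h.1) hg.1).add (abs_int (bd_ind h'.1) hg'.1)) fun x => ?_
          simp only
          have e : (A ∪ B).indicator (fun _ => (1:ℝ)) x = max (A.indicator (fun _ => (1:ℝ)) x)
              (B.indicator (fun _ => (1:ℝ)) x) := by
            by_cases h1 : x ∈ A <;> by_cases h2 : x ∈ B <;> simp [h1, h2]
          rw [e]
          exact abs_max_max _ _ _ _
      _ < ε := by
          rw [integral_add (abs_int (bd_ind h.1) hg.1) (abs_int (bd_ind h'.1) hg'.1)]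
          linarith

lemma ZS.mono_approx {A B : Set X} (hAm : MeasurableSet A) (hBA : B ⊆ A)
    (hB : ZS μ S Y B) {ε : ℝ} (hε : 0 < ε) (h : μ.real (A \ B) < ε) :
    ∃ g, CAP μ S Y g ∧ ∫ x, |A.indicator (fun _ => (1:ℝ)) x - g x| ∂μ < 2 * ε := by
  obtain ⟨g, hg, hgε⟩ := hB.2 ε hε
  refine ⟨g, hg, ?_⟩
  calc _ ≤ ∫ x, ((A \ B).indicator (fun _ => (1:ℝ)) x + |B.indicator (fun _ => (1:ℝ)) x - g x|) ∂μ := by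
        refine integral_mono (abs_int (bd_ind hAm) hg.1)
            (((bd_ind (hAm.diff hB.1)).integrable μ).add (abs_int (bd_ind hB.1) hg.1)) fun x => ?_
        simp only
        by_cases h1 : x ∈ A <;> by_cases h2 : x ∈ B
        · simp [h1, h2]
        · simp only [h1, h2, Set.indicator_of_mem, Set.mem_sdiff, not_false_eq_true, and_self,
            Set.indicator_of_notMem]
          have := abs_sub (1:ℝ) (g x)
          simpa using this
        · exact absurd (hBA h2) h1
        · simp [h1, h2]
    _ < 2 * ε := by
        rw [integral_add ((bd_ind (hAm.diff hB.1)).integrable μ) (abs_int (bd_ind hB.1) hg.1),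
          int_ind (hAm.diff hB.1)]
        linarith

lemma ZS.iUnion (hA : Act μ S) {f : ℕ → Set X} (h : ∀ i, ZS μ S Y (f i)) : ZS μ S Y (⋃ i, f i) := by
  have hm : MeasurableSet (⋃ i, f i) := MeasurableSet.iUnion fun i => (h i).1
  refine ⟨hm, fun ε hε => ?_⟩
  have hp : ∀ n, ZS μ S Y (⋃ i ∈ Finset.range n, f i) := by
    intro n
    induction n with
    | zero =>
      simp only [Finset.range_zero, Finset.notMem_empty, Set.iUnion_of_empty, Set.iUnion_empty]
      exact ⟨MeasurableSet.empty, fun ε hε => ⟨fun _ => 0, cap_const hA, by simpa using hε⟩⟩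
    | succ n ih =>
      rw [Finset.range_add_one, Finset.set_biUnion_insert]
      exact (h n).union hA ih
  have ht : Tendsto (fun n => μ.real ((⋃ i, f i) \ ⋃ i ∈ Finset.range n, f i)) atTop (𝓝 0) := by
    have := tendsto_measure_iInter_atTop (μ := μ) (s := fun n => (⋃ i, f i) \ ⋃ i ∈ Finset.range n, f i)
      (fun n => (hm.diff (hp n).1).nullMeasurableSet) (by
        intro a b hab
        refine Set.sdiff_subset_sdiff_right ?_
        exact Set.biUnion_subset_biUnion_left fun i hi => Finset.range_mono hab hi) ⟨0, measure_ne_top _ _⟩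
    have e : (⋂ n, (⋃ i, f i) \ ⋃ i ∈ Finset.range n, f i) = ∅ := by
      ext x
      simp only [Set.mem_iInter, Set.mem_sdiff, Set.mem_iUnion, Set.mem_empty_iff_false, iff_false]
      intro hx
      obtain ⟨i, hi⟩ := (hx 0).1
      exact (hx (i+1)).2 ⟨i, by simp, hi⟩
    rw [e, measure_empty] at this
    have h2 := (ENNReal.tendsto_toReal ENNReal.zero_ne_top).comp this
    simpa using! h2
  obtain ⟨n, hn⟩ := (ht.eventually (gt_mem_nhds (show (0:ℝ) < ε/2 by positivity))).exists
  obtain ⟨g, hg, h⟩ := ZS.mono_approx (μ := μ) (S := S) (Y := Y) hm (B := ⋃ i ∈ Finset.range n, f i) (by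
    intro x hx
    simp only [Set.mem_iUnion] at hx ⊢
    obtain ⟨i, _, hi⟩ := hx
    exact ⟨i, hi⟩) (hp n) (by positivity) hn
  exact ⟨g, hg, by linarith⟩

lemma ZS_empty (hA : Act μ S) : ZS μ S Y ∅ :=
  ⟨MeasurableSet.empty, fun ε hε => ⟨fun _ => 0, cap_const hA, by simpa using hε⟩⟩

/-- the compact extension -/
@[reducible] def ZM (hA : Act μ S) (Y : MeasurableSpace X) : MeasurableSpace X where
  MeasurableSet' A := ZS μ S Y A
  measurableSet_empty := ZS_empty (mX := mX) hA
  measurableSet_compl A h := ZS.compl (mX := mX) hA h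
  measurableSet_iUnion f h := ZS.iUnion (mX := mX) hA h

lemma ZM_le (hA : Act μ S) : ZM hA Y ≤ mX := fun A h => h.1

lemma le_ZM (hA : Act μ S) (hY : Y ≤ mX) (hI : Inv S Y) : Y ≤ ZM hA Y := fun A h =>
  ⟨hY _ h, fun ε hε => ⟨_, CAP.of_Y hA hY hI h, by simpa using hε⟩⟩

lemma ZM_inv (hA : Act μ S) : Inv S (ZM hA Y) := by
  intro n A h
  refine ⟨hA.measurable n h.1, fun ε hε => ?_⟩
  obtain ⟨g, hg, hgε⟩ := h.2 ε hε
  refine ⟨_, hg.comp hA n, ?_⟩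
  have h1 := hA.integral n (((bd_ind h.1).half_sub hg.1).abs)
  have h2 : ∀ a : ℝ, |a| = 2 * |a / 2| := fun a => by rw [abs_div, abs_two]; ring
  rw [show (fun x => |A.indicator (fun _ => (1:ℝ)) x - g x|) = fun x => 2 * |(A.indicator (fun _ => (1:ℝ)) x - g x)/2| from
    funext fun x => h2 _, integral_const_mul, ← h1, ← integral_const_mul] at hgε
  refine lt_of_eq_of_lt ?_ hgε
  congr 1
  ext x
  rw [← h2]; rfl

lemma CAP.meas (hA : Act μ S) {F : X → ℝ} (hF : CAP μ S Y F) : @Measurable _ _ (ZM hA Y) _ F := by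
  refine @measurable_of_Ioi _ _ _ _ _ (ZM hA Y) _ _ _ F fun c => ?_
  have hm : MeasurableSet (F ⁻¹' Set.Ioi c) := hF.1.1 measurableSet_Ioi
  refine ⟨hm, fun ε hε => ?_⟩
  have hbd : ∀ j : ℕ, Bd (fun x => max 0 (min 1 (j * (F x - c)))) := fun j => by
    refine ⟨measurable_const.max (measurable_const.min ((hF.1.1.sub measurable_const).const_mul _)), fun x => ?_⟩
    rw [abs_le]
    exact ⟨by linarith [le_max_left 0 (min 1 (j * (F x - c)))], max_le zero_le_one (min_le_left _ _)⟩
  have hcap : ∀ j : ℕ, CAP μ S Y (fun x => max 0 (min 1 (j * (F x - c)))) := fun j => by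
    refine CAP.lip hA hF hF (hbd j) (C := j + 1) (by positivity) fun x x' => ?_
    have h1 := abs_max_sub_max_le_abs (min 1 (j * (F x - c))) (min 1 (j * (F x' - c))) 0
    rw [max_comm _ 0, max_comm _ 0] at h1
    have h2 := abs_min_sub_min_le_max 1 (j * (F x - c)) 1 (j * (F x' - c))
    rw [sub_self, abs_zero, max_eq_right (abs_nonneg _)] at h2
    have h3 : |(j:ℝ) * (F x - c) - j * (F x' - c)| = j * |F x - F x'| := by
      rw [← mul_sub, abs_mul, Nat.abs_cast]; congr 2; ring
    have h4 := abs_nonneg (F x - F x')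
    have h5 : (0:ℝ) ≤ j := by positivity
    nlinarith
  have ht : Tendsto (fun j : ℕ => ∫ x, |(F ⁻¹' Set.Ioi c).indicator (fun _ => (1:ℝ)) x -
      max 0 (min 1 (j * (F x - c)))| ∂μ) atTop (𝓝 (∫ x, (0:ℝ) ∂μ)) := by
    refine tendsto_integral_of_dominated_convergence (fun _ => 2) ?_ (integrable_const _) ?_ ?_
    · intro j; exact (abs_int (bd_ind hm) (hbd j)).aestronglyMeasurable
    · intro j; refine ae_of_all _ fun x => ?_
      have h1 := (bd_ind hm).2 x
      have h2 := (hbd j).2 x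
      rw [Real.norm_eq_abs, abs_abs]
      exact (abs_sub _ _).trans (by linarith)
    · refine ae_of_all _ fun x => ?_
      by_cases hx : c < F x
      · rw [Set.indicator_of_mem (by exact hx)]
        refine tendsto_const_nhds.congr' ?_
        obtain ⟨J, hJ⟩ := exists_nat_gt (1 / (F x - c))
        filter_upwards [eventually_ge_atTop J] with j hj
        have h0 : 0 < F x - c := by linarith
        have h1 : (1:ℝ) ≤ j * (F x - c) := by
          rw [div_lt_iff₀ h0] at hJ
          have : (J:ℝ) ≤ j := by exact_mod_cast hj
          nlinarith
        rw [min_eq_left h1, max_eq_right zero_le_one, sub_self, abs_zero]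
      · rw [Set.indicator_of_notMem (by exact hx)]
        refine tendsto_const_nhds.congr fun j => ?_
        have h1 : (j:ℝ) * (F x - c) ≤ 0 := mul_nonpos_of_nonneg_of_nonpos (by positivity) (by linarith)
        rw [min_eq_right (h1.trans zero_le_one), max_eq_left h1, sub_self, abs_zero]
  rw [integral_zero] at ht
  obtain ⟨j, hj⟩ := (ht.eventually (gt_mem_nhds hε)).exists
  exact ⟨_, hcap j, hj⟩

end cap
end PSz
end Part6

section Part7
open MeasureTheory ProbabilityTheory Filter Topology
open scoped Polynomial

namespace PSz

section lift
set_option linter.unusedSectionVars false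
set_option linter.unusedVariables false

variable {X : Type} {Y : MeasurableSpace X} [mX : MeasurableSpace X] [StandardBorelSpace X]
  {μ : Measure X} [IsProbabilityMeasure μ] {S : ℤ → X → X}

lemma cE_ind {A : Set X} (hA : MeasurableSet A) (y : X) :
    cE μ Y (A.indicator fun _ => (1:ℝ)) y = (condExpKernel μ Y y).real A := by
  unfold cE; rw [int_ind hA]

lemma inter_lower {ν : Measure X} [IsProbabilityMeasure ν] {k : ℕ} {F : ℕ → Set X}
    (hF : ∀ i, MeasurableSet (F i)) {δ : ℝ} (h : ∀ i ≤ k, ν.real (F 0 \ F i) ≤ δ) :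
    ν.real (F 0) - (k+1) * δ ≤ ν.real (⋂ i ∈ Finset.range (k+1), F i) := by
  have h1 : F 0 \ (⋂ i ∈ Finset.range (k+1), F i) ⊆ ⋃ i ∈ Finset.range (k+1), F 0 \ F i := by
    intro x hx
    simp only [Set.mem_sdiff, Set.mem_iInter, not_forall, Set.mem_iUnion] at hx ⊢
    obtain ⟨hx, i, hi, h⟩ := hx
    exact ⟨i, hi, hx, h⟩
  have h2 : ν.real (F 0 \ (⋂ i ∈ Finset.range (k+1), F i)) ≤ (k+1) * δ := by
    refine (measureReal_mono h1 (measure_ne_top _ _)).trans ((measureReal_biUnion_finset_le _ _).trans ?_)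
    calc _ ≤ ∑ i ∈ Finset.range (k+1), δ :=
          Finset.sum_le_sum fun i hi => h i (by simpa [Nat.lt_succ_iff] using hi)
      _ = _ := by simp
  have := measureReal_inter_add_sdiff (μ := ν) (s := F 0)
    (Finset.measurableSet_biInter (Finset.range (k+1)) fun i _ => hF i)
  have h3 : ν.real (F 0 ∩ ⋂ i ∈ Finset.range (k+1), F i) ≤ ν.real (⋂ i ∈ Finset.range (k+1), F i) :=
    measureReal_mono Set.inter_subset_right
  linarith

lemma diff_le {ν : Measure X} [IsProbabilityMeasure ν] {A : Set X} (hAm : MeasurableSet A)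
    {g : X → ℝ} (hg : Bd g) {T T' T'' : X → X} (hT : Measurable T) (hT' : Measurable T')
    (hT'' : Measurable T'') :
    ν.real (T ⁻¹' A \ T' ⁻¹' A) ≤ 2 * (∫ x, |(A.indicator (fun _ => (1:ℝ)) (T x) - g (T x)) / 2| ∂ν +
      ∫ x, |(A.indicator (fun _ => (1:ℝ)) (T' x) - g (T' x)) / 2| ∂ν +
      ∫ x, |(g (T x) - g (T'' x)) / 2| ∂ν + ∫ x, |(g (T' x) - g (T'' x)) / 2| ∂ν) := by
  have hB := bd_ind hAm
  have i1 := (((hB.half_sub hg).abs).comp hT).integrable ν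
  have i2 := (((hB.half_sub hg).abs).comp hT').integrable ν
  have i3 := (((hg.comp hT).half_sub (hg.comp hT'')).abs).integrable ν
  have i4 := (((hg.comp hT').half_sub (hg.comp hT'')).abs).integrable ν
  have hm : MeasurableSet (T ⁻¹' A \ T' ⁻¹' A) := (hT hAm).diff (hT' hAm)
  have key : ∀ f1 f2 f3 f4 : X → ℝ, Integrable f1 ν → Integrable f2 ν → Integrable f3 ν →
      Integrable f4 ν → ∫ x, f1 x ∂ν + ∫ x, f2 x ∂ν + ∫ x, f3 x ∂ν + ∫ x, f4 x ∂ν =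
        ∫ x, (f1 + f2 + f3 + f4) x ∂ν := by
    intro f1 f2 f3 f4 h1 h2 h3 h4
    rw [← integral_add' h1 h2, ← integral_add' (h1.add h2) h3, ← integral_add' ((h1.add h2).add h3) h4]
  rw [key _ _ _ _ i1 i2 i3 i4, ← integral_const_mul, ← int_ind hm]
  refine integral_mono ((bd_ind hm).integrable ν) ((((i1.add i2).add i3).add i4).const_mul 2) fun x => ?_
  simp only [Pi.add_apply, abs_div, abs_two]
  by_cases hx : x ∈ T ⁻¹' A \ T' ⁻¹' A
  · rw [Set.indicator_of_mem hx, Set.indicator_of_mem (show T x ∈ A from hx.1),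
      Set.indicator_of_notMem (show T' x ∉ A from hx.2)]
    have h1 := le_abs_self (1 - g (T x))
    have h2 := neg_abs_le (0 - g (T' x))
    have h3 := le_abs_self (g (T x) - g (T'' x))
    have h4 := neg_abs_le (g (T' x) - g (T'' x))
    linarith
  · rw [Set.indicator_of_notMem hx]
    positivity

lemma avz_sum_mul {P : Finset (ℕ × ℕ)} {r k : ℕ} {A : Set X}
    (hav : AvZ (fun d => μ.real (RS S r k A d))) :
    AvZ (fun D => ∑ p ∈ P, μ.real (RS S r k A ((p.2+1) * D))) := by
  refine AvZ.sum P (fun p D => μ.real (RS S r k A ((p.2+1) * D))) fun p _ => ?_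
  exact AvZ.mul_index (u := fun d => μ.real (RS S r k A d)) hav (fun n => measureReal_nonneg) (p.2+1)
    (Nat.le_add_left 1 _)

set_option maxHeartbeats 1600000 in
theorem SZ_lift (hA : Act μ S) (hY : Y ≤ mX) (hI : Inv S Y) {r : ℕ} (hr : 1 ≤ r)
    (hsz : SZ μ S r Y) : SZ μ S r (ZM hA Y) := by
  intro A hAZ hpos k hav
  have hAm : MeasurableSet A := hAZ.1
  set α := μ.real A with hα
  set η := α / 2 with hη
  have hηpos : 0 < η := by positivity
  set δ := η / (16 * (k+1)) with hδ
  have hδpos : 0 < δ := by positivity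
  obtain ⟨g, hg, hgε⟩ := hAZ.2 (δ * α / 4) (by positivity)
  have hB := bd_ind hAm
  set W : X → ℝ := fun x => |(A.indicator (fun _ => (1:ℝ)) x - g x) / 2| with hWdef
  have hW : Bd W := (hB.half_sub hg.1).abs
  set φ := cE μ Y (A.indicator fun _ => (1:ℝ)) with hφ
  set ψ := cE μ Y W with hψ
  have hφY : BdY Y φ := cE_bdY hB
  have hψY : BdY Y ψ := cE_bdY hW
  have hψ0 : ∀ y, 0 ≤ ψ y := fun y => integral_nonneg fun x => abs_nonneg _
  have hWint : ∫ x, W x ∂μ ≤ δ * α / 8 := by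
    have : ∫ x, W x ∂μ = (∫ x, |A.indicator (fun _ => (1:ℝ)) x - g x| ∂μ) / 2 := by
      rw [← integral_div]; simp only [hWdef, abs_div, abs_two]
    rw [this]; linarith
  have hmark : μ.real {y | δ ≤ ψ y} ≤ α / 8 := by
    have h1 := mul_meas_ge_le_integral_of_nonneg (μ := μ) (ae_of_all _ hψ0) ((hψY.bd hY).integrable μ) δ
    rw [int_cE hY hW] at h1
    have h2 : δ * μ.real {y | δ ≤ ψ y} ≤ δ * (α / 8) := h1.trans (by linarith)
    exact le_of_mul_le_mul_left h2 hδpos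
  set E : ℕ → Set X := fun L => {y | ∀ n : ℤ, ∃ c ∈ Finset.Icc (-(L:ℤ)) L, rho μ S Y g y n c < δ} with hE
  have hrhoY : ∀ n c, Measurable[Y] (fun y => rho μ S Y g y n c) := fun n c =>
    (cE_bdY (rho_bd hA hg.1 n c)).1
  have hEm : ∀ L, MeasurableSet[Y] (E L) := by
    intro L
    have : E L = ⋂ n : ℤ, ⋃ c ∈ Finset.Icc (-(L:ℤ)) L, {y | rho μ S Y g y n c < δ} := by
      ext y; simp [hE]
    rw [this]
    exact MeasurableSet.iInter fun n => Finset.measurableSet_biUnion _ fun c _ =>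
      hrhoY n c measurableSet_Iio
  have hmono : Monotone E := by
    intro L L' hLL y hy n
    obtain ⟨c, hc, h⟩ := hy n
    refine ⟨c, ?_, h⟩
    rw [Finset.mem_Icc] at hc ⊢
    omega
  have hun : μ (⋃ L, E L) = 1 := by
    rw [← measure_univ (μ := μ)]
    refine measure_congr ?_
    filter_upwards [hg.2] with y hy
    obtain ⟨L, hL⟩ := hy.centers hδpos
    exact propext ⟨fun _ => trivial, fun _ => Set.mem_iUnion.2 ⟨L, hL⟩⟩
  have ht : Tendsto (fun L => μ.real (E L)) atTop (𝓝 1) := by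
    have := tendsto_measure_iUnion_atTop (μ := μ) hmono
    rw [hun] at this
    have h2 := (ENNReal.tendsto_toReal ENNReal.one_ne_top).comp this
    simpa using! h2
  obtain ⟨L, hL⟩ := (ht.eventually (lt_mem_nhds (show 1 - α / 8 < 1 by linarith))).exists
  set B' := {y | η < φ y} ∩ {y | ψ y < δ} ∩ E L with hB'
  have hB'm : MeasurableSet[Y] B' :=
    ((hφY.1 measurableSet_Ioi).inter (hψY.1 measurableSet_Iio)).inter (hEm L)
  have hB'pos : 0 < μ.real B' := by
    have h1 := exists_large (μ := μ) (Y := Y) hY hAm hηpos.le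
    have h2 : {y | η < φ y} ⊆ (B' ∪ {y | δ ≤ ψ y}) ∪ (E L)ᶜ := by
      intro y hy
      by_cases hy1 : y ∈ E L
      · by_cases hy2 : ψ y < δ
        · exact Or.inl (Or.inl ⟨⟨hy, hy2⟩, hy1⟩)
        · exact Or.inl (Or.inr (not_lt.1 hy2))
      · exact Or.inr hy1
    have h3 := (measureReal_mono h2 (measure_ne_top μ _)).trans
      ((measureReal_union_le _ _).trans (add_le_add_left (measureReal_union_le _ _) _))
    rw [probReal_compl_eq_one_sub (hY _ (hEm L))] at h3
    simp only [← hφ] at h1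
    linarith
  set J := Finset.Icc (-(L:ℤ)) L with hJ
  obtain ⟨N, hN⟩ := power_vdw (k+1) r hr (Nat.card J)
  refine hsz B' hB'm hB'pos N ?_
  have hsum := avz_sum_mul (P := Finset.range (N+1) ×ˢ Finset.range (N+1)) hav
  refine AvZ.squeeze (hsum.const_mul (η/2)⁻¹) (fun d => measureReal_nonneg) fun D => ?_
  rw [inv_mul_eq_div, le_div_iff₀ (by positivity)]
  set G : ℕ × ℕ → Set X := fun p => S ((p.1:ℤ) * (D:ℤ)^r) ⁻¹' RS S r k A ((p.2+1) * D) with hG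
  have hGm : ∀ p, MeasurableSet (G p) := fun p => hA.measurable _ (RS_meas hA.inv hAm _)
  have hGμ : ∀ p, μ.real (RS S r k A ((p.2+1) * D)) = μ.real (G p) := by
    intro p
    rw [hG, measureReal_def, measureReal_def, (hA.mp _).measure_preimage
      (RS_meas hA.inv hAm _).nullMeasurableSet]
  simp only [hGμ]
  have hae1 : ∀ᵐ y ∂μ, ∀ n : ℤ, cE μ Y (fun x => A.indicator (fun _ => (1:ℝ)) (S n x)) y = φ (S n y) := by
    rw [ae_all_iff]; intro n; exact cE_comp hA hY hI n hB
  have hae2 : ∀ᵐ y ∂μ, ∀ n : ℤ, cE μ Y (fun x => W (S n x)) y = ψ (S n y) := by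
    rw [ae_all_iff]; intro n; exact cE_comp hA hY hI n hW
  have hfib : ∀ᵐ y ∂μ, y ∈ RS S r N B' D → η / 2 ≤
      ∑ p ∈ Finset.range (N+1) ×ˢ Finset.range (N+1), cE μ Y ((G p).indicator fun _ => (1:ℝ)) y := by
    filter_upwards [hae1, hae2] with y h1 h2 hy
    have hyE : y ∈ E L := by
      have := (hy 0 (Nat.zero_le _)).2
      simpa only [Nat.cast_zero, zero_mul, hA.zero] using this
    choose c hcJ hc using hyE
    obtain ⟨a, d, hd, had, hcol⟩ := hN (fun j => Finite.equivFin J ⟨c ((j:ℤ) * (D:ℤ)^r), hcJ _⟩)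
    have hcol' : ∀ i ≤ k, c (((a + i * d^r : ℕ):ℤ) * (D:ℤ)^r) = c ((a:ℤ) * (D:ℤ)^r) := by
      intro i hi
      have := hcol i (by omega)
      simpa using this
    have hdN : d ≤ N := by
      have : d ≤ d ^ r := Nat.le_self_pow (by omega) d
      have : d ^ r ≤ (k+1) * d^r := Nat.le_mul_of_pos_left _ (by omega)
      omega
    have hle : ∀ i ≤ k, a + i * d^r ≤ N := by
      intro i hi
      have : i * d ^ r ≤ (k+1) * d^r := Nat.mul_le_mul_right _ (by omega)
      omega
    set n : ℕ → ℤ := fun i => ((a + i * d^r : ℕ):ℤ) * (D:ℤ)^r with hn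
    have hn0 : n 0 = (a:ℤ) * (D:ℤ)^r := by simp [hn]
    set ν := condExpKernel μ Y y with hν
    have hF := inter_lower (ν := ν) (k := k) (F := fun i => S (n i) ⁻¹' A) (δ := 8 * δ)
      (fun i => hA.measurable _ hAm) (by
        intro i hi
        have h3 := diff_le (ν := ν) hAm hg.1 (hA.measurable (n 0)) (hA.measurable (n i))
          (hA.measurable (c (n 0)))
        have e1 := h2 (n 0)
        have e2 := h2 (n i)
        have l1 : ψ (S (n 0) y) < δ := (hy (a + 0 * d^r) (hle 0 (Nat.zero_le _))).1.2
        have l2 : ψ (S (n i) y) < δ := (hy (a + i * d^r) (hle i hi)).1.2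
        have l3 := hc (n 0)
        have l4 := hc (n i)
        rw [show c (n i) = c (n 0) by rw [hn0]; exact hcol' i hi] at l4
        rw [← e1] at l1
        rw [← e2] at l2
        unfold rho at l3 l4
        unfold cE at l1 l2 l3 l4
        simp only [hWdef] at l1 l2
        refine h3.trans ?_
        linarith)
    have l0 : η < ν.real (S (n 0) ⁻¹' A) := by
      have : η < φ (S (n 0) y) := (hy (a + 0 * d^r) (hle 0 (Nat.zero_le _))).1.1
      rw [← h1, show (fun x => A.indicator (fun _ => (1:ℝ)) (S (n 0) x)) =
        (S (n 0) ⁻¹' A).indicator (fun _ => (1:ℝ)) from rfl, cE_ind (hA.measurable _ hAm)] at this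
      exact this
    have hkd : ((k:ℝ)+1) * (8 * δ) = η / 2 := by rw [hδ]; field_simp; norm_num
    rw [hkd] at hF
    have hsub : (⋂ i ∈ Finset.range (k+1), S (n i) ⁻¹' A) ⊆ G (a, d-1) := by
      intro x hx
      simp only [Set.mem_iInter, Finset.mem_range] at hx
      simp only [hG, Set.mem_preimage, RS, Set.mem_ofPred_eq]
      intro i hi
      have := hx i (by omega)
      rw [Set.mem_preimage] at this
      rw [← hA.add, show d - 1 + 1 = d by omega]
      convert this using 2
      simp only [hn]
      push_cast
      ring
    have hfin : η / 2 ≤ cE μ Y ((G (a, d-1)).indicator fun _ => (1:ℝ)) y := by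
      rw [cE_ind (hGm _)]
      have := measureReal_mono (μ := ν) hsub
      linarith
    refine hfin.trans (Finset.single_le_sum (f := fun p => cE μ Y ((G p).indicator fun _ => (1:ℝ)) y)
      (fun p _ => cE_ind_nonneg y) ?_)
    simp only [Finset.mem_product, Finset.mem_range]
    have := hle 0 (Nat.zero_le _)
    omega
  have hRm : MeasurableSet (RS S r N B' D) := hY _ (RS_meas hI hB'm D)
  have hGi : ∀ p, μ.real (G p) = ∫ y, cE μ Y ((G p).indicator fun _ => (1:ℝ)) y ∂μ := by
    intro p; rw [int_cE hY (bd_ind (hGm p)), int_ind (hGm p)]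
  simp only [hGi]
  have hintg : ∀ p ∈ Finset.range (N+1) ×ˢ Finset.range (N+1),
      Integrable (fun y => cE μ Y ((G p).indicator fun _ => (1:ℝ)) y) μ :=
    fun p _ => (cE_bd hY (bd_ind (hGm p))).integrable μ
  rw [← integral_finsetSum _ hintg, ← int_ind hRm, ← integral_mul_const]
  refine integral_mono_ae (((bd_ind hRm).integrable μ).mul_const _) (integrable_finsetSum _ hintg) ?_
  filter_upwards [hfib] with y hy
  by_cases hyR : y ∈ RS S r N B' D
  · simp only [Set.indicator_of_mem hyR, one_mul]; exact hy hyR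
  · simp only [Set.indicator_of_notMem hyR, zero_mul]
    exact Finset.sum_nonneg fun p _ => cE_ind_nonneg y

end lift
end PSz
end Part7

section Part8
open MeasureTheory ProbabilityTheory Filter Topology
open scoped Polynomial

namespace PSz

section met
open scoped InnerProductSpace

variable {E : Type} [SeminormedAddCommGroup E] [InnerProductSpace ℝ E]

lemma met_shift_sum (v : ℕ → E) {B : ℝ} (hB : ∀ n, ‖v n‖ ≤ B) (N i : ℕ) :
    ‖∑ l ∈ Finset.range N, v (i + l) - ∑ l ∈ Finset.range N, v l‖ ≤ 2 * B * i := by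
  induction i with
  | zero => simp
  | succ i ih =>
    have h1 : ∑ l ∈ Finset.range N, v (i + 1 + l) =
        ∑ l ∈ Finset.range N, v (i + l) + v (i + N) - v i := by
      have h2 := Finset.sum_range_succ' (fun l => v (i + l)) N
      rw [Finset.sum_range_succ] at h2
      simp only [add_zero] at h2
      rw [h2]
      simp only [add_sub_cancel_right]
      exact Finset.sum_congr rfl fun l _ => by congr 1; ring
    have h3 : ∑ l ∈ Finset.range N, v (i + 1 + l) - ∑ l ∈ Finset.range N, v l =
        (∑ l ∈ Finset.range N, v (i + l) - ∑ l ∈ Finset.range N, v l) + (v (i+N) - v i) := by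
      rw [h1]; abel
    rw [h3]
    refine (norm_add_le _ _).trans ?_
    have := (norm_sub_le (v (i+N)) (v i)).trans (add_le_add (hB _) (hB _))
    push_cast
    linarith

/-- elementary mean ergodic theorem for stationary sequences -/
lemma met_abstract (v : ℕ → E) (hst : ∀ i j l, ⟪v (i+l), v (j+l)⟫_ℝ = ⟪v i, v j⟫_ℝ) :
    ∀ ε > 0, ∃ N₀ : ℕ, ∀ N ≥ N₀, ∀ M ≥ N₀,
      ‖(N:ℝ)⁻¹ • ∑ n ∈ Finset.range N, v n - (M:ℝ)⁻¹ • ∑ n ∈ Finset.range M, v n‖ < ε := by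
  intro ε hε
  set H := convexHull ℝ (Set.range v) with hH
  have hconv : Convex ℝ H := convex_convexHull ℝ _
  have hvH : ∀ n, v n ∈ H := fun n => subset_convexHull ℝ _ ⟨n, rfl⟩
  have hnorm : ∀ n, ‖v n‖ = ‖v 0‖ := by
    intro n
    have := hst 0 0 n
    rw [real_inner_self_eq_norm_sq, real_inner_self_eq_norm_sq, zero_add] at this
    exact (pow_left_inj₀ (norm_nonneg _) (norm_nonneg _) two_ne_zero).1 this
  set d := sInf ((fun w => ‖w‖ ^ 2) '' H) with hd
  have hbdd : BddBelow ((fun w => ‖w‖ ^ 2) '' H) := ⟨0, by rintro _ ⟨w, _, rfl⟩; positivity⟩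
  have hdle : ∀ w ∈ H, d ≤ ‖w‖ ^ 2 := fun w hw => csInf_le hbdd ⟨w, hw, rfl⟩
  obtain ⟨_, ⟨w, hw, rfl⟩, hwd⟩ := exists_lt_of_csInf_lt (s := (fun w => ‖w‖ ^ 2) '' H)
    ⟨_, v 0, hvH 0, rfl⟩ (show sInf ((fun w => ‖w‖ ^ 2) '' H) < d + ε^2 / 16 by
      have : 0 < ε ^ 2 := by positivity
      linarith)
  rw [hH, convexHull_eq] at hw
  obtain ⟨ι, t, c, z, hc0, hc1, hz, hcz⟩ := hw
  rw [Finset.centerMass_eq_of_sum_1 _ _ hc1] at hcz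
  have : ∀ i, ∃ n : ℕ, i ∈ t → v n = z i := by
    intro i
    by_cases hi : i ∈ t
    · obtain ⟨n, hn⟩ := hz i hi
      exact ⟨n, fun _ => hn⟩
    · exact ⟨0, fun h => absurd h hi⟩
  choose idx hidx using this
  set W : ℕ → E := fun l => ∑ i ∈ t, c i • v (idx i + l) with hW
  have hWH : ∀ l, W l ∈ H := fun l => hconv.sum_mem hc0 hc1 fun i _ => hvH _
  have hW0 : W 0 = w := by
    rw [← hcz]
    exact Finset.sum_congr rfl fun i hi => by rw [add_zero, hidx i hi]
  have hWn : ∀ l, ‖W l‖ ^ 2 = ‖w‖ ^ 2 := by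
    intro l
    rw [← hW0, ← real_inner_self_eq_norm_sq, ← real_inner_self_eq_norm_sq]
    simp only [hW, sum_inner, inner_sum, real_inner_smul_left, real_inner_smul_right, hst, add_zero]
  have hWn' : ∀ l, ‖W l‖ = ‖w‖ := fun l =>
    (pow_left_inj₀ (norm_nonneg _) (norm_nonneg _) two_ne_zero).1 (hWn l)
  set A : ℕ → E := fun N => (N:ℝ)⁻¹ • ∑ l ∈ Finset.range N, W l with hA
  have hAH : ∀ N, 0 < N → A N ∈ H := by
    intro N hN
    rw [hA]
    simp only [Finset.smul_sum]
    refine hconv.sum_mem (fun i _ => by positivity) ?_ fun i _ => hWH _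
    have : (N:ℝ) ≠ 0 := by positivity
    simp [this]
  have hAn : ∀ N, 0 < N → ‖A N‖ ^ 2 ≤ d + ε^2/16 := by
    intro N hN
    have h1 : ‖A N‖ ≤ ‖w‖ := by
      rw [hA]
      simp only
      rw [norm_smul, norm_inv, Real.norm_natCast]
      have h2 : ‖∑ l ∈ Finset.range N, W l‖ ≤ N * ‖w‖ := by
        refine (norm_sum_le _ _).trans ?_
        simp [hWn']
      have hN' : (0:ℝ) < N := by exact_mod_cast hN
      rw [inv_mul_le_iff₀ hN']
      exact h2
    exact (pow_le_pow_left₀ (norm_nonneg _) h1 2).trans hwd.le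
  have hAA : ∀ N M, 0 < N → 0 < M → ‖A N - A M‖ ≤ ε / 2 := by
    intro N M hN hM
    have h1 := parallelogram_law_with_norm ℝ (A N) (A M)
    have h2 : (1/2:ℝ) • A N + (1/2:ℝ) • A M ∈ H :=
      hconv (hAH N hN) (hAH M hM) (by norm_num) (by norm_num) (by norm_num)
    have h3 := hdle _ h2
    rw [← smul_add, norm_smul] at h3
    have h4 := hAn N hN
    have h5 := hAn M hM
    norm_num at h3
    rw [mul_pow] at h3
    have h6 : ‖A N - A M‖ ^ 2 ≤ (ε/2)^2 := by nlinarith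
    exact le_of_sq_le_sq h6 (by positivity) 
  have hcl : ∀ N, 0 < N → ‖A N - (N:ℝ)⁻¹ • ∑ n ∈ Finset.range N, v n‖ ≤
      (∑ i ∈ t, c i * (2 * ‖v 0‖ * idx i)) / N := by
    intro N hN
    have e : A N - (N:ℝ)⁻¹ • ∑ n ∈ Finset.range N, v n = (N:ℝ)⁻¹ • ∑ i ∈ t, c i •
        (∑ l ∈ Finset.range N, v (idx i + l) - ∑ l ∈ Finset.range N, v l) := by
      simp only [hA, hW]
      rw [← smul_sub, Finset.sum_comm]
      congr 1
      simp only [smul_sub, Finset.sum_sub_distrib]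
      rw [← Finset.sum_smul, hc1, one_smul]
      simp only [Finset.smul_sum]
    rw [e, norm_smul, norm_inv, Real.norm_natCast, inv_mul_eq_div]
    gcongr
    refine (norm_sum_le _ _).trans (Finset.sum_le_sum fun i hi => ?_)
    rw [norm_smul, Real.norm_of_nonneg (hc0 i hi)]
    exact mul_le_mul_of_nonneg_left (met_shift_sum v (fun n => (hnorm n).le) N _) (hc0 i hi)
  set C := ∑ i ∈ t, c i * (2 * ‖v 0‖ * idx i)
  have ht : Tendsto (fun N : ℕ => C / N) atTop (𝓝 0) := tendsto_const_div_atTop_nhds_zero_nat C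
  obtain ⟨N₀, hN₀⟩ := eventually_atTop.1 ((ht.eventually (gt_mem_nhds (show (0:ℝ) < ε/4 by positivity))).and
    (eventually_gt_atTop 0))
  refine ⟨N₀, fun N hN M hM => ?_⟩
  have a1 := (hcl N (hN₀ N hN).2).trans_lt (hN₀ N hN).1
  have a2 := (hcl M (hN₀ M hM).2).trans_lt (hN₀ M hM).1
  have a3 := hAA N M (hN₀ N hN).2 (hN₀ M hM).2
  rw [norm_sub_rev] at a1
  have e : (N:ℝ)⁻¹ • ∑ n ∈ Finset.range N, v n - (M:ℝ)⁻¹ • ∑ n ∈ Finset.range M, v n =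
    ((N:ℝ)⁻¹ • ∑ n ∈ Finset.range N, v n - A N) + (A N - A M) +
      (A M - (M:ℝ)⁻¹ • ∑ n ∈ Finset.range M, v n) := by abel
  rw [e]
  have := norm_add₃_le (a := (N:ℝ)⁻¹ • ∑ n ∈ Finset.range N, v n - A N) (b := A N - A M)
      (c := A M - (M:ℝ)⁻¹ • ∑ n ∈ Finset.range M, v n)
  linarith

end met

/-- Cesàro weights -/
noncomputable def cw (N i : ℕ) : ℝ := if i < N then (N:ℝ)⁻¹ else 0

/-- quadratic form -/
noncomputable def QQ (u : ℕ → ℕ → ℝ) (R : ℕ) (w : ℕ → ℝ) : ℝ :=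
  ∑ i ∈ Finset.range R, ∑ j ∈ Finset.range R, w i * w j * u i j

/-- pre-inner product from a positive semidefinite kernel -/
@[reducible] noncomputable def gramCore (u : ℕ → ℕ → ℝ) (hs : ∀ i j, u i j = u j i)
    (hp : ∀ R w, 0 ≤ QQ u R w) : PreInnerProductSpace.Core ℝ (ℕ →₀ ℝ) where
  inner w w' := w.sum fun i a => w'.sum fun j b => a * b * u i j
  conj_inner_symm w w' := by
    simp only [conj_trivial]
    rw [Finsupp.sum_comm]
    refine Finset.sum_congr rfl fun i _ => Finset.sum_congr rfl fun j _ => ?_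
    show w' j * w i * u j i = w i * w' j * u i j
    rw [hs j i]; ring
  re_inner_nonneg w := by
    simp only [RCLike.re_to_real]
    obtain ⟨R, hR⟩ : ∃ R, w.support ⊆ Finset.range R := ⟨w.support.sup id + 1, fun i hi => by
      have := Finset.le_sup (f := id) hi
      simp only [id] at this
      simp; omega⟩
    have := hp R w
    unfold QQ at this
    rw [Finsupp.sum_of_support_subset _ hR _ (by simp)]
    convert this using 2 with i hi
    rw [Finsupp.sum_of_support_subset _ hR _ (by simp)]
  add_left w w' w'' := by
    rw [Finsupp.sum_add_index']
    · simp
    · intro i a b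
      simp [add_mul, Finsupp.sum_add]
  smul_left w w' r := by
    rw [Finsupp.sum_smul_index']
    · simp only [conj_trivial, Finsupp.mul_sum, smul_eq_mul, mul_assoc]
    · simp

lemma met_gram (u : ℕ → ℕ → ℝ) (hs : ∀ i j, u i j = u j i) (hp : ∀ R w, 0 ≤ QQ u R w)
    (hst : ∀ i j l, u (i+l) (j+l) = u i j) :
    ∀ ε > 0, ∃ N₀ : ℕ, ∀ N ≥ N₀, ∀ M ≥ N₀, ∀ R, N ≤ R → M ≤ R →
      QQ u R (fun i => cw N i - cw M i) < ε := by
  intro ε hε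
  letI core := gramCore u hs hp
  letI := @InnerProductSpace.Core.toSeminormedAddCommGroup ℝ (ℕ →₀ ℝ) _ _ _ core
  letI : InnerProductSpace ℝ (ℕ →₀ ℝ) := InnerProductSpace.ofCore core
  have hin : ∀ w w' : ℕ →₀ ℝ, inner ℝ w w' = w.sum fun i a => w'.sum fun j b => a * b * u i j :=
    fun w w' => rfl
  obtain ⟨N₀, h⟩ := met_abstract (fun n => Finsupp.single n (1:ℝ)) (by
    intro i j l
    simp only [hin]
    simp [hst]) (Real.sqrt ε) (Real.sqrt_pos.2 hε)
  refine ⟨N₀, fun N hN M hM R hNR hMR => ?_⟩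
  have h1 := h N hN M hM
  have h2 := (Real.lt_sqrt (norm_nonneg _)).1 h1
  refine lt_of_eq_of_lt ?_ h2
  rw [← real_inner_self_eq_norm_sq]
  have key : ∀ N ≤ R, (N:ℝ)⁻¹ • ∑ n ∈ Finset.range N, Finsupp.single n (1:ℝ) =
      ∑ n ∈ Finset.range R, Finsupp.single n (cw N n) := by
    intro N hN
    rw [Finset.smul_sum, ← Finset.sum_subset (Finset.range_mono hN)]
    · refine Finset.sum_congr rfl fun n hn => ?_
      rw [Finset.mem_range] at hn
      simp [cw, hn]
    · intro n _ hn
      rw [Finset.mem_range] at hn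
      simp [cw, hn]
  rw [key N hNR, key M hMR, ← Finset.sum_sub_distrib]
  have e : ∑ n ∈ Finset.range R, (Finsupp.single n (cw N n) - Finsupp.single n (cw M n)) =
      ∑ n ∈ Finset.range R, Finsupp.single n (cw N n - cw M n) :=
    Finset.sum_congr rfl fun n _ => (Finsupp.single_sub _ _ _).symm
  rw [e, sum_inner]
  simp only [inner_sum]
  unfold QQ
  refine Finset.sum_congr rfl fun i _ => Finset.sum_congr rfl fun j _ => ?_
  rw [hin, Finsupp.sum_single_index, Finsupp.sum_single_index]
  · simp
  · simp

end PSz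
end Part8

section Part9
open MeasureTheory ProbabilityTheory Filter Topology
open scoped Polynomial

namespace PSz

set_option linter.unusedSectionVars false
set_option linter.unusedVariables false

section hs
variable {X : Type} [mX : MeasurableSpace X]

lemma sq_int_le (ν : Measure X) [IsProbabilityMeasure ν] {g : X → ℝ} (hg : Integrable g ν)
    (hg2 : Integrable (fun x => g x ^ 2) ν) : (∫ x, g x ∂ν) ^ 2 ≤ ∫ x, g x ^ 2 ∂ν := by
  set c := ∫ x, g x ∂ν with hc
  have h0 : 0 ≤ ∫ x, (g x - c) ^ 2 ∂ν := integral_nonneg fun x => sq_nonneg _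
  have e : (fun x => (g x - c) ^ 2) = fun x => g x ^ 2 - (2 * c) * g x + c ^ 2 := by
    ext x; ring
  have i1 : Integrable (fun x => g x ^ 2 - (2 * c) * g x) ν := hg2.sub (hg.const_mul _)
  rw [e, integral_add i1 (integrable_const _),
    integral_sub hg2 (hg.const_mul _), integral_const_mul, integral_const] at h0
  simp only [probReal_univ, one_smul, ← hc] at h0
  nlinarith

/-- fibrewise Hilbert-Schmidt bound -/
lemma hs_bound (ν : Measure X) [IsProbabilityMeasure ν] (f : ℕ → X → ℝ) (hf : ∀ n, Bd (f n))
    {h : X → ℝ} (hh : Bd h) (R : ℕ) (w : ℕ → ℝ) :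
    ∫ x, (∑ n ∈ Finset.range R, w n * ((∫ z, h z * f n z ∂ν) * f n x)) ^ 2 ∂ν ≤
      QQ (fun i j => (∫ z, f i z * f j z ∂ν) ^ 2) R w := by
  have hK2 : ∀ x, (fun z => (∑ n ∈ Finset.range R, w n * f n x * f n z) ^ 2) = fun z =>
      ∑ i ∈ Finset.range R, ∑ j ∈ Finset.range R, (w i * w j * (f i x * f j x)) * (f i z * f j z) := by
    intro x; ext z
    rw [sq, Finset.sum_mul_sum]
    exact Finset.sum_congr rfl fun i _ => Finset.sum_congr rfl fun j _ => by ring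
  have hintg : ∀ x, ∫ z, (∑ n ∈ Finset.range R, w n * f n x * f n z) ^ 2 ∂ν =
      ∑ i ∈ Finset.range R, ∑ j ∈ Finset.range R,
        (w i * w j * ∫ z, f i z * f j z ∂ν) * (f i x * f j x) := by
    intro x
    rw [hK2, integral_finsetSum _ fun i _ => integrable_finsetSum _ fun j _ =>
      (((hf i).mul (hf j)).integrable ν).const_mul _]
    refine Finset.sum_congr rfl fun i _ => ?_
    rw [integral_finsetSum _ fun j _ => (((hf i).mul (hf j)).integrable ν).const_mul _]
    refine Finset.sum_congr rfl fun j _ => ?_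
    rw [integral_const_mul]; ring
  have hI2 : Integrable (fun x => ∑ i ∈ Finset.range R, ∑ j ∈ Finset.range R,
        (w i * w j * ∫ z, f i z * f j z ∂ν) * (f i x * f j x)) ν :=
    integrable_finsetSum _ fun i _ => integrable_finsetSum _ fun j _ =>
      (((hf i).mul (hf j)).integrable ν).const_mul _
  have hpt : ∀ x, (∑ n ∈ Finset.range R, w n * ((∫ z, h z * f n z ∂ν) * f n x)) ^ 2 ≤
      ∑ i ∈ Finset.range R, ∑ j ∈ Finset.range R,
        (w i * w j * ∫ z, f i z * f j z ∂ν) * (f i x * f j x) := by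
    intro x
    rw [← hintg]
    have e : ∑ n ∈ Finset.range R, w n * ((∫ z, h z * f n z ∂ν) * f n x) =
        ∫ z, h z * (∑ n ∈ Finset.range R, w n * f n x * f n z) ∂ν := by
      have : (fun z => h z * (∑ n ∈ Finset.range R, w n * f n x * f n z)) = fun z =>
          ∑ n ∈ Finset.range R, (w n * f n x) * (h z * f n z) := by
        ext z; rw [Finset.mul_sum]; exact Finset.sum_congr rfl fun i _ => by ring
      rw [this, integral_finsetSum _ fun i _ => ((hh.mul (hf i)).integrable ν).const_mul _]
      refine Finset.sum_congr rfl fun j _ => ?_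
      rw [integral_const_mul]; ring
    have hk : Integrable (fun z => (∑ n ∈ Finset.range R, w n * f n x * f n z) ^ 2) ν := by
      rw [hK2]
      exact integrable_finsetSum _ fun i _ => integrable_finsetSum _ fun j _ =>
        (((hf i).mul (hf j)).integrable ν).const_mul _
    have hm : Measurable (fun z => ∑ n ∈ Finset.range R, w n * f n x * f n z) :=
      Finset.measurable_fun_sum _ fun i _ => (hf i).1.const_mul _
    have hle : ∀ z, (h z * (∑ n ∈ Finset.range R, w n * f n x * f n z)) ^ 2 ≤
        (∑ n ∈ Finset.range R, w n * f n x * f n z) ^ 2 := by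
      intro z
      rw [mul_pow]
      have : h z ^ 2 ≤ 1 := by rw [sq_le_one_iff_abs_le_one]; exact hh.2 z
      exact mul_le_of_le_one_left (sq_nonneg _) this
    have hk' : Integrable (fun z => (h z * (∑ n ∈ Finset.range R, w n * f n x * f n z)) ^ 2) ν :=
      hk.mono' ((hh.1.mul hm).pow_const 2).aestronglyMeasurable
        (ae_of_all _ fun z => by rw [Real.norm_of_nonneg (sq_nonneg _)]; exact hle z)
    have hk1 : Integrable (fun z => h z * (∑ n ∈ Finset.range R, w n * f n x * f n z)) ν := by
      have : (fun z => h z * (∑ n ∈ Finset.range R, w n * f n x * f n z)) = fun z =>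
          ∑ n ∈ Finset.range R, (w n * f n x) * (h z * f n z) := by
        ext z; rw [Finset.mul_sum]; exact Finset.sum_congr rfl fun i _ => by ring
      rw [this]
      exact integrable_finsetSum _ fun i _ => ((hh.mul (hf i)).integrable ν).const_mul _
    rw [e]
    exact (sq_int_le ν hk1 hk').trans (integral_mono hk' hk hle)
  have hm : Measurable (fun x => (∑ n ∈ Finset.range R, w n * ((∫ z, h z * f n z ∂ν) * f n x)) ^ 2) :=
    (Finset.measurable_fun_sum _ fun i _ => ((hf i).1.const_mul _).const_mul _).pow_const 2
  have h1 := integral_mono (hI2.mono' hm.aestronglyMeasurable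
    (ae_of_all _ fun z => by rw [Real.norm_of_nonneg (sq_nonneg _)]; exact hpt z)) hI2 hpt
  refine h1.trans (le_of_eq ?_)
  rw [integral_finsetSum _ fun i _ => integrable_finsetSum _ fun j _ =>
      (((hf i).mul (hf j)).integrable ν).const_mul _]
  refine Finset.sum_congr rfl fun i _ => ?_
  rw [integral_finsetSum _ fun j _ => (((hf i).mul (hf j)).integrable ν).const_mul _]
  refine Finset.sum_congr rfl fun j _ => ?_
  rw [integral_const_mul]; ring

lemma hs_nonneg (ν : Measure X) [IsProbabilityMeasure ν] (f : ℕ → X → ℝ) (hf : ∀ n, Bd (f n))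
    (R : ℕ) (w : ℕ → ℝ) : 0 ≤ QQ (fun i j => (∫ z, f i z * f j z ∂ν) ^ 2) R w :=
  (integral_nonneg fun x => sq_nonneg _).trans (hs_bound ν f hf bd_zero R w)

lemma ae_small (μ : Measure X) [IsProbabilityMeasure μ] {g : ℕ → X → ℝ} (h0 : ∀ i x, 0 ≤ g i x)
    (hi : ∀ i, Integrable (g i) μ) (hs : ∀ i, ∫ x, g i x ∂μ ≤ (1/8:ℝ)^i) :
    ∀ᵐ x ∂μ, ∀ᶠ i in atTop, g i x ≤ (1/4:ℝ)^i := by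
  have hb : ∀ i, μ {x | (1/4:ℝ)^i ≤ g i x} ≤ ENNReal.ofReal ((1/2:ℝ)^i) := by
    intro i
    have h1 := mul_meas_ge_le_integral_of_nonneg (ae_of_all μ (h0 i)) (hi i) ((1/4:ℝ)^i)
    have h2 := h1.trans (hs i)
    have e : (1/8:ℝ)^i = (1/4)^i * (1/2)^i := by rw [← mul_pow]; norm_num
    rw [e] at h2
    have h3 := le_of_mul_le_mul_left h2 (by positivity)
    rw [← ENNReal.ofReal_toReal (measure_ne_top μ {x | (1/4:ℝ)^i ≤ g i x})]
    exact ENNReal.ofReal_le_ofReal h3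
  have hsum : ∑' i, μ {x | (1/4:ℝ)^i ≤ g i x} ≠ ⊤ := by
    refine ne_top_of_le_ne_top ?_ (ENNReal.tsum_le_tsum hb)
    rw [← ENNReal.ofReal_tsum_of_nonneg (fun i => by positivity) summable_geometric_two]
    exact ENNReal.ofReal_ne_top
  filter_upwards [ae_eventually_notMem hsum] with x hx
  filter_upwards [hx] with i hi
  exact (not_le.1 hi).le

lemma cauchy_of_geom {a : ℕ → ℝ} (h : ∀ᶠ i in atTop, |a i - a (i+1)| ≤ (1/2:ℝ)^i) : CauchySeq a := by
  obtain ⟨i0, hi⟩ := eventually_atTop.1 h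
  have : CauchySeq (fun i => a (i + i0)) := by
    refine cauchySeq_of_le_geometric (1/2) 1 (by norm_num) fun i => ?_
    rw [Real.dist_eq, one_mul, show i + 1 + i0 = i + i0 + 1 by ring]
    refine (hi _ (by omega)).trans ?_
    exact pow_le_pow_of_le_one (by norm_num) (by norm_num) (by omega)
  have ht := (cauchySeq_tendsto_of_complete this).choose_spec
  exact ((tendsto_add_atTop_iff_nat i0).1 ht).cauchySeq

/-- `L¹` distance from the limit -/
lemma l1_limit (ν : Measure X) [IsProbabilityMeasure ν] {a : ℕ → X → ℝ} {G : X → ℝ}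
    (ha : ∀ i, Bd (a i)) (hG : Bd G) (hlim : ∀ᵐ x ∂ν, Tendsto (fun i => a i x) atTop (𝓝 (G x)))
    {i0 : ℕ} (h : ∀ i ≥ i0, ∫ x, |a i x - a (i+1) x| ∂ν ≤ (1/2:ℝ)^i) (i : ℕ) (hi : i0 ≤ i) :
    ∫ x, |G x - a i x| ∂ν ≤ 2 * (1/2:ℝ)^i := by
  have hintg : ∀ i j, Integrable (fun x => |a i x - a j x|) ν := fun i j =>
    (((ha i).integrable ν).sub ((ha j).integrable ν)).abs
  have h1 : ∀ l, ∫ x, |a (i+l) x - a i x| ∂ν ≤ 2 * (1/2:ℝ)^i - 2 * (1/2)^(i+l) := by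
    intro l
    induction l with
    | zero => simp
    | succ l ih =>
      have h2 : ∫ x, |a (i+(l+1)) x - a i x| ∂ν ≤
          ∫ x, |a (i+l) x - a (i+l+1) x| + |a (i+l) x - a i x| ∂ν := by
        refine integral_mono (hintg _ _) ((hintg _ _).add (hintg _ _)) fun x => ?_
        simp only
        rw [abs_sub_comm (a (i+l) x) (a (i+l+1) x)]
        exact abs_sub_le _ _ _
      rw [integral_add (hintg _ _) (hintg _ _)] at h2
      have h3 := h (i+l) (by omega)
      have e : (1/2:ℝ)^(i+(l+1)) = (1/2)^(i+l) / 2 := by rw [← add_assoc, pow_succ]; ring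
      rw [e]; linarith
  have h2 : Tendsto (fun l => ∫ x, |a (i+l) x - a i x| ∂ν) atTop (𝓝 (∫ x, |G x - a i x| ∂ν)) := by
    refine tendsto_integral_of_dominated_convergence (fun _ => 2) (fun l => (hintg _ _).1)
      (integrable_const _) (fun l => ae_of_all _ fun x => ?_) ?_
    · have h3 := abs_le.1 ((ha (i+l)).2 x)
      have h4 := abs_le.1 ((ha i).2 x)
      rw [Real.norm_eq_abs, abs_abs, abs_le]; constructor <;> linarith
    · filter_upwards [hlim] with x hx
      have := (tendsto_add_atTop_iff_nat i).2 hx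
      have h5 : Tendsto (fun l => a (i + l) x) atTop (𝓝 (G x)) := by simpa [add_comm] using this
      exact (h5.sub_const _).abs
  refine le_of_tendsto h2 (Eventually.of_forall fun l => (h1 l).trans ?_)
  have : (0:ℝ) ≤ (1/2)^(i+l) := by positivity
  linarith

lemma int_abs_le (ν : Measure X) [IsProbabilityMeasure ν] {g : X → ℝ} (hg : Integrable g ν)
    (hg2 : Integrable (fun x => g x ^ 2) ν) {c : ℝ} (hc : 0 ≤ c) (h : ∫ x, g x ^ 2 ∂ν ≤ c ^ 2) :
    ∫ x, |g x| ∂ν ≤ c := by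
  have := sq_int_le ν hg.abs (by simpa using hg2)
  simp only [sq_abs] at this
  exact le_of_sq_le_sq (this.trans h) hc

lemma int_shift (w : ℤ → ℝ) (hw : ∀ n, |w n| ≤ 1) (m : ℤ) (N : ℕ) :
    |∑ n ∈ Finset.range N, w (n + m) - ∑ n ∈ Finset.range N, w n| ≤ 2 * |(m:ℝ)| := by
  rcases le_total 0 m with h | h
  · obtain ⟨i, rfl⟩ := Int.eq_ofNat_of_zero_le h
    have := met_shift_sum (E := ℝ) (fun n => w n) (B := 1) (fun n => hw n) N i
    simpa [add_comm] using this
  · obtain ⟨i, hi⟩ := Int.eq_ofNat_of_zero_le (neg_nonneg.2 h)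
    have := met_shift_sum (E := ℝ) (fun n => w (n + m)) (B := 1) (fun n => hw _) N i
    have e : ∀ l : ℕ, w (((i + l : ℕ):ℤ) + m) = w l := fun l => by
      congr 1; push_cast; omega
    simp only [e] at this
    rw [abs_sub_comm]
    have e2 : |(m:ℝ)| = i := by
      have : (m:ℝ) = -(i:ℝ) := by
        have : m = -(i:ℤ) := by omega
        rw [this]; push_cast; rfl
      rw [this, abs_neg, Nat.abs_cast]
    rw [e2]
    simpa using this

end hs

section fib
variable {X : Type} {Y : MeasurableSpace X} [mX : MeasurableSpace X] [StandardBorelSpace X]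
  {μ : Measure X} [IsProbabilityMeasure μ]

lemma fib_ae (hY : Y ≤ mX) {p : X → Prop} (hp : ∀ᵐ x ∂μ, p x) :
    ∀ᵐ y ∂μ, ∀ᵐ x ∂(condExpKernel (mΩ := mX) μ Y y), p x := by
  rw [← condExpKernel_comp_trim (μ := μ) hY] at hp
  exact ae_of_ae_trim hY (Measure.ae_ae_of_ae_comp hp)

lemma fib_const (hY : Y ≤ mX) {g : X → ℝ} (hg : BdY Y g) :
    ∀ᵐ y ∂μ, ∀ᵐ x ∂(condExpKernel (mΩ := mX) μ Y y), g x = g y := by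
  have hb := hg.bd hY
  have h1 := cE_self (μ := μ) hY hg
  have h2 := cE_mul (μ := μ) hY hb hg
  filter_upwards [h1, h2] with y h1 h2
  rw [h1] at h2
  unfold cE at h1 h2
  set ν := condExpKernel (mΩ := mX) μ Y y
  have h3 : ∫ x, (g x - g y) ^ 2 ∂ν = 0 := by
    have e : (fun x => (g x - g y) ^ 2) = fun x => g x * g x - (2 * g y) * g x + g y ^ 2 := by
      ext x; ring
    have i1 := (hb.mul hb).integrable ν
    have i2 := (hb.integrable ν).const_mul (2 * g y)
    have i3 : Integrable (fun x => g x * g x - (2 * g y) * g x) ν := i1.sub i2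
    rw [e, integral_add i3 (integrable_const _), integral_sub i1 i2, integral_const_mul,
      integral_const, h1, h2]
    simp; ring
  rw [integral_eq_zero_iff_of_nonneg (fun x => sq_nonneg _)] at h3
  · filter_upwards [h3] with x hx
    simpa [sub_eq_zero] using hx
  · have e : (fun x => (g x - g y) ^ 2) = fun x => g x * g x - (2 * g y) * g x + g y ^ 2 := by
      ext x; ring
    rw [e]
    exact (((hb.mul hb).integrable ν).sub ((hb.integrable ν).const_mul (2 * g y))).add (integrable_const _)

end fib
end PSz
end Part9

section Part10
open MeasureTheory ProbabilityTheory Filter Topology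
open scoped Polynomial

namespace PSz

set_option linter.unusedSectionVars false
set_option linter.unusedVariables false

/-- relative correlations -/
noncomputable def cc {X : Type} {mX : MeasurableSpace X} [StandardBorelSpace X] (μ : Measure X)
    [IsProbabilityMeasure μ] (S : ℤ → X → X) (Y : MeasurableSpace X) (f : X → ℝ) (m n : ℤ) : X → ℝ :=
  cE (mX := mX) μ Y (fun x => f (S m x) * f (S n x))

noncomputable def FN {X : Type} {mX : MeasurableSpace X} [StandardBorelSpace X] (μ : Measure X)
    [IsProbabilityMeasure μ] (S : ℤ → X → X) (Y : MeasurableSpace X) (f : X → ℝ) (N : ℕ) (x : X) : ℝ :=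
  ∑ n ∈ Finset.range N, (N:ℝ)⁻¹ * (cc μ S Y f 0 n x * f (S n x))

noncomputable def AN {X : Type} {mX : MeasurableSpace X} [StandardBorelSpace X] (μ : Measure X)
    [IsProbabilityMeasure μ] (S : ℤ → X → X) (Y : MeasurableSpace X) (f : X → ℝ) (N : ℕ) (m : ℤ)
    (y x : X) : ℝ :=
  ∑ n ∈ Finset.range N, (N:ℝ)⁻¹ * (cc μ S Y f m n y * f (S n x))

noncomputable def DD {X : Type} {mX : MeasurableSpace X} [StandardBorelSpace X] (μ : Measure X)
    [IsProbabilityMeasure μ] (S : ℤ → X → X) (Y : MeasurableSpace X) (f : X → ℝ) (N M : ℕ) (y : X) : ℝ :=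
  QQ (fun i j => (cc μ S Y f i j y) ^ 2) (N + M) (fun i => cw N i - cw M i)

lemma sum_cw {N R : ℕ} (h : N ≤ R) (a : ℕ → ℝ) :
    ∑ n ∈ Finset.range N, (N:ℝ)⁻¹ * a n = ∑ n ∈ Finset.range R, cw N n * a n := by
  rw [← Finset.sum_subset (Finset.range_mono h)]
  · refine Finset.sum_congr rfl fun n hn => ?_
    rw [Finset.mem_range] at hn
    simp [cw, hn]
  · intro n _ hn
    rw [Finset.mem_range] at hn
    simp [cw, hn]

lemma sum_avg_le {N : ℕ} {a : ℕ → ℝ} {c : ℝ} (hc : 0 ≤ c) (h : ∀ n, |a n| ≤ c) :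
    |∑ n ∈ Finset.range N, (N:ℝ)⁻¹ * a n| ≤ c := by
  rcases Nat.eq_zero_or_pos N with rfl | hN
  · simpa using hc
  have hN' : (0:ℝ) < N := by exact_mod_cast hN
  refine (Finset.abs_sum_le_sum_abs _ _).trans ?_
  calc ∑ n ∈ Finset.range N, |(N:ℝ)⁻¹ * a n| ≤ ∑ n ∈ Finset.range N, (N:ℝ)⁻¹ * c := by
        refine Finset.sum_le_sum fun n _ => ?_
        rw [abs_mul, abs_of_nonneg (by positivity : (0:ℝ) ≤ (N:ℝ)⁻¹)]
        gcongr; exact h n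
    _ = c := by simp; field_simp

section
variable {X : Type} {Y : MeasurableSpace X} [mX : MeasurableSpace X] [StandardBorelSpace X]
  {μ : Measure X} [IsProbabilityMeasure μ] {S : ℤ → X → X} {f : X → ℝ}

lemma cc_bdY (hA : Act μ S) (hf : Bd f) (m n : ℤ) : BdY Y (cc μ S Y f m n) :=
  cE_bdY ((hf.comp (hA.measurable m)).mul (hf.comp (hA.measurable n)))

lemma FN_bd (hA : Act μ S) (hY : Y ≤ mX) (hf : Bd f) (N : ℕ) : Bd (FN μ S Y f N) := by
  have h : ∀ n : ℕ, Bd (fun x => cc μ S Y f 0 n x * f (S n x)) := fun n =>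
    ((cc_bdY hA hf 0 n).bd hY).mul (hf.comp (hA.measurable n))
  exact ⟨Finset.measurable_fun_sum _ fun n _ => (h n).1.const_mul _,
    fun x => sum_avg_le zero_le_one fun n => (h n).2 x⟩

lemma AN_bd (hA : Act μ S) (hf : Bd f) (N : ℕ) (m : ℤ) (y : X) :
    Bd (AN μ S Y f N m y) := by
  refine ⟨Finset.measurable_fun_sum _ fun n _ =>
    ((hf.1.comp (hA.measurable n)).const_mul _).const_mul _, fun x => sum_avg_le zero_le_one fun n => ?_⟩
  rw [abs_mul]
  exact mul_le_one₀ ((cc_bdY hA hf m n).2 y) (abs_nonneg _) (hf.2 _)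

lemma AN_diff (hA : Act μ S) (hf : Bd f) (N M : ℕ) (m : ℤ) (y : X) :
    ∫ x, (AN μ S Y f N m y x - AN μ S Y f M m y x) ^ 2 ∂(condExpKernel (mΩ := mX) μ Y y) ≤
      DD μ S Y f N M y := by
  have := hs_bound (condExpKernel (mΩ := mX) μ Y y) (fun (n : ℕ) x => f (S n x))
    (fun n => hf.comp (hA.measurable n)) (hf.comp (hA.measurable m)) (N + M) (fun i => cw N i - cw M i)
  refine le_trans (le_of_eq ?_) this
  refine integral_congr_ae (ae_of_all _ fun x => ?_)
  simp only [AN]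
  rw [sum_cw (show N ≤ N + M by omega), sum_cw (show M ≤ N + M by omega), ← Finset.sum_sub_distrib]
  congr 1
  refine Finset.sum_congr rfl fun n _ => ?_
  simp only [cc, cE]; ring

lemma DD_nonneg (hA : Act μ S) (hf : Bd f) (N M : ℕ) (y : X) : 0 ≤ DD μ S Y f N M y :=
  (integral_nonneg fun x => sq_nonneg _).trans (AN_diff hA hf N M 0 y)

lemma DD_integrable (hA : Act μ S) (hY : Y ≤ mX) (hf : Bd f) (N M : ℕ) :
    Integrable (DD μ S Y f N M) μ := by
  unfold DD QQ
  exact integrable_finsetSum _ fun i _ => integrable_finsetSum _ fun j _ =>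
    (((cc_bdY hA hf i j).bd hY).sq.integrable μ).const_mul _

lemma DD_integral (hA : Act μ S) (hY : Y ≤ mX) (hf : Bd f) (R : ℕ) (w : ℕ → ℝ) :
    ∫ y, QQ (fun i j => (cc μ S Y f i j y) ^ 2) R w ∂μ =
      QQ (fun i j => ∫ y, (cc μ S Y f i j y) ^ 2 ∂μ) R w := by
  simp only [QQ]
  rw [integral_finsetSum _ fun (i:ℕ) _ => integrable_finsetSum _ fun (j:ℕ) _ =>
    (((cc_bdY hA hf i j).bd hY).sq.integrable μ).const_mul _]
  refine Finset.sum_congr rfl fun i _ => ?_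
  rw [integral_finsetSum _ fun (j:ℕ) _ => (((cc_bdY hA hf i j).bd hY).sq.integrable μ).const_mul _]
  refine Finset.sum_congr rfl fun j _ => ?_
  rw [integral_const_mul]

lemma cc_shift (hA : Act μ S) (hY : Y ≤ mX) (hI : Inv S Y) (hf : Bd f) (i j l : ℤ) :
    cc μ S Y f (i + l) (j + l) =ᵐ[μ] fun x => cc μ S Y f i j (S l x) := by
  have := cE_comp hA hY hI l ((hf.comp (hA.measurable i)).mul (hf.comp (hA.measurable j)))
  unfold cc
  simpa only [hA.add] using this

lemma DD_small (hA : Act μ S) (hY : Y ≤ mX) (hI : Inv S Y) (hf : Bd f) :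
    ∀ ε > 0, ∃ N₀ : ℕ, ∀ N ≥ N₀, ∀ M ≥ N₀, ∫ y, DD μ S Y f N M y ∂μ < ε := by
  intro ε hε
  obtain ⟨N₀, h⟩ := met_gram (fun i j => ∫ y, (cc μ S Y f i j y) ^ 2 ∂μ)
    (by intro i j; simp only [cc, mul_comm])
    (by
      intro R w
      rw [← DD_integral hA hY hf]
      exact integral_nonneg fun y => hs_nonneg (condExpKernel (mΩ := mX) μ Y y) (fun (n : ℕ) x => f (S n x))
        (fun n => hf.comp (hA.measurable n)) R w)
    (by
      intro i j l
      have h1 := cc_shift hA hY hI hf i j l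
      have h2 := hA.integral l ((cc_bdY (Y := Y) hA hf i j).bd hY).sq
      simp only [Nat.cast_add]
      rw [← h2]
      refine integral_congr_ae ?_
      filter_upwards [h1] with x hx
      rw [hx]) ε hε
  refine ⟨N₀, fun N hN M hM => ?_⟩
  have := h N hN M hM (N+M) (by omega) (by omega)
  rw [← DD_integral hA hY hf] at this
  exact this

lemma FN_fib (hA : Act μ S) (hY : Y ≤ mX) (hI : Inv S Y) (hf : Bd f) :
    ∀ᵐ y ∂μ, ∀ᵐ x ∂(condExpKernel (mΩ := mX) μ Y y), ∀ (m : ℤ) (N : ℕ),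
      FN μ S Y f N (S m x) =
        ∑ n ∈ Finset.range N, (N:ℝ)⁻¹ * (cc μ S Y f m (n + m) y * f (S (n + m) x)) := by
  have h1 : ∀ᵐ x ∂μ, ∀ (m : ℤ) (n : ℕ), cc μ S Y f m (n + m) x = cc μ S Y f 0 n (S m x) := by
    rw [ae_all_iff]; intro m
    rw [ae_all_iff]; intro n
    have := cc_shift hA hY hI hf 0 n m
    rw [zero_add] at this
    exact this
  have h2 : ∀ᵐ y ∂μ, ∀ m n : ℤ, ∀ᵐ x ∂(condExpKernel (mΩ := mX) μ Y y),
      cc μ S Y f m n x = cc μ S Y f m n y := by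
    rw [ae_all_iff]; intro m
    rw [ae_all_iff]; intro n
    exact fib_const hY (cc_bdY hA hf m n)
  filter_upwards [fib_ae hY h1, h2] with y h1 h2
  have h3 : ∀ᵐ x ∂(condExpKernel (mΩ := mX) μ Y y), ∀ m n : ℤ,
      cc μ S Y f m n x = cc μ S Y f m n y := by
    rw [ae_all_iff]; intro m
    rw [ae_all_iff]; intro n
    exact h2 m n
  filter_upwards [h1, h3] with x h1 h3 m N
  unfold FN
  refine Finset.sum_congr rfl fun n _ => ?_
  rw [← h1, h3, hA.add]

lemma FN_diff (hA : Act μ S) (hY : Y ≤ mX) (hI : Inv S Y) (hf : Bd f) (N M : ℕ) :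
    ∫ x, (FN μ S Y f N x - FN μ S Y f M x) ^ 2 ∂μ ≤ ∫ y, DD μ S Y f N M y ∂μ := by
  have hb := ((FN_bd hA hY hf N).half_sub (FN_bd hA hY hf M)).sq
  have e : ∀ ν : Measure X, ∫ x, (FN μ S Y f N x - FN μ S Y f M x) ^ 2 ∂ν =
      4 * ∫ x, ((FN μ S Y f N x - FN μ S Y f M x) / 2) ^ 2 ∂ν := by
    intro ν
    rw [← integral_const_mul]
    congr 1; ext x; ring
  rw [e, ← int_cE hY hb, ← integral_const_mul]
  refine integral_mono_ae (((cE_bd hY hb).integrable μ).const_mul _) (DD_integrable hA hY hf N M) ?_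
  filter_upwards [FN_fib hA hY hI hf] with y hy
  unfold cE
  rw [← e]
  refine le_trans (le_of_eq (integral_congr_ae ?_)) (AN_diff hA hf N M 0 y)
  filter_upwards [hy] with x hx
  have h1 := hx 0 N
  have h2 := hx 0 M
  simp only [hA.zero, add_zero] at h1 h2
  rw [h1, h2]; rfl

end
end PSz
end Part10

section Part11
open MeasureTheory ProbabilityTheory Filter Topology
open scoped Polynomial

namespace PSz

set_option linter.unusedSectionVars false
set_option linter.unusedVariables false

section
variable {X : Type} {Y : MeasurableSpace X} [mX : MeasurableSpace X] [StandardBorelSpace X]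
  {μ : Measure X} [IsProbabilityMeasure μ] {S : ℤ → X → X} {f : X → ℝ}

lemma AN_close (hA : Act μ S) (hf : Bd f) {m : ℤ} {N : ℕ} {y x : X}
    (h : FN μ S Y f N (S m x) =
        ∑ n ∈ Finset.range N, (N:ℝ)⁻¹ * (cc μ S Y f m (n + m) y * f (S (n + m) x))) :
    |AN μ S Y f N m y x - FN μ S Y f N (S m x)| ≤ (2 * |(m:ℝ)|) / N := by
  have h1 := int_shift (fun n => cc μ S Y f m n y * f (S n x)) (fun n => by
    rw [abs_mul]
    exact mul_le_one₀ ((cc_bdY hA hf m n).2 y) (abs_nonneg _) (hf.2 _)) m N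
  rw [h]
  unfold AN
  rw [← Finset.mul_sum, ← Finset.mul_sum, ← mul_sub, abs_mul, abs_sub_comm,
    abs_of_nonneg (by positivity : (0:ℝ) ≤ (N:ℝ)⁻¹), inv_mul_eq_div]
  gcongr

/-- colouring by rounding -/
lemma round_colour (N : ℕ) (c : ℤ → ℕ → ℝ) (hc : ∀ m n, |c m n| ≤ 1) {η : ℝ} (hη : 0 < η) :
    ∃ (α : Type) (_ : Finite α) (χ : ℤ → α), ∀ m m', χ m = χ m' → ∀ n < N, |c m n - c m' n| ≤ η := by
  set L : ℤ := ⌈1/η⌉ + 1 with hL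
  have hmem : ∀ m n, ⌊c m n / η⌋ ∈ Set.Icc (-L) L := by
    intro m n
    have h1 := abs_le.1 (hc m n)
    have h2 : c m n / η ≤ 1/η := by gcongr; exact h1.2
    have h3 : -(1/η) ≤ c m n / η := by rw [← neg_div]; gcongr; exact h1.1
    have h4 := Int.le_ceil (1/η)
    constructor
    · rw [Int.le_floor, hL]; push_cast; linarith
    · have h5 := Int.floor_le (c m n / η)
      have : (⌊c m n / η⌋:ℝ) ≤ (L:ℝ) := by rw [hL]; push_cast; linarith
      exact_mod_cast this
  refine ⟨Fin N → Set.Icc (-L) L, inferInstance, fun m n => ⟨_, hmem m n⟩, fun m m' h n hn => ?_⟩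
  have h1 := congrFun h ⟨n, hn⟩
  simp only [Subtype.mk.injEq] at h1
  have h2 := Int.abs_sub_lt_one_of_floor_eq_floor h1
  rw [← sub_div, abs_div, abs_of_pos hη, div_lt_one hη] at h2
  exact h2.le

lemma cap_fibre (hA : Act μ S) (hf : Bd f) {F : X → ℝ} (hF : Bd F) {N : ℕ → ℕ}
    (hN : Tendsto N atTop atTop) {y : X}
    (h1 : ∀ᶠ i in atTop, DD μ S Y f (N i) (N (i+1)) y ≤ (1/4:ℝ)^i)
    (h2 : ∀ᵐ x ∂(condExpKernel (mΩ := mX) μ Y y), ∀ m : ℤ,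
      Tendsto (fun i => FN μ S Y f (N i) (S m x)) atTop (𝓝 (F (S m x))))
    (h3 : ∀ᵐ x ∂(condExpKernel (mΩ := mX) μ Y y), ∀ (m : ℤ) (N : ℕ),
      FN μ S Y f N (S m x) =
        ∑ n ∈ Finset.range N, (N:ℝ)⁻¹ * (cc μ S Y f m (n + m) y * f (S (n + m) x))) :
    TB (rho μ S Y F y) := by
  set ν := condExpKernel (mΩ := mX) μ Y y with hν
  obtain ⟨i0, h1⟩ := eventually_atTop.1 h1
  have key : ∀ (m : ℤ), ∀ i ≥ i0, ∫ x, |F (S m x) - AN μ S Y f (N i) m y x| ∂ν ≤ 2 * (1/2:ℝ)^i := by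
    intro m i hi
    refine l1_limit ν (a := fun i => AN μ S Y f (N i) m y) (G := fun x => F (S m x))
      (fun i => AN_bd hA hf _ _ _) (hF.comp (hA.measurable m)) ?_ ?_ i hi
    · filter_upwards [h2, h3] with x h2 h3
      have e : ∀ i, AN μ S Y f (N i) m y x = (AN μ S Y f (N i) m y x - FN μ S Y f (N i) (S m x)) +
          FN μ S Y f (N i) (S m x) := fun i => by ring
      refine Tendsto.congr (fun i => (e i).symm) ?_
      rw [← zero_add (F (S m x))]
      refine Tendsto.add ?_ (h2 m)
      refine squeeze_zero_norm (fun i => AN_close hA hf (h3 m (N i))) ?_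
      exact (tendsto_const_div_atTop_nhds_zero_nat _).comp hN
    · intro i hi
      have hb := (AN_bd (Y := Y) hA hf (N i) m y).half_sub (AN_bd (Y := Y) hA hf (N (i+1)) m y)
      refine int_abs_le ν (((AN_bd hA hf _ _ _).integrable ν).sub ((AN_bd hA hf _ _ _).integrable ν)) ?_
        (by positivity) ?_
      · have e : (fun x => (AN μ S Y f (N i) m y x - AN μ S Y f (N (i+1)) m y x)^2) = fun x =>
          4 * ((AN μ S Y f (N i) m y x - AN μ S Y f (N (i+1)) m y x)/2)^2 := by ext x; ring
        show Integrable (fun x => (AN μ S Y f (N i) m y x - AN μ S Y f (N (i+1)) m y x)^2) ν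
        rw [e]
        exact (hb.sq.integrable ν).const_mul _
      · refine (AN_diff hA hf (N i) (N (i+1)) m y).trans ((h1 i hi).trans (le_of_eq ?_))
        rw [← pow_mul, mul_comm, pow_mul]; norm_num
  refine TB.of_fin fun ε hε => ?_
  obtain ⟨i, hi⟩ := (((tendsto_pow_atTop_nhds_zero_of_lt_one (r := (1/2:ℝ)) (by norm_num)
    (by norm_num)).eventually (gt_mem_nhds (show (0:ℝ) < ε/8 by positivity))).and
      (eventually_ge_atTop i0)).exists
  obtain ⟨α, hα, χ, hχ⟩ := round_colour (N i) (fun m n => cc μ S Y f m n y)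
    (fun m n => (cc_bdY hA hf m n).2 y) (show 0 < ε/4 by positivity)
  refine ⟨α, hα, χ, fun m m' hm => ?_⟩
  have hcol := hχ m m' hm
  have hp : ∀ x, |AN μ S Y f (N i) m y x - AN μ S Y f (N i) m' y x| ≤ ε/4 := by
    intro x
    unfold AN
    rw [← Finset.sum_sub_distrib]
    have e : ∀ n ∈ Finset.range (N i), ((N i:ℕ):ℝ)⁻¹ * (cc μ S Y f m n y * f (S n x)) -
        ((N i:ℕ):ℝ)⁻¹ * (cc μ S Y f m' n y * f (S n x)) = ((N i:ℕ):ℝ)⁻¹ *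
        (if n < N i then (cc μ S Y f m n y - cc μ S Y f m' n y) * f (S n x) else 0) := by
      intro n hn
      rw [if_pos (Finset.mem_range.1 hn)]; ring
    rw [Finset.sum_congr rfl e]
    refine sum_avg_le (by positivity) fun n => ?_
    split_ifs with hn
    · rw [abs_mul]
      calc _ ≤ ε/4 * 1 := mul_le_mul (hcol n hn) (hf.2 _) (abs_nonneg _) (by positivity)
        _ = _ := mul_one _
    · simp; positivity
  have k1 := key m i hi.2
  have k2 := key m' i hi.2
  have i1 : ∀ m, Integrable (fun x => |F (S m x) - AN μ S Y f (N i) m y x|) ν := fun m =>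
    abs_int (hF.comp (hA.measurable m)) (AN_bd hA hf _ _ _)
  unfold rho cE
  have hle : ∫ x, |(F (S m x) - F (S m' x)) / 2| ∂ν ≤ ∫ x, (|F (S m x) - AN μ S Y f (N i) m y x| +
      |F (S m' x) - AN μ S Y f (N i) m' y x|) + ε/4 ∂ν := by
    have i2 : Integrable (fun x => |F (S m x) - AN μ S Y f (N i) m y x| +
      |F (S m' x) - AN μ S Y f (N i) m' y x|) ν := (i1 m).add (i1 m')
    refine integral_mono ((rho_bd hA hF m m').integrable ν) (i2.add (integrable_const _)) fun x => ?_
    show |(F (S m x) - F (S m' x)) / 2| ≤ (|F (S m x) - AN μ S Y f (N i) m y x| +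
      |F (S m' x) - AN μ S Y f (N i) m' y x|) + ε/4
    have h5 := hp x
    rw [abs_div, abs_two]
    have h6 : |F (S m x) - F (S m' x)| ≤ |F (S m x) - AN μ S Y f (N i) m y x| +
        |AN μ S Y f (N i) m y x - AN μ S Y f (N i) m' y x| + |F (S m' x) - AN μ S Y f (N i) m' y x| := by
      have e : F (S m x) - F (S m' x) = (F (S m x) - AN μ S Y f (N i) m y x) +
        (AN μ S Y f (N i) m y x - AN μ S Y f (N i) m' y x) - (F (S m' x) - AN μ S Y f (N i) m' y x) := by
        ring
      rw [e]
      exact (abs_sub _ _).trans (by gcongr; exact abs_add_le _ _)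
    have := abs_nonneg (F (S m x) - F (S m' x))
    linarith
  have i2 : Integrable (fun x => |F (S m x) - AN μ S Y f (N i) m y x| +
      |F (S m' x) - AN μ S Y f (N i) m' y x|) ν := (i1 m).add (i1 m')
  rw [integral_add i2 (integrable_const _), integral_add (i1 m) (i1 m'), integral_const] at hle
  simp only [probReal_univ, one_smul] at hle
  have := hi.1
  linarith

lemma cap_exists (hA : Act μ S) (hY : Y ≤ mX) (hI : Inv S Y) (hf : Bd f) :
    ∃ (F : X → ℝ) (N : ℕ → ℕ), CAP μ S Y F ∧ Tendsto N atTop atTop ∧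
      ∀ᵐ x ∂μ, Tendsto (fun i => FN μ S Y f (N i) x) atTop (𝓝 (F x)) := by
  choose N0 hN0 using fun i : ℕ => DD_small hA hY hI hf ((1/8:ℝ)^i) (by positivity)
  set N : ℕ → ℕ := fun i => ∑ l ∈ Finset.range (i+1), N0 l + i with hN
  have hN1 : ∀ i, N0 i ≤ N i := fun i =>
    (Finset.single_le_sum (f := N0) (fun _ _ => Nat.zero_le _) (Finset.self_mem_range_succ i)).trans
      (Nat.le_add_right _ _)
  have hN2 : ∀ i, N i ≤ N (i+1) := fun i => by
    simp only [hN]; rw [Finset.sum_range_succ _ (i+1)]; omega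
  have hNt : Tendsto N atTop atTop := tendsto_atTop_mono (fun i => by simp [hN]) tendsto_id
  have hD : ∀ i, ∫ y, DD μ S Y f (N i) (N (i+1)) y ∂μ ≤ (1/8:ℝ)^i := fun i =>
    (hN0 i _ (hN1 i) _ ((hN1 i).trans (hN2 i))).le
  have hΔ := ae_small μ (fun i y => DD_nonneg hA hf (N i) (N (i+1)) y)
    (fun i => DD_integrable hA hY hf _ _) hD
  have hF2 := ae_small μ (g := fun i x => (FN μ S Y f (N i) x - FN μ S Y f (N (i+1)) x)^2)
    (fun i x => sq_nonneg _) (fun i => by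
      have e : (fun x => (FN μ S Y f (N i) x - FN μ S Y f (N (i+1)) x)^2) = fun x =>
          4 * ((FN μ S Y f (N i) x - FN μ S Y f (N (i+1)) x)/2)^2 := by ext x; ring
      rw [e]
      exact (((FN_bd hA hY hf _).half_sub (FN_bd hA hY hf _)).sq.integrable μ).const_mul _)
    (fun i => (FN_diff hA hY hI hf _ _).trans (hD i))
  have hex : ∀ᵐ x ∂μ, ∃ l, Tendsto (fun i => FN μ S Y f (N i) x) atTop (𝓝 l) := by
    filter_upwards [hF2] with x hx
    refine cauchySeq_tendsto_of_complete (cauchy_of_geom ?_)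
    filter_upwards [hx] with i hi
    refine abs_le_of_sq_le_sq (hi.trans (le_of_eq ?_)) (by positivity)
    rw [← pow_mul, mul_comm, pow_mul]; norm_num
  obtain ⟨F0, hF0m, hF0⟩ := measurable_limit_of_tendsto_metrizable_ae
    (fun i => (FN_bd hA hY hf (N i)).1.aemeasurable) hex
  set F : X → ℝ := fun x => max (-1) (min 1 (F0 x)) with hFdef
  have hFb : Bd F := by
    refine ⟨measurable_const.max (measurable_const.min hF0m), fun x => ?_⟩
    rw [abs_le]
    exact ⟨le_max_left _ _, max_le (by norm_num) (min_le_left _ _)⟩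
  have hlim : ∀ᵐ x ∂μ, Tendsto (fun i => FN μ S Y f (N i) x) atTop (𝓝 (F x)) := by
    filter_upwards [hF0] with x hx
    have h1 : F x = F0 x := by
      have h2 : F0 x ≤ 1 := le_of_tendsto hx (Eventually.of_forall fun i => (abs_le.1 ((FN_bd hA hY hf _).2 x)).2)
      have h3 : -1 ≤ F0 x := ge_of_tendsto hx (Eventually.of_forall fun i => (abs_le.1 ((FN_bd hA hY hf _).2 x)).1)
      simp only [hFdef]
      rw [min_eq_right h2, max_eq_right h3]
    rw [h1]; exact hx
  refine ⟨F, N, ⟨hFb, ?_⟩, hNt, hlim⟩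
  have hlimS : ∀ᵐ x ∂μ, ∀ m : ℤ, Tendsto (fun i => FN μ S Y f (N i) (S m x)) atTop (𝓝 (F (S m x))) := by
    rw [ae_all_iff]; intro m
    exact hA.ae m hlim
  filter_upwards [hΔ, fib_ae hY hlimS, FN_fib hA hY hI hf] with y h1 h2 h3
  exact cap_fibre hA hf hFb hNt h1 h2 h3

theorem wm_of_cap (hA : Act μ S) (hY : Y ≤ mX) (hI : Inv S Y)
    (h : ∀ F, CAP (mX := mX) μ S Y F → Measurable[Y] F) : WM μ S Y := by
  intro f hf h0
  obtain ⟨F, N, hF, hN, hlim⟩ := cap_exists hA hY hI hf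
  have hFY : BdY Y F := ⟨h F hF, hF.1.2⟩
  have hFf : ∫ x, F x * f x ∂μ = 0 := by
    rw [int_mul_cE hY hf hFY]
    rw [integral_congr_ae (g := fun _ => (0:ℝ))]
    · simp
    · filter_upwards [h0] with x hx
      simp [hx]
  have hbb : ∀ n : ℕ, Bd (fun x => cc μ S Y f 0 n x * (f x * f (S n x))) := fun n =>
    ((cc_bdY hA hf 0 n).bd hY).mul (hf.mul (hf.comp (hA.measurable n)))
  have hav : ∀ M : ℕ, (∑ n ∈ Finset.range M, ∫ x, (cE μ Y (fun x => f x * f (S n x)) x) ^ 2 ∂μ) / M =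
      ∫ x, FN μ S Y f M x * f x ∂μ := by
    intro M
    have e : (fun x => FN μ S Y f M x * f x) = fun x => ∑ n ∈ Finset.range M, (M:ℝ)⁻¹ *
        (cc μ S Y f 0 n x * (f x * f (S n x))) := by
      ext x
      unfold FN
      rw [Finset.sum_mul]
      exact Finset.sum_congr rfl fun n _ => by ring
    rw [e, integral_finsetSum _ fun n _ => ((hbb n).integrable μ).const_mul _, Finset.sum_div]
    refine Finset.sum_congr rfl fun n _ => ?_
    rw [integral_const_mul, int_mul_cE hY (hf.mul (hf.comp (hA.measurable n))) (cc_bdY hA hf 0 n),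
      inv_mul_eq_div]
    simp only [cc, hA.zero, sq]
  unfold AvZ
  simp only [hav]
  have hsub : Tendsto (fun i => ∫ x, FN μ S Y f (N i) x * f x ∂μ) atTop (𝓝 0) := by
    rw [← hFf]
    refine tendsto_integral_of_dominated_convergence (fun _ => 1)
      (fun i => ((FN_bd hA hY hf _).mul hf).1.aestronglyMeasurable) (integrable_const _)
      (fun i => ae_of_all _ fun x => ((FN_bd hA hY hf _).mul hf).2 x) ?_
    filter_upwards [hlim] with x hx
    exact hx.mul_const _
  refine tendsto_nhds_of_cauchySeq_of_subseq ?_ hN hsub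
  rw [Metric.cauchySeq_iff]
  intro ε hε
  obtain ⟨N₀, hN₀⟩ := DD_small hA hY hI hf (ε^2) (by positivity)
  refine ⟨N₀, fun a ha b hb => ?_⟩
  have h1 := (FN_diff hA hY hI hf a b).trans_lt (hN₀ a ha b hb)
  have hbd := (FN_bd hA hY hf a).half_sub (FN_bd hA hY hf b)
  have i1 : Integrable (fun x => (FN μ S Y f a x - FN μ S Y f b x) ^ 2) μ := by
    have e : (fun x => (FN μ S Y f a x - FN μ S Y f b x)^2) = fun x =>
          4 * ((FN μ S Y f a x - FN μ S Y f b x)/2)^2 := by ext x; ring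
    rw [e]
    exact (hbd.sq.integrable μ).const_mul _
  have hm : Measurable (fun x => (FN μ S Y f a x - FN μ S Y f b x) * f x) :=
    ((FN_bd hA hY hf a).1.sub (FN_bd hA hY hf b).1).mul hf.1
  have hle : ∀ x, ((FN μ S Y f a x - FN μ S Y f b x) * f x) ^ 2 ≤ (FN μ S Y f a x - FN μ S Y f b x)^2 := by
    intro x
    rw [mul_pow]
    exact mul_le_of_le_one_right (sq_nonneg _) (by rw [sq_le_one_iff_abs_le_one]; exact hf.2 x)
  have i2 : Integrable (fun x => ((FN μ S Y f a x - FN μ S Y f b x) * f x) ^ 2) μ :=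
    i1.mono' (hm.pow_const 2).aestronglyMeasurable
      (ae_of_all _ fun z => by rw [Real.norm_of_nonneg (sq_nonneg _)]; exact hle z)
  have ia := ((FN_bd hA hY hf a).mul hf).integrable μ
  have ib := ((FN_bd hA hY hf b).mul hf).integrable μ
  have e : (fun x => (FN μ S Y f a x - FN μ S Y f b x) * f x) =
      fun x => FN μ S Y f a x * f x - FN μ S Y f b x * f x := by ext x; ring
  have i3 : Integrable (fun x => (FN μ S Y f a x - FN μ S Y f b x) * f x) μ := by
    rw [e]; exact ia.sub ib
  have h2 := (sq_int_le μ i3 i2).trans ((integral_mono i2 i1 hle).trans h1.le)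
  have h3 := lt_of_le_of_lt (sq_int_le μ i3 i2) ((integral_mono i2 i1 hle).trans_lt h1)
  rw [Real.dist_eq, ← integral_sub ia ib, ← e]
  exact abs_lt_of_sq_lt_sq h3 hε.le

/-- ergodic polynomial Szemerédi theorem -/
theorem ergodic_sz (hA : Act μ S) {r : ℕ} (hr : 1 ≤ r) : SZ μ S r mX := by
  obtain ⟨Y, hY, hmax⟩ := exists_max hA r
  have hZ : Good (mX := mX) μ S r (ZM (mX := mX) hA Y) :=
    ⟨ZM_le (mX := mX) hA, ZM_inv (mX := mX) hA, SZ_lift (mX := mX) hA hY.le hY.inv hr hY.sz⟩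
  have hle := hmax _ hZ (le_ZM (mX := mX) hA hY.le hY.inv)
  have hwm : WM (mX := mX) μ S Y := wm_of_cap (mX := mX) hA hY.le hY.inv fun F hF =>
    (CAP.meas (mX := mX) hA hF).mono hle le_rfl
  exact SZ_of_wm (mX := mX) hA hY.le hY.inv hwm hr hY.sz

end
end PSz
end Part11

section Part12
open MeasureTheory ProbabilityTheory Filter Topology
open scoped Polynomial

namespace PSz

set_option linter.unusedSectionVars false
set_option linter.unusedVariables false

/-- the Bernoulli shift -/
def Sh (n : ℤ) (x : ℤ → Bool) : ℤ → Bool := fun j => x (j + n)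

lemma Sh_zero (x : ℤ → Bool) : Sh 0 x = x := by ext j; simp [Sh]
lemma Sh_add (m n : ℤ) (x : ℤ → Bool) : Sh (m + n) x = Sh m (Sh n x) := by
  ext j; simp [Sh, add_assoc]
lemma Sh_cont (n : ℤ) : Continuous (Sh n) := continuous_pi fun j => continuous_apply (j + n)

/-- empirical measures -/
noncomputable def emp (N : ℕ) (x : ℤ → Bool) : ProbabilityMeasure (ℤ → Bool) :=
  ⟨Measure.map (fun n : Fin (N+1) => Sh ((n:ℕ):ℤ) x) (uniformOn Set.univ),
    Measure.isProbabilityMeasure_map (Measurable.of_discrete).aemeasurable⟩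

open Classical in
lemma emp_real (N : ℕ) (x : ℤ → Bool) {E : Set (ℤ → Bool)} (hE : MeasurableSet E) :
    ((emp N x : Measure (ℤ → Bool))).real E =
      (∑ n ∈ Finset.range (N+1), E.indicator (fun _ => (1:ℝ)) (Sh (n:ℤ) x)) / (N+1) := by
  have h1 : (emp N x : Measure (ℤ → Bool)) =
    Measure.map (fun n : Fin (N+1) => Sh ((n:ℕ):ℤ) x) (uniformOn Set.univ) := rfl
  rw [h1, Measure.real, Measure.map_apply Measurable.of_discrete hE, uniformOn_univ,
    ENNReal.toReal_div]
  congr 1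
  · rw [Finset.sum_range]
    rw [Measure.count_apply_finite _ (Set.toFinite _)]
    simp only [Set.indicator_apply, Finset.sum_boole]
    rw [ENNReal.toReal_natCast]
    congr 2
    ext n
    simp
  · rw [Fintype.card_fin, ENNReal.toReal_natCast]; push_cast; rfl

lemma cyl_clopen {E : Set (ℤ → Bool)} (hE : E ∈ measurableCylinders (fun _ : ℤ => Bool)) :
    IsClopen E := by
  rw [mem_measurableCylinders] at hE
  obtain ⟨s, T, hT, rfl⟩ := hE
  exact (isClopen_discrete T).preimage (continuous_pi fun j => continuous_apply _)

theorem corr_limit (x : ℕ → ℤ → Bool) : ∃ (μ : Measure (ℤ → Bool)) (U : Ultrafilter ℕ),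
    (U : Filter ℕ) ≤ atTop ∧ IsProbabilityMeasure μ ∧ Act μ Sh ∧ ∀ E, IsClopen E →
      Tendsto (fun N => ((emp N (x N) : Measure (ℤ → Bool))).real E) U (𝓝 (μ.real E)) := by
  set U : Ultrafilter ℕ := hyperfilter ℕ with hU
  have hUle : (U : Filter ℕ) ≤ atTop := by
    rw [hU, ← Nat.cofinite_eq_atTop]; exact hyperfilter_le_cofinite
  obtain ⟨P, -, hP⟩ := isCompact_univ (X := ProbabilityMeasure (ℤ → Bool)).ultrafilter_le_nhds
    (U.map fun N => emp N (x N)) (by simp)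
  have hP' : Tendsto (fun N => emp N (x N)) U (𝓝 P) := hP
  have hlim : ∀ E, IsClopen E →
      Tendsto (fun N => ((emp N (x N) : Measure (ℤ → Bool))).real E) U (𝓝 ((P : Measure (ℤ → Bool)).real E)) := by
    intro E hE
    have := ProbabilityMeasure.tendsto_measure_of_isClopen_of_tendsto hP' hE
    exact NNReal.tendsto_coe.2 this
  refine ⟨P, U, hUle, inferInstance, ⟨Sh_zero, Sh_add, fun m => ⟨(Sh_cont m).measurable, ?_⟩⟩, hlim⟩
  have : IsProbabilityMeasure (Measure.map (Sh m) (P : Measure (ℤ → Bool))) :=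
    Measure.isProbabilityMeasure_map (Sh_cont m).measurable.aemeasurable
  refine ext_of_generate_finite _ generateFrom_measurableCylinders.symm isPiSystem_measurableCylinders
    ?_ (by simp)
  intro E hE
  have hc := cyl_clopen hE
  have hm : MeasurableSet E := hc.isOpen.measurableSet
  rw [Measure.map_apply (Sh_cont m).measurable hm]
  have h1 := hlim _ (hc.preimage (Sh_cont m))
  have h2 := hlim _ hc
  have h3 : Tendsto (fun N => ((emp N (x N) : Measure (ℤ → Bool))).real (Sh m ⁻¹' E) -
      ((emp N (x N) : Measure (ℤ → Bool))).real E) U (𝓝 0) := by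
    have h4 : Tendsto (fun N : ℕ => (2 * |(m:ℝ)|) / ((N:ℝ)+1)) U (𝓝 0) := by
      have := (tendsto_const_div_atTop_nhds_zero_nat (2 * |(m:ℝ)|)).comp (tendsto_add_atTop_nat 1)
      refine (Tendsto.mono_left ?_ hUle)
      refine this.congr fun N => ?_
      simp
    refine squeeze_zero_norm (fun N => ?_) h4
    rw [emp_real _ _ hm, emp_real _ _ (hc.preimage (Sh_cont m)).isOpen.measurableSet, ← sub_div,
      Real.norm_eq_abs, abs_div, abs_of_nonneg (by positivity : (0:ℝ) ≤ (N:ℝ)+1)]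
    gcongr
    have := int_shift (fun n => E.indicator (fun _ => (1:ℝ)) (Sh n (x N))) (fun n => by
      by_cases h : Sh n (x N) ∈ E <;> simp [h]) m (N+1)
    refine le_of_eq_of_le ?_ this
    congr 2
    refine Finset.sum_congr rfl fun n _ => ?_
    rw [add_comm (n:ℤ) m, Sh_add]
    by_cases h : Sh m (Sh n (x N)) ∈ E
    · rw [Set.indicator_of_mem h, Set.indicator_of_mem (show Sh n (x N) ∈ Sh m ⁻¹' E from h)]
    · rw [Set.indicator_of_notMem h, Set.indicator_of_notMem (show Sh n (x N) ∉ Sh m ⁻¹' E from h)]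
  have h5 := tendsto_nhds_unique h3 (h1.sub h2)
  have h6 : (P : Measure (ℤ → Bool)).real (Sh m ⁻¹' E) = (P : Measure (ℤ → Bool)).real E := by linarith
  exact (ENNReal.toReal_eq_toReal_iff' (measure_ne_top _ _) (measure_ne_top _ _)).1 h6

/-- finite polynomial Szemerédi theorem for power differences -/
theorem fin_sz (k r : ℕ) (hr : 1 ≤ r) (ε : ℝ) (hε : 0 < ε) : ∃ N : ℕ, 1 ≤ N ∧
    ∀ B : Finset ℕ, B ⊆ Finset.range N → ε * N ≤ B.card →
      ∃ a d : ℕ, 1 ≤ d ∧ ∀ i ≤ k, a + i * d ^ r ∈ B := by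
  classical
  by_contra hcon
  push Not at hcon
  choose B hBs hBc hB using fun N : ℕ => hcon (N+1) (by omega)
  set x : ℕ → ℤ → Bool := fun N j => decide (0 ≤ j ∧ j.toNat ∈ B N) with hx
  obtain ⟨μ, U, hU, hμ, hA, hlim⟩ := corr_limit x
  set A : Set (ℤ → Bool) := {y | y 0 = true} with hAdef
  have hAc : IsClopen A := (isClopen_discrete {true}).preimage (continuous_apply 0)
  have hxn : ∀ (N n : ℕ), Sh (n:ℤ) (x N) ∈ A ↔ n ∈ B N := by
    intro N n; simp [hAdef, Sh, hx]
  have hApos : ε ≤ μ.real A := by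
    refine ge_of_tendsto (hlim A hAc) (Eventually.of_forall fun N => ?_)
    rw [emp_real _ _ hAc.isOpen.measurableSet, le_div_iff₀ (by positivity)]
    have h1 := hBc N
    push_cast at h1
    refine h1.trans (le_of_eq ?_)
    simp only [Set.indicator_apply, hxn, Finset.sum_boole]
    congr 2
    ext n
    simp only [Finset.mem_filter]
    exact ⟨fun h => ⟨hBs N h, h⟩, fun h => h.2⟩
  have hsz := ergodic_sz hA hr A hAc.isOpen.measurableSet (hε.trans_le hApos) k
  apply hsz
  refine AvZ.finite avz_zero {0} fun d hd => ?_
  have hd1 : 1 ≤ d := by simp at hd; omega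
  have hR : IsClopen (RS Sh r k A d) := by
    rw [RS_eq]
    exact isClopen_biInter_finset fun i _ => hAc.preimage (Sh_cont _)
  refine tendsto_nhds_unique (hlim _ hR) (tendsto_const_nhds.congr fun N => ?_)
  rw [emp_real _ _ hR.isOpen.measurableSet]
  symm
  rw [div_eq_zero_iff]; left
  refine Finset.sum_eq_zero fun n hn => Set.indicator_of_notMem (fun hmem => ?_) _
  obtain ⟨i, hi, hni⟩ := hB N n d hd1
  apply hni
  have := hmem i hi
  rw [← Sh_add, show ((i:ℤ) * (d:ℤ)^r + n) = ((n + i * d^r : ℕ) : ℤ) by push_cast; ring, hxn] at this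
  exact this

end PSz
end Part12

section Part13
open MeasureTheory ProbabilityTheory Filter Topology
open scoped Polynomial

namespace PSz

/-- configurations `(a,d)` inside `A` -/
noncomputable def cfg (k r n D : ℕ) (A : Finset ℕ) : Finset (ℕ × ℕ) := by
  classical
  exact (Finset.Icc 1 n ×ˢ Finset.Icc 1 D).filter (fun p => ∀ i ≤ k, p.1 + i * p.2 ^ r ∈ A)

lemma mem_cfg {k r n D : ℕ} {A : Finset ℕ} {p : ℕ × ℕ} : p ∈ cfg k r n D A ↔
    (1 ≤ p.1 ∧ p.1 ≤ n) ∧ (1 ≤ p.2 ∧ p.2 ≤ D) ∧ ∀ i ≤ k, p.1 + i * p.2 ^ r ∈ A := by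
  classical
  simp [cfg, and_assoc]

open Classical in
/-- starting points of progressions of step `s`, length `N`, dense in `A` -/
lemma good_starts {ε : ℝ} (hε : 0 < ε) {n N s : ℕ} (hN : 1 ≤ N) {A : Finset ℕ} (hA : A ⊆ Finset.Icc 1 n)
    (hc : ε * n ≤ A.card) (hs : (N:ℝ) * s ≤ ε / 4 * n) :
    ε / 4 * n ≤ (((Finset.Icc 1 n).filter (fun a => ε / 2 * N ≤
      (((Finset.range N).filter (fun j => a + j * s ∈ A)).card : ℝ))).card : ℝ) := by
  set P : ℕ → ℕ := fun a => ((Finset.range N).filter (fun j => a + j * s ∈ A)).card with hP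
  set Gd := (Finset.Icc 1 n).filter (fun a => ε / 2 * N ≤ (P a : ℝ)) with hG
  have h1 : (∑ a ∈ Finset.Icc 1 n, P a) = ∑ j ∈ Finset.range N,
      ((Finset.Icc 1 n).filter (fun a => a + j * s ∈ A)).card := by
    simp only [hP, Finset.card_filter]
    rw [Finset.sum_comm]
  have h2 : ∀ j ∈ Finset.range N, A.card ≤
      ((Finset.Icc 1 n).filter (fun a => a + j * s ∈ A)).card + N * s := by
    intro j hj
    have hjN : j * s ≤ N * s := Nat.mul_le_mul_right _ (Finset.mem_range.1 hj).le
    have : A ⊆ (((Finset.Icc 1 n).filter (fun a => a + j * s ∈ A)).image (fun a => a + j * s)) ∪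
        Finset.Icc 1 (N * s) := by
      intro x hx
      have hxn := Finset.mem_Icc.1 (hA hx)
      rw [Finset.mem_union]
      by_cases h : x ≤ N * s
      · right; exact Finset.mem_Icc.2 ⟨hxn.1, h⟩
      · left
        rw [Finset.mem_image]
        refine ⟨x - j * s, ?_, by omega⟩
        rw [Finset.mem_filter, Finset.mem_Icc, Nat.sub_add_cancel (by omega)]
        exact ⟨⟨by omega, by omega⟩, hx⟩
    refine (Finset.card_le_card this).trans ((Finset.card_union_le _ _).trans ?_)
    refine add_le_add Finset.card_image_le ?_
    simp
  have h3 : N * A.card ≤ (∑ a ∈ Finset.Icc 1 n, P a) + N * (N * s) := by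
    rw [h1]
    calc N * A.card = ∑ j ∈ Finset.range N, A.card := by simp
      _ ≤ ∑ j ∈ Finset.range N, (((Finset.Icc 1 n).filter (fun a => a + j * s ∈ A)).card + N * s) :=
          Finset.sum_le_sum h2
      _ = _ := by rw [Finset.sum_add_distrib]; simp
  have h4 : (∑ a ∈ Finset.Icc 1 n, (P a : ℝ)) ≤ N * Gd.card + ε / 2 * N * n := by
    calc (∑ a ∈ Finset.Icc 1 n, (P a : ℝ)) ≤
        ∑ a ∈ Finset.Icc 1 n, ((if ε / 2 * N ≤ (P a : ℝ) then (N:ℝ) else 0) + ε / 2 * N) := by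
          refine Finset.sum_le_sum fun a _ => ?_
          split_ifs with h
          · have : (P a : ℝ) ≤ N := by
              have := Finset.card_filter_le (Finset.range N) (fun j => a + j * s ∈ A)
              rw [Finset.card_range] at this
              exact_mod_cast this
            have : 0 ≤ ε / 2 * N := by positivity
            linarith
          · linarith
      _ = _ := by
          rw [Finset.sum_add_distrib, ← Finset.sum_filter]
          simp only [Finset.sum_const, nsmul_eq_mul, Nat.card_Icc, Nat.add_sub_cancel]
          rw [← hG]; ring
  have h3' : (N:ℝ) * A.card ≤ (∑ a ∈ Finset.Icc 1 n, (P a : ℝ)) + N * (N * s) := by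
    exact_mod_cast h3
  have hN' : (0:ℝ) < N := by exact_mod_cast hN
  have h5 : (N:ℝ) * (ε * n) ≤ N * (Gd.card + ε / 2 * n + ε / 4 * n) := by
    have := mul_le_mul_of_nonneg_left hc hN'.le
    have := mul_le_mul_of_nonneg_left hs hN'.le
    nlinarith
  have := le_of_mul_le_mul_left h5 hN'
  linarith

open Classical in
theorem varn (k r : ℕ) (hk : 1 ≤ k) (hr : 1 ≤ r) (ε : ℝ) (hε : 0 < ε) :
    ∃ c : ℝ, 0 < c ∧ ∃ D0 : ℕ, ∀ n D : ℕ, D ^ r ≤ n → D0 ≤ D → ∀ A ⊆ Finset.Icc 1 n,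
      ε * n ≤ A.card → c * n * D ≤ ((cfg k r n D A).card : ℝ) := by
  obtain ⟨N, hN, hsz⟩ := fin_sz k r hr (ε/2) (by positivity)
  obtain ⟨L, hL⟩ := exists_nat_gt ((N:ℝ) + N / (ε / 4))
  have hN' : (0:ℝ) < N := by exact_mod_cast hN
  have hLN : (N:ℝ) ≤ L := by
    have : 0 ≤ N / (ε/4) := by positivity
    linarith
  have hLN' : N ≤ L := by exact_mod_cast hLN
  have hL0 : (0:ℝ) < L := hN'.trans_le hLN
  have hLe : (N:ℝ) ≤ ε / 4 * L := by
    have : N / (ε/4) ≤ L := by linarith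
    rw [div_le_iff₀ (by positivity)] at this
    linarith
  refine ⟨ε / 4 / (2 * L) / (N * (N + 1)), by positivity, L, ?_⟩
  intro n D hDn hDL A hA hAc
  set T := D / L with hT
  have hLpos : 0 < L := by omega
  have hT2 : (D:ℝ) ≤ 2 * L * T := by
    have h1 : D < L * T + L := by
      have e1 := Nat.div_add_mod D L
      rw [← hT] at e1
      have := Nat.mod_lt D hLpos
      omega
    have h2 : 1 ≤ T := (Nat.one_le_div_iff hLpos).2 hDL
    have h3 : L * 1 ≤ L * T := Nat.mul_le_mul_left _ h2
    have : D ≤ 2 * L * T := by nlinarith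
    exact_mod_cast this
  have hTL : L * T ≤ D := Nat.mul_div_le D L
  have hsmall : ∀ t ∈ Finset.Icc 1 T, (N:ℝ) * (t ^ r : ℕ) ≤ ε / 4 * n := by
    intro t ht
    have ht := Finset.mem_Icc.1 ht
    have h1 : L * t ^ r ≤ n := by
      calc L * t ^ r ≤ L ^ r * t ^ r := Nat.mul_le_mul_right _ (Nat.le_self_pow (by omega) L)
        _ = (L * t) ^ r := (mul_pow _ _ _).symm
        _ ≤ D ^ r := Nat.pow_le_pow_left ((Nat.mul_le_mul_left _ ht.2).trans hTL) _
        _ ≤ n := hDn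
    have h1' : (L:ℝ) * (t ^ r : ℕ) ≤ n := by exact_mod_cast h1
    calc (N:ℝ) * (t ^ r : ℕ) ≤ ε / 4 * L * (t ^ r : ℕ) := by gcongr
      _ = ε / 4 * (L * (t^r : ℕ)) := by ring
      _ ≤ _ := by gcongr
  set Gt : ℕ → Finset ℕ := fun t => (Finset.Icc 1 n).filter (fun a => ε / 2 * N ≤
      (((Finset.range N).filter (fun j => a + j * t ^ r ∈ A)).card : ℝ)) with hGt
  have hgood : ∀ t ∈ Finset.Icc 1 T, ε / 4 * n ≤ ((Gt t).card : ℝ) := fun t ht =>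
    good_starts hε hN hA hAc (hsmall t ht)
  set Q : Finset (Σ _ : ℕ, ℕ) := (Finset.Icc 1 T).sigma Gt with hQ
  have hQc : ε / 4 * n * T ≤ (Q.card : ℝ) := by
    rw [hQ, Finset.card_sigma]
    push_cast
    calc ε / 4 * n * T = ∑ t ∈ Finset.Icc 1 T, ε / 4 * n := by simp; ring
      _ ≤ _ := Finset.sum_le_sum hgood
  -- choose configurations
  have hch : ∀ p ∈ Q, ∃ jd : ℕ × ℕ, jd.1 < N ∧ 1 ≤ jd.2 ∧ jd.2 ≤ N ∧
      ∀ i ≤ k, p.2 + (jd.1 + i * jd.2 ^ r) * p.1 ^ r ∈ A := by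
    intro p hp
    rw [hQ, Finset.mem_sigma, hGt, Finset.mem_filter] at hp
    obtain ⟨a, d, hd, h⟩ := hsz _ (Finset.filter_subset _ _) hp.2.2
    have h0 := h 0 (by omega)
    have h1 := h 1 hk
    simp only [Finset.mem_filter, Finset.mem_range, zero_mul, add_zero, one_mul] at h0 h1
    refine ⟨(a, d), h0.1, hd, ?_, fun i hi => (Finset.mem_filter.1 (h i hi)).2⟩
    have : d ≤ d ^ r := Nat.le_self_pow (by omega) d
    simp only
    omega
  choose! f hf1 hf2 hf3 hf4 using hch
  have hcard : Q.card ≤ ((cfg k r n D A) ×ˢ (Finset.range N ×ˢ Finset.range (N+1))).card := by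
    refine Finset.card_le_card_of_injOn
      (fun p => ((p.2 + (f p).1 * p.1 ^ r, (f p).2 * p.1), f p)) ?_ ?_
    · intro p hp
      have hp : p ∈ Q := hp
      have e4 := hf4 p hp
      have e3 := hf3 p hp
      have e2 := hf2 p hp
      have e1 := hf1 p hp
      have hp' := hp
      rw [hQ, Finset.mem_sigma, Finset.mem_Icc] at hp'
      have h0 := e4 0 (by omega)
      rw [zero_mul, add_zero] at h0
      have h0' := Finset.mem_Icc.1 (hA h0)
      have hm : ((f p).1, (f p).2) = f p := rfl
      simp only [Finset.mem_coe, Finset.mem_product, mem_cfg, Finset.mem_range]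
      refine ⟨⟨h0', ⟨Nat.mul_pos e2 hp'.1.1, ?_⟩, fun i hi => ?_⟩, e1, by omega⟩
      · exact (Nat.mul_le_mul (e3.trans hLN') hp'.1.2).trans hTL
      · have := e4 i hi
        rw [mul_pow]
        convert this using 1
        ring
    · intro p hp q hq hpq
      simp only [Prod.mk.injEq] at hpq
      obtain ⟨⟨h1, h2⟩, h3⟩ := hpq
      have e2 := hf2 p hp
      rw [← h3] at h1 h2
      have h4 : p.1 = q.1 := Nat.eq_of_mul_eq_mul_left e2 h2
      rw [h4] at h1
      have h5 : p.2 = q.2 := by omega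
      cases p; cases q; simp_all
  rw [Finset.card_product, Finset.card_product, Finset.card_range, Finset.card_range] at hcard
  have hcard' : (Q.card : ℝ) ≤ (cfg k r n D A).card * (N * (N + 1)) := by exact_mod_cast hcard
  rw [div_mul_eq_mul_div, div_mul_eq_mul_div, div_le_iff₀ (by positivity)]
  refine le_trans ?_ hcard'
  refine le_trans ?_ hQc
  rw [div_mul_eq_mul_div, div_mul_eq_mul_div, div_le_iff₀ (by positivity)]
  calc ε / 4 * n * D ≤ ε / 4 * n * (2 * L * T) := by gcongr
    _ = _ := by ring

end PSz
end Part13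

section Part14
namespace PSz

/-- container predicate -/
def HasCont (P : Finset ℕ → Prop) (s b : ℕ) : Prop :=
  ∃ cont : Finset ℕ → Finset ℕ, ∀ I, P I → ∃ S ⊆ I, S.card ≤ s ∧
    ∀ T, S ⊆ T → T ⊆ I → I ⊆ cont T ∧ (cont T).card ≤ b

lemma HasCont.mono {P Q : Finset ℕ → Prop} {s t b : ℕ} (h : HasCont P s b)
    (hQ : ∀ I, Q I → P I) (hst : s ≤ t) : HasCont Q t b := by
  obtain ⟨c, hc⟩ := h
  refine ⟨c, fun I hI => ?_⟩
  obtain ⟨S, h1, h2, h3⟩ := hc I (hQ I hI)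
  exact ⟨S, h1, h2.trans hst, h3⟩

lemma HasCont.leaf {P : Finset ℕ → Prop} {s b : ℕ} (X : Finset ℕ) (hX : X.card ≤ b)
    (h : ∀ I, P I → I ⊆ X) : HasCont P s b :=
  ⟨fun _ => X, fun I hI => ⟨∅, by simp, by simp, fun _ _ _ => ⟨h I hI, hX⟩⟩⟩

lemma HasCont.branch {P : Finset ℕ → Prop} {s b : ℕ} (v : ℕ)
    (h1 : HasCont (fun I => P I ∧ v ∈ I) s b) (h0 : HasCont (fun I => P I ∧ v ∉ I) (s+1) b) :
    HasCont P (s+1) b := by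
  classical
  obtain ⟨c1, hc1⟩ := h1
  obtain ⟨c0, hc0⟩ := h0
  refine ⟨fun T => if v ∈ T then c1 T else c0 T, fun I hI => ?_⟩
  by_cases hv : v ∈ I
  · obtain ⟨S, e1, e2, e3⟩ := hc1 I ⟨hI, hv⟩
    refine ⟨insert v S, Finset.insert_subset hv e1, (Finset.card_insert_le _ _).trans (by omega), ?_⟩
    intro T hST hTI
    beta_reduce
    rw [if_pos (hST (Finset.mem_insert_self _ _))]
    exact e3 T ((Finset.subset_insert _ _).trans hST) hTI
  · obtain ⟨S, e1, e2, e3⟩ := hc0 I ⟨hI, hv⟩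
    refine ⟨S, e1, e2, ?_⟩
    intro T hST hTI
    beta_reduce
    rw [if_neg (fun h => hv (hTI h))]
    exact e3 T hST hTI

/-- degree of a vertex -/
def dg {ι : Type} (E : Finset ι) (φ : ι → Finset ℕ) (v : ℕ) : ℕ := (E.filter (fun e => v ∈ φ e)).card

/-- codegree condition -/
def Codeg {ι : Type} (E : Finset ι) (φ : ι → Finset ℕ) (B : ℕ) : Prop :=
  ∀ u v, u ≠ v → (E.filter (fun e => u ∈ φ e ∧ v ∈ φ e)).card ≤ B

lemma sum_dg {ι : Type} (E : Finset ι) (φ : ι → Finset ℕ) (V : Finset ℕ) (hV : ∀ e ∈ E, φ e ⊆ V) (j : ℕ)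
    (hj : ∀ e ∈ E, (φ e).card = j) : ∑ v ∈ V, dg E φ v = j * E.card := by
  simp only [dg, Finset.card_filter]
  rw [Finset.sum_comm]
  have : ∀ e ∈ E, (∑ v ∈ V, if v ∈ φ e then 1 else 0) = j := by
    intro e he
    rw [← Finset.card_filter, ← hj e he]
    congr 1
    ext v
    simp only [Finset.mem_filter]
    exact ⟨fun h => h.2, fun h => ⟨hV e he h, h⟩⟩
  rw [Finset.sum_congr rfl this]
  simp [mul_comm]

lemma exists_big {ι : Type} (F : Finset ι) (φ : ι → Finset ℕ) (X0 : Finset ℕ)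
    (hV : ∀ e ∈ F, φ e ⊆ X0) (j : ℕ) (hj : ∀ e ∈ F, (φ e).card = j + 1) (n : ℕ) (hX : X0.card ≤ n)
    (hn : 0 < n) (θ : ℝ) (hθ : 0 < θ) (hF : θ * n ≤ F.card) : ∃ v ∈ X0, θ ≤ dg F φ v := by
  have hsum := sum_dg F φ X0 hV (j+1) hj
  have hn' : (0:ℝ) < n := by exact_mod_cast hn
  have hFpos : (0:ℝ) < F.card := lt_of_lt_of_le (by positivity) hF
  have hFpos' : 0 < F.card := by exact_mod_cast hFpos
  have hne : X0.Nonempty := by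
    obtain ⟨e, he⟩ := Finset.card_pos.1 hFpos'
    have : 0 < (φ e).card := by rw [hj e he]; omega
    obtain ⟨v, hv⟩ := Finset.card_pos.1 this
    exact ⟨v, hV e he hv⟩
  refine Finset.exists_le_of_sum_le hne ?_
  have h1 : (∑ v ∈ X0, (dg F φ v : ℝ)) = ((j+1) * F.card : ℕ) := by rw [← hsum]; push_cast; rfl
  rw [h1, Finset.sum_const, nsmul_eq_mul]
  have h2 : (X0.card : ℝ) ≤ n := by exact_mod_cast hX
  have h3 : (F.card : ℝ) ≤ ((j+1) * F.card : ℕ) := by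
    exact_mod_cast Nat.le_mul_of_pos_left _ (by omega)
  nlinarith

lemma remove_le {ι : Type} [DecidableEq ι] (E : Finset ι) (φ : ι → Finset ℕ) (R : Finset ℕ) (dE : ℝ)
    (hd : ∀ v, (dg E φ v : ℝ) ≤ dE) :
    (E.card : ℝ) ≤ (E.filter (fun e => Disjoint (φ e) R)).card + R.card * dE := by
  have h1 : E ⊆ E.filter (fun e => Disjoint (φ e) R) ∪ R.biUnion (fun v => E.filter (fun e => v ∈ φ e)) := by
    intro e he
    rw [Finset.mem_union]
    by_cases h : Disjoint (φ e) R
    · left; simp [he, h]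
    · right
      rw [Finset.not_disjoint_iff] at h
      obtain ⟨a, h1, h2⟩ := h
      rw [Finset.mem_biUnion]
      exact ⟨a, h2, by simp [he, h1]⟩
  have h2 := (Finset.card_le_card h1).trans ((Finset.card_union_le _ _).trans
    (Nat.add_le_add_left Finset.card_biUnion_le _))
  have h3 : (E.card : ℝ) ≤ (E.filter (fun e => Disjoint (φ e) R)).card +
      ∑ v ∈ R, (dg E φ v : ℝ) := by
    have : E.card ≤ (E.filter (fun e => Disjoint (φ e) R)).card + ∑ v ∈ R, dg E φ v := h2
    exact_mod_cast this
  refine h3.trans (add_le_add le_rfl ?_)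
  calc ∑ v ∈ R, (dg E φ v : ℝ) ≤ ∑ v ∈ R, dE := Finset.sum_le_sum fun v _ => hd v
    _ = _ := by simp

lemma sat_le {ι : Type} (G : Finset ι) (ψ : ι → Finset ℕ) (X0 : Finset ℕ)
    (hV : ∀ e ∈ G, ψ e ⊆ X0) (j : ℕ) (hj : ∀ e ∈ G, (ψ e).card = j) (dd : ℝ) (hdd : 0 < dd)
    (sat : Finset ℕ) (hsat : sat ⊆ X0) (h : ∀ v ∈ sat, dd ≤ dg G ψ v) :
    (sat.card : ℝ) ≤ j * G.card / dd := by
  have hsum := sum_dg G ψ X0 hV j hj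
  rw [le_div_iff₀ hdd]
  calc (sat.card : ℝ) * dd = ∑ v ∈ sat, dd := by simp
    _ ≤ ∑ v ∈ sat, (dg G ψ v : ℝ) := Finset.sum_le_sum h
    _ ≤ ∑ v ∈ X0, (dg G ψ v : ℝ) := Finset.sum_le_sum_of_subset_of_nonneg hsat (by intros; positivity)
    _ = _ := by exact_mod_cast hsum

lemma dg_update {ι : Type} [DecidableEq ι] (E F G : Finset ι) (φ ψ : ι → Finset ℕ) (v : ℕ) (B : ℕ)
    (dd : ℝ) (hFE : F ⊆ E) (hco : Codeg E φ B) (_hdj : ∀ e ∈ G, e ∉ F)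
    (hdeg : ∀ u, (dg G ψ u : ℝ) ≤ dd + B)
    (hs : ∀ e ∈ F, ∀ u ∈ φ e, (dg G ψ u : ℝ) < dd) (u : ℕ) :
    (dg (G ∪ F.filter (fun e => v ∈ φ e))
      (fun e => if e ∈ F.filter (fun e => v ∈ φ e) then (φ e).erase v else ψ e) u : ℝ) ≤ dd + B := by
  set N := F.filter (fun e => v ∈ φ e) with hN
  have h1 : dg (G ∪ N) (fun e => if e ∈ N then (φ e).erase v else ψ e) u ≤
      dg G ψ u + (N.filter (fun e => u ∈ (φ e).erase v)).card := by
    unfold dg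
    refine (Finset.card_le_card ?_).trans (Finset.card_union_le _ _)
    intro e he
    simp only [Finset.mem_filter, Finset.mem_union] at he ⊢
    by_cases h : e ∈ N
    · rw [if_pos h] at he
      exact Or.inr ⟨h, he.2⟩
    · rw [if_neg h] at he
      exact Or.inl ⟨he.1.resolve_right h, he.2⟩
  have h1' : (dg (G ∪ N) (fun e => if e ∈ N then (φ e).erase v else ψ e) u : ℝ) ≤
      dg G ψ u + ((N.filter (fun e => u ∈ (φ e).erase v)).card : ℝ) := by exact_mod_cast h1
  rcases Finset.eq_empty_or_nonempty (N.filter (fun e => u ∈ (φ e).erase v)) with h | ⟨e, he⟩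
  · rw [h] at h1'
    simp only [Finset.card_empty, Nat.cast_zero, add_zero] at h1'
    exact h1'.trans (hdeg u)
  · rw [Finset.mem_filter, hN, Finset.mem_filter, Finset.mem_erase] at he
    have h2 := hs e he.1.1 u he.2.2
    have h3 : (N.filter (fun e => u ∈ (φ e).erase v)).card ≤ B := by
      refine (Finset.card_le_card ?_).trans (hco u v he.2.1)
      intro e' he'
      rw [Finset.mem_filter, hN, Finset.mem_filter, Finset.mem_erase] at he'
      rw [Finset.mem_filter]
      exact ⟨hFE he'.1.1, he'.2.2, he'.1.2⟩
    have h3' : ((N.filter (fun e => u ∈ (φ e).erase v)).card : ℝ) ≤ B := by exact_mod_cast h3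
    linarith

open Classical in
theorem cont_loop {ι : Type} (P0 : Finset ℕ → Prop) (X0 : Finset ℕ) (n : ℕ) (hn : 0 < n)
    (hX : X0.card ≤ n) (E : Finset ι) (φ : ι → Finset ℕ) (j : ℕ) (B M s b : ℕ)
    (dE θ δ dd γ : ℝ) (hθ : 0 < θ) (hdd : 0 < dd) (hdE0 : 0 ≤ dE)
    (hV : ∀ e ∈ E, φ e ⊆ X0) (hcard : ∀ e ∈ E, (φ e).card = j + 1) (hco : Codeg E φ B)
    (hdE : ∀ v, (dg E φ v : ℝ) ≤ dE) (hE : θ * n ≤ E.card)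
    (hM : γ * n ≤ θ / 2 * M)
    (hR : (δ * n + M + j * (γ * n) / dd) * dE ≤ θ / 2 * n)
    (hnext : ∀ Y ⊆ X0, ∀ (G : Finset ι) (ψ : ι → Finset ℕ), (∀ e ∈ G, ψ e ⊆ X0) →
      (∀ e ∈ G, (ψ e).card = j) → (∀ u, (dg G ψ u : ℝ) ≤ dd + B) → Codeg G ψ B →
      γ * n ≤ G.card → HasCont (fun I => P0 I ∧ I ⊆ Y ∧ ∀ e ∈ G, ¬ ψ e ⊆ I) s b)
    (hcont : ∀ Y ⊆ X0, δ * n ≤ ((X0 \ Y).card : ℝ) → HasCont (fun I => P0 I ∧ I ⊆ Y) s b) :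
    ∀ (m : ℕ) (Y W : Finset ℕ) (G : Finset ι) (ψ : ι → Finset ℕ), (Y \ W).card < m → Y ⊆ X0 →
      (∀ e ∈ G, e ∈ E ∧ ∃ w ∈ W, w ∈ φ e ∧ ψ e = (φ e).erase w) →
      (∀ u, (dg G ψ u : ℝ) ≤ dd + B) → (W.card : ℝ) * (θ / 2) ≤ G.card →
      HasCont (fun I => P0 I ∧ I ⊆ Y ∧ W ⊆ I ∧ ∀ e ∈ E, ¬ φ e ⊆ I) (s + (M - W.card)) b := by
  intro m
  induction m with
  | zero => intro Y W G ψ h; omega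
  | succ m ih =>
    intro Y W G ψ hm hY hG hdeg hGc
    have hψφ : ∀ e ∈ G, ψ e ⊆ φ e := by
      intro e he
      obtain ⟨-, w, -, -, h⟩ := hG e he
      rw [h]; exact Finset.erase_subset _ _
    have hψX : ∀ e ∈ G, ψ e ⊆ X0 := fun e he => (hψφ e he).trans (hV e (hG e he).1)
    have hψc : ∀ e ∈ G, (ψ e).card = j := by
      intro e he
      obtain ⟨h0, w, -, h1, h⟩ := hG e he
      rw [h, Finset.card_erase_of_mem h1, hcard e h0]; omega
    by_cases hA : δ * n ≤ ((X0 \ Y).card : ℝ)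
    · exact (hcont Y hY hA).mono (fun I hI => ⟨hI.1, hI.2.1⟩) (by omega)
    by_cases hBc : γ * n ≤ G.card
    · refine (hnext Y hY G ψ hψX hψc hdeg ?_ hBc).mono (fun I hI => ⟨hI.1, hI.2.1, ?_⟩) (by omega)
      · intro u v huv
        refine (Finset.card_le_card ?_).trans (hco u v huv)
        intro e he
        rw [Finset.mem_filter] at he ⊢
        exact ⟨(hG e he.1).1, hψφ e he.1 he.2.1, hψφ e he.1 he.2.2⟩
      · intro e he hsub
        obtain ⟨h0, w, hw, h1, h⟩ := hG e he
        refine hI.2.2.2 e h0 ?_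
        rw [← Finset.insert_erase h1, ← h]
        exact Finset.insert_subset (hI.2.2.1 hw) hsub
    push Not at hA hBc
    have hWM : W.card < M := by
      have : (W.card : ℝ) * (θ/2) < M * (θ / 2) := by linarith
      have := lt_of_mul_lt_mul_right this (by positivity)
      exact_mod_cast this
    set sat := X0.filter (fun u => dd ≤ (dg G ψ u : ℝ)) with hsat
    set R := (X0 \ Y) ∪ W ∪ sat with hRdef
    set F := E.filter (fun e => Disjoint (φ e) R) with hF
    have hsc : (sat.card : ℝ) ≤ j * (γ * n) / dd := by
      refine (sat_le G ψ X0 hψX j hψc dd hdd sat (Finset.filter_subset _ _)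
        (fun v hv => (Finset.mem_filter.1 hv).2)).trans ?_
      gcongr
    have hRc : (R.card : ℝ) ≤ δ * n + M + j * (γ * n) / dd := by
      have h1 : R.card ≤ (X0 \ Y).card + W.card + sat.card :=
        (Finset.card_union_le _ _).trans (Nat.add_le_add_right (Finset.card_union_le _ _) _)
      have h1' : (R.card : ℝ) ≤ (X0 \ Y).card + W.card + sat.card := by exact_mod_cast h1
      have : (W.card : ℝ) ≤ M := by exact_mod_cast hWM.le
      linarith
    have hFc : θ / 2 * n ≤ F.card := by
      have h1 := remove_le E φ R dE hdE
      have h2 : R.card * dE ≤ θ / 2 * n := (mul_le_mul_of_nonneg_right hRc hdE0).trans hR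
      have : (E.card : ℝ) ≤ F.card + R.card * dE := h1
      linarith
    have hFE : F ⊆ E := Finset.filter_subset _ _
    obtain ⟨v, hvX, hv⟩ := exists_big F φ X0 (fun e he => hV e (hFE he)) j
      (fun e he => hcard e (hFE he)) n hX hn (θ/2) (by positivity) hFc
    have hnotR : ∀ e ∈ F, ∀ u ∈ φ e, u ∉ R := fun e he u hu =>
      Finset.disjoint_left.1 (Finset.mem_filter.1 he).2 hu
    have hvR : v ∉ R := by
      have : (0:ℝ) < dg F φ v := lt_of_lt_of_le (by positivity) hv
      have : 0 < dg F φ v := by exact_mod_cast this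
      obtain ⟨e, he⟩ := Finset.card_pos.1 this
      rw [Finset.mem_filter] at he
      exact hnotR e he.1 v he.2
    have hvR' := hvR
    simp only [hRdef, Finset.mem_union, Finset.mem_sdiff, not_or, not_and, not_not] at hvR'
    have hvY : v ∈ Y := hvR'.1.1 hvX
    have hvW : v ∉ W := hvR'.1.2
    have hYW : v ∈ Y \ W := Finset.mem_sdiff.2 ⟨hvY, hvW⟩
    have hdec : ((Y \ W).erase v).card < m := by
      rw [Finset.card_erase_of_mem hYW]
      have := Finset.card_pos.2 ⟨v, hYW⟩
      omega
    obtain ⟨t, ht⟩ : ∃ t, M - W.card = t + 1 := ⟨M - W.card - 1, by omega⟩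
    rw [ht, ← add_assoc]
    refine HasCont.branch v ?_ ?_
    · -- `v ∈ I`
      set N := F.filter (fun e => v ∈ φ e) with hN
      have hGF : ∀ e ∈ G, e ∉ F := by
        intro e he hF'
        obtain ⟨-, w, hw, h1, -⟩ := hG e he
        refine hnotR e hF' w h1 ?_
        simp [hRdef, hw]
      have hGN : Disjoint G N := by
        rw [Finset.disjoint_left]
        intro e he hn'
        exact hGF e he (Finset.filter_subset _ _ hn')
      have := ih Y (insert v W) (G ∪ N) (fun e => if e ∈ N then (φ e).erase v else ψ e)
        (by
          refine lt_of_le_of_lt (Finset.card_le_card ?_) hdec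
          intro x hx
          simp only [Finset.mem_sdiff, Finset.mem_insert, not_or, Finset.mem_erase] at hx ⊢
          tauto) hY
        (by
          intro e he
          by_cases h : e ∈ N
          · rw [if_pos h]
            have h' := Finset.mem_filter.1 h
            exact ⟨hFE h'.1, v, Finset.mem_insert_self _ _, h'.2, rfl⟩
          · rw [if_neg h]
            obtain ⟨h0, w, hw, h1, h2⟩ := hG e ((Finset.mem_union.1 he).resolve_right h)
            exact ⟨h0, w, Finset.mem_insert_of_mem hw, h1, h2⟩)
        (by
          refine dg_update E F G φ ψ v B dd hFE hco hGF hdeg ?_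
          intro e he u hu
          by_contra hcon
          push Not at hcon
          refine hnotR e he u hu ?_
          rw [hRdef, Finset.mem_union]; right
          exact Finset.mem_filter.2 ⟨hV e (hFE he) hu, hcon⟩)
        (by
          rw [Finset.card_insert_of_notMem hvW, Finset.card_union_of_disjoint hGN]
          push_cast
          have : θ / 2 ≤ (N.card : ℝ) := hv
          linarith)
      refine this.mono (fun I hI => ⟨hI.1.1, hI.1.2.1, ?_, hI.1.2.2.2⟩) ?_
      · exact Finset.insert_subset hI.2 hI.1.2.2.1
      · rw [Finset.card_insert_of_notMem hvW]; omega
    · -- `v ∉ I`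
      have := ih (Y.erase v) W G ψ
        (by rw [Finset.erase_sdiff_comm]; exact hdec)
        ((Finset.erase_subset _ _).trans hY) hG hdeg hGc
      refine this.mono (fun I hI => ⟨hI.1.1, ?_, hI.1.2.2.1, hI.1.2.2.2⟩) (by omega)
      exact Finset.subset_erase.2 ⟨hI.1.2.1, hI.2⟩

end PSz
end Part14

section Part15
namespace PSz

open Classical in
theorem cont_stage {ι : Type} (P0 : Finset ℕ → Prop) (X0 : Finset ℕ) (n k : ℕ) (hn : 0 < n)
    (hk : 1 ≤ k) (hX : X0.card ≤ n) (B M s b : ℕ) (L α δ C κ : ℝ) (hL : 1 ≤ L) (hα : 0 < α)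
    (_hδ : 0 < δ) (hC : C = B + 1) (hκ : κ = 8 * k * C) (hδα : C * δ ≤ α / 8)
    (hM1 : (M:ℝ) ≤ δ * n) (hM2 : (n:ℝ) ≤ L * M)
    (hcont : ∀ Y ⊆ X0, δ * n ≤ ((X0 \ Y).card : ℝ) → HasCont (fun I => P0 I ∧ I ⊆ Y) s b) :
    ∀ j ≤ k, ∀ Y ⊆ X0, ∀ (E : Finset ι) (φ : ι → Finset ℕ), (∀ e ∈ E, φ e ⊆ X0) →
      (∀ e ∈ E, (φ e).card = j + 1) → (∀ u, (dg E φ u : ℝ) ≤ C * L ^ j) → Codeg E φ B →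
      α * κ ^ j * L ^ j * n ≤ E.card →
      HasCont (fun I => P0 I ∧ I ⊆ Y ∧ ∀ e ∈ E, ¬ φ e ⊆ I) (s + j * M) b := by
  have hn' : (0:ℝ) < n := by exact_mod_cast hn
  have hC1 : 1 ≤ C := by rw [hC]; have : (0:ℝ) ≤ B := by positivity
                         linarith
  have hC0 : 0 < C := by linarith
  have hk' : (1:ℝ) ≤ k := by exact_mod_cast hk
  have hκ1 : 8 ≤ κ := by rw [hκ]; nlinarith
  have hκ0 : 0 < κ := by linarith
  have hL0 : 0 < L := by linarith
  intro j
  induction j with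
  | zero =>
    intro _ Y hY E φ hV hc hd hco hE
    simp only [pow_zero, mul_one] at hE hd
    set Z := E.biUnion φ with hZ
    have hZX : Z ⊆ X0 := Finset.biUnion_subset.2 hV
    have h1 := remove_le E φ Z C hd
    have h2 : E.filter (fun e => Disjoint (φ e) Z) = ∅ := by
      refine Finset.filter_eq_empty_iff.2 fun e he hdis => ?_
      have : 0 < (φ e).card := by rw [hc e he]; omega
      obtain ⟨v, hv⟩ := Finset.card_pos.1 this
      exact Finset.disjoint_left.1 hdis hv (Finset.mem_biUnion.2 ⟨e, he, hv⟩)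
    rw [h2] at h1
    simp only [Finset.card_empty, Nat.cast_zero, zero_add] at h1
    have h3 : δ * n ≤ (Z.card : ℝ) := by
      have : C * (δ * n) ≤ C * Z.card := by nlinarith
      exact le_of_mul_le_mul_left this hC0
    have h4 : (Z.card : ℝ) ≤ ((X0 \ (Y \ Z)).card : ℝ) := by
      have : Z ⊆ X0 \ (Y \ Z) := fun x hx => by
        simp only [Finset.mem_sdiff, not_and, not_not]
        exact ⟨hZX hx, fun _ => hx⟩
      exact_mod_cast Finset.card_le_card this
    refine (hcont (Y \ Z) (Finset.sdiff_subset.trans hY) (h3.trans h4)).mono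
      (fun I hI => ⟨hI.1, fun x hx => ?_⟩) (by omega)
    rw [Finset.mem_sdiff]
    refine ⟨hI.2.1 hx, fun hxZ => ?_⟩
    obtain ⟨e, he, hxe⟩ := Finset.mem_biUnion.1 hxZ
    refine hI.2.2 e he ?_
    obtain ⟨y, hy⟩ := Finset.card_eq_one.1 (by simpa using hc e he : (φ e).card = 1)
    rw [hy, Finset.mem_singleton] at hxe
    rw [hy, Finset.singleton_subset_iff, ← hxe]
    exact hx
  | succ j ih =>
    intro hjk Y hY E φ hV hc hd hco hE
    have hLj : 1 ≤ L ^ j := one_le_pow₀ hL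
    have hκj : 1 ≤ κ ^ j := one_le_pow₀ (by linarith)
    have hjk' : ((j + 1 : ℕ) : ℝ) ≤ k := by exact_mod_cast hjk
    have key := cont_loop P0 X0 n hn hX E φ (j+1) B M (s + j * M) b (C * L ^ (j+1))
      (α * κ ^ (j+1) * L ^ (j+1)) δ (L ^ j) (α * κ ^ j * L ^ j) (by positivity) (by positivity)
      (by positivity) hV hc hco hd hE
      (by
        have h1 : α * κ ^ (j+1) * L ^ (j+1) / 2 * M = (α * κ ^ j * L ^ j) * (κ / 2 * (L * M)) := by
          ring
        rw [h1]
        have : (n:ℝ) ≤ κ / 2 * (L * M) := by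
          have : 0 ≤ L * M := by positivity
          nlinarith
        gcongr)
      (by
        have h1 : ((j+1:ℕ):ℝ) * (α * κ ^ j * L ^ j * n) / L ^ j = ((j+1:ℕ):ℝ) * (α * κ ^ j * n) := by
          field_simp
        rw [h1]
        have h2 : α * κ ^ (j+1) * L ^ (j+1) / 2 * n = (4 * k * C * (α * κ ^ j) * n) * L ^ (j+1) := by
          rw [pow_succ κ, hκ]; ring
        rw [h2, ← mul_assoc]
        refine mul_le_mul_of_nonneg_right ?_ (by positivity)
        have h3 : C * δ ≤ k * C * (α * κ ^ j) := by
          have h4 : α ≤ α * κ ^ j := le_mul_of_one_le_right hα.le hκj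
          have h5 : α * κ ^ j ≤ (k * C) * (α * κ ^ j) :=
            le_mul_of_one_le_left (by positivity) (by nlinarith)
          linarith
        calc (δ * n + M + ((j+1:ℕ):ℝ) * (α * κ ^ j * n)) * C
            ≤ (δ * n + δ * n + k * (α * κ ^ j * n)) * C := by gcongr
          _ = (2 * (C * δ) + k * C * (α * κ ^ j)) * n := by ring
          _ ≤ (2 * (k * C * (α * κ ^ j)) + k * C * (α * κ ^ j)) * n := by gcongr
          _ ≤ _ := by
              have : 0 ≤ k * C * (α * κ ^ j) * n := by positivity
              nlinarith)
      (by
        intro Y' hY' G ψ h1 h2 h3 h4 h5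
        refine ih (by omega) Y' hY' G ψ h1 h2 (fun u => (h3 u).trans ?_) h4 h5
        rw [hC]
        have : (B:ℝ) * 1 ≤ B * L ^ j := by gcongr
        linarith)
      (fun Y' hY' h => (hcont Y' hY' h).mono (fun _ h => h) (by omega))
      ((Y \ ∅).card + 1) Y ∅ ∅ φ (by omega) hY (by simp)
      (by intro u; simp [dg]; positivity) (by simp)
    refine key.mono (fun I hI => ⟨hI.1, hI.2.1, by simp, hI.2.2⟩) ?_
    simp only [Finset.card_empty, Nat.sub_zero]
    rw [add_mul]; omega

/-- independence predicate -/
def Ind (k r : ℕ) (I : Finset ℕ) : Prop :=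
  ¬ ∃ a d : ℕ, 0 < a ∧ 0 < d ∧ ∀ i ≤ k, a + i * d ^ r ∈ I

/-- vertex set of a configuration -/
def ph (k r : ℕ) (p : ℕ × ℕ) : Finset ℕ := (Finset.range (k+1)).image (fun i => p.1 + i * p.2 ^ r)

lemma mem_ph {k r : ℕ} {p : ℕ × ℕ} {u : ℕ} : u ∈ ph k r p ↔ ∃ i ≤ k, p.1 + i * p.2 ^ r = u := by
  simp [ph]

lemma ph_card {k r : ℕ} {p : ℕ × ℕ} (hp : 1 ≤ p.2) : (ph k r p).card = k + 1 := by
  rw [ph, Finset.card_image_of_injective, Finset.card_range]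
  intro i j hij
  have : 0 < p.2 ^ r := by positivity
  have h : i * p.2 ^ r = j * p.2 ^ r := by simpa using hij
  exact Nat.eq_of_mul_eq_mul_right this h

lemma cfg_dg (k r n D : ℕ) (A : Finset ℕ) (u : ℕ) : dg (cfg k r n D A) (ph k r) u ≤ (k+1) * D := by
  classical
  have : ∀ p ∈ (cfg k r n D A).filter (fun e => u ∈ ph k r e), ∃ i ≤ k, p.1 + i * p.2 ^ r = u :=
    fun p hp => mem_ph.1 (Finset.mem_filter.1 hp).2
  choose! f hf1 hf2 using this
  unfold dg
  have h2 : (k+1) * D = (Finset.range (k+1) ×ˢ Finset.Icc 1 D).card := by simp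
  rw [h2]
  refine Finset.card_le_card_of_injOn (fun p => (f p, p.2)) ?_ ?_
  · intro p hp
    have := mem_cfg.1 (Finset.mem_filter.1 hp).1
    have h3 := hf1 p hp
    simp only [Finset.coe_product, Set.mem_prod, Finset.mem_coe, Finset.mem_range, Finset.mem_Icc]
    exact ⟨by omega, this.2.1⟩
  · intro p hp q hq h
    simp only [Prod.mk.injEq] at h
    have e1 := hf2 p hp
    have e2 := hf2 q hq
    rw [h.1, h.2] at e1
    ext
    · omega
    · exact h.2

lemma cfg_codeg (k r n D : ℕ) (hr : 1 ≤ r) (A : Finset ℕ) :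
    Codeg (cfg k r n D A) (ph k r) ((k+1) * (k+1)) := by
  classical
  intro u v huv
  have h1 : ∀ p ∈ (cfg k r n D A).filter (fun e => u ∈ ph k r e ∧ v ∈ ph k r e),
      ∃ i ≤ k, p.1 + i * p.2 ^ r = u := fun p hp => mem_ph.1 (Finset.mem_filter.1 hp).2.1
  have h2 : ∀ p ∈ (cfg k r n D A).filter (fun e => u ∈ ph k r e ∧ v ∈ ph k r e),
      ∃ i ≤ k, p.1 + i * p.2 ^ r = v := fun p hp => mem_ph.1 (Finset.mem_filter.1 hp).2.2
  choose! f hf1 hf2 using h1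
  choose! g hg1 hg2 using h2
  have h3 : (k+1) * (k+1) = (Finset.range (k+1) ×ˢ Finset.range (k+1)).card := by simp
  rw [h3]
  refine Finset.card_le_card_of_injOn (fun p => (f p, g p)) ?_ ?_
  · intro p hp
    have e1 := hf1 p hp
    have e2 := hg1 p hp
    simp only [Finset.coe_product, Set.mem_prod, Finset.mem_coe, Finset.mem_range]
    omega
  · intro p hp q hq h
    simp only [Prod.mk.injEq] at h
    have e1 := hf2 p hp
    have e2 := hf2 q hq
    have e3 := hg2 p hp
    have e4 := hg2 q hq
    rw [← h.1] at e2
    rw [← h.2] at e4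
    have hne : (f p : ℤ) ≠ g p := by
      intro hh
      have hh : f p = g p := by exact_mod_cast hh
      rw [hh] at e1
      exact huv (e1.symm.trans e3)
    have e5 : ((f p : ℤ) - g p) * ((p.2 : ℤ) ^ r) = ((f p : ℤ) - g p) * ((q.2 : ℤ) ^ r) := by
      zify at e1 e2 e3 e4
      linear_combination e1 - e3 - e2 + e4
    have e6 := mul_left_cancel₀ (sub_ne_zero.2 hne) e5
    have e7 : p.2 ^ r = q.2 ^ r := by exact_mod_cast e6
    have e8 : p.2 = q.2 := Nat.pow_left_injective (by omega : r ≠ 0) e7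
    rw [e8] at e1
    ext
    · omega
    · exact e8

open Classical in
theorem cont_rounds (k r : ℕ) (hk : 1 ≤ k) (hr : 1 ≤ r) (ε : ℝ) (hε : 0 < ε) :
    ∃ (t : ℕ) (δ : ℝ) (D0 : ℕ), 0 < δ ∧ ∀ n D M : ℕ, 0 < n → D ^ r ≤ n → D0 ≤ D → ∀ L : ℝ, 1 ≤ L →
      L ^ k = D → (M:ℝ) ≤ δ * n → (n:ℝ) ≤ L * M →
      HasCont (fun I => Ind k r I ∧ I ⊆ Finset.Icc 1 n) (t * (k * M)) ⌊ε * n⌋₊ := by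
  obtain ⟨c, hc, D0, hv⟩ := varn k r hk hr ε hε
  set B := (k+1) * (k+1) with hB
  set C : ℝ := B + 1 with hC
  set κ : ℝ := 8 * k * C with hκ
  have hk' : (1:ℝ) ≤ k := by exact_mod_cast hk
  have hC0 : 0 < C := by positivity
  have hκ0 : 0 < κ := by positivity
  set α : ℝ := c / κ ^ k with hα
  have hα0 : 0 < α := by positivity
  set δ : ℝ := α / 8 / C with hδ
  have hδ0 : 0 < δ := by positivity
  obtain ⟨t, ht⟩ := exists_nat_gt (1 / δ)
  refine ⟨t, δ, D0, hδ0, ?_⟩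
  intro n D M hn hD hD0 L hL hLk hM1 hM2
  have hn' : (0:ℝ) < n := by exact_mod_cast hn
  have main : ∀ t : ℕ, ∀ X ⊆ Finset.Icc 1 n, (X.card : ℝ) ≤ ε * n + t * (δ * n) →
      HasCont (fun I => Ind k r I ∧ I ⊆ X) (t * (k * M)) ⌊ε * n⌋₊ := by
    intro t
    induction t with
    | zero =>
      intro X hX hXc
      refine HasCont.leaf X ?_ (fun I hI => hI.2)
      exact Nat.le_floor (by simpa using hXc)
    | succ t ih =>
      intro X hX hXc
      by_cases hs : (X.card : ℝ) ≤ ε * n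
      · exact HasCont.leaf X (Nat.le_floor hs) (fun I hI => hI.2)
      push Not at hs
      have hXn : X.card ≤ n := by simpa using Finset.card_le_card hX
      have key := cont_stage (ι := ℕ × ℕ) (Ind k r) X n k hn hk hXn B M (t * (k * M)) ⌊ε * n⌋₊ L α δ C κ
        hL hα0 hδ0 hC hκ (by rw [hδ]; field_simp; rfl) hM1 hM2
        (by
          intro Y hY hYc
          refine ih Y (hY.trans hX) ?_
          have h1 := Finset.card_sdiff_add_card_eq_card hY
          have h1' : ((X \ Y).card : ℝ) + Y.card = X.card := by exact_mod_cast h1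
          push_cast at hXc
          linarith) k le_rfl X le_rfl (cfg k r n D X) (ph k r)
        (by
          intro e he u hu
          obtain ⟨i, hi, rfl⟩ := mem_ph.1 hu
          exact (mem_cfg.1 he).2.2 i hi)
        (fun e he => ph_card (mem_cfg.1 he).2.1.1)
        (by
          intro u
          rw [hLk]
          have h1 : (dg (cfg k r n D X) (ph k r) u : ℝ) ≤ ((k+1) * D : ℕ) := by
            exact_mod_cast cfg_dg k r n D X u
          refine h1.trans ?_
          push_cast
          have : ((k:ℝ)+1) ≤ C := by rw [hC, hB]; push_cast; nlinarith
          gcongr)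
        (cfg_codeg k r n D hr X)
        (by
          rw [hLk]
          have h1 : α * κ ^ k = c := by rw [hα]; field_simp
          rw [h1]
          have := hv n D hD hD0 X hX hs.le
          linarith)
      refine key.mono (fun I hI => ⟨hI.1, hI.2, ?_⟩) (by rw [add_mul]; omega)
      intro e he hsub
      have h2 := mem_cfg.1 he
      exact hI.1 ⟨e.1, e.2, h2.1.1, h2.2.1.1, fun i hi => hsub (mem_ph.2 ⟨i, hi, rfl⟩)⟩
  refine main t _ le_rfl ?_
  have : 1 ≤ t * δ := by
    rw [div_lt_iff₀ hδ0] at ht; exact ht.le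
  simp only [Nat.card_Icc, Nat.add_sub_cancel]
  nlinarith [mul_pos hε hn']

end PSz
end Part15

section Part16
namespace PSz

lemma desc_scale {K x y : ℕ} (hK : 1 ≤ K) (h : K * x ≤ y) (i : ℕ) :
    K ^ i * x.descFactorial i ≤ y.descFactorial i := by
  induction i with
  | zero => simp
  | succ i ih =>
    rw [Nat.descFactorial_succ, Nat.descFactorial_succ]
    have h1 : K * (x - i) ≤ y - i := by
      rw [Nat.mul_sub]
      have : i ≤ K * i := Nat.le_mul_of_pos_left _ hK
      omega
    calc K ^ (i+1) * ((x - i) * x.descFactorial i)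
        = (K * (x - i)) * (K ^ i * x.descFactorial i) := by ring
      _ ≤ _ := Nat.mul_le_mul h1 ih

lemma choose_scale {K x y : ℕ} (hK : 1 ≤ K) (h : K * x ≤ y) (i : ℕ) :
    K ^ i * x.choose i ≤ y.choose i := by
  have := desc_scale hK h i
  rw [Nat.descFactorial_eq_factorial_mul_choose, Nat.descFactorial_eq_factorial_mul_choose] at this
  refine Nat.le_of_mul_le_mul_left ?_ (Nat.factorial_pos i)
  calc i.factorial * (K ^ i * x.choose i) = K ^ i * (i.factorial * x.choose i) := by ring
    _ ≤ _ := this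

lemma desc_up {Q n b s : ℕ} (h : n ≤ Q * (b - s)) : ∀ i ≤ s,
    n.descFactorial i ≤ Q ^ i * b.descFactorial i := by
  intro i
  induction i with
  | zero => simp
  | succ i ih =>
    intro hi
    rw [Nat.descFactorial_succ, Nat.descFactorial_succ]
    have h1 : n - i ≤ Q * (b - i) :=
      (Nat.sub_le _ _).trans (h.trans (Nat.mul_le_mul_left _ (by omega)))
    calc (n - i) * n.descFactorial i ≤ (Q * (b - i)) * (Q ^ i * b.descFactorial i) :=
          Nat.mul_le_mul h1 (ih (by omega))
      _ = _ := by ring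

lemma choose_up {Q n b s : ℕ} (h : n ≤ Q * (b - s)) (i : ℕ) (hi : i ≤ s) :
    n.choose i ≤ Q ^ i * b.choose i := by
  have := desc_up h i hi
  rw [Nat.descFactorial_eq_factorial_mul_choose, Nat.descFactorial_eq_factorial_mul_choose] at this
  refine Nat.le_of_mul_le_mul_left ?_ (Nat.factorial_pos i)
  calc i.factorial * n.choose i ≤ _ := this
    _ = _ := by ring

lemma final_sum {n b b' m s Q : ℕ} (h1 : 64 * b' + s ≤ b) (h2 : n ≤ Q * (b - s))
    (h3 : s * (Q + 2) ≤ m) (h4 : m ≤ b') :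
    ∑ j ∈ Finset.range (s+1), n.choose j * b'.choose (m - j) ≤ b.choose m := by
  have hterm : ∀ j ∈ Finset.range (s+1), 2 ^ m * (n.choose j * b'.choose (m - j)) ≤ b.choose m := by
    intro j hj
    have hj : j ≤ s := by simpa [Nat.lt_succ_iff] using hj
    have hjm : j * (Q + 2) ≤ m := (Nat.mul_le_mul_right _ hj).trans h3
    have hjQ : Q * j ≤ m := by nlinarith
    have hj2 : 2 * j ≤ m := by nlinarith
    have e1 := choose_up h2 j hj
    have e2 : 64 ^ (m-j) * b'.choose (m-j) ≤ (b-j).choose (m-j) :=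
      choose_scale (by norm_num) (by omega) _
    have e3 : b.choose m * m.choose j = b.choose j * (b - j).choose (m - j) :=
      Nat.choose_mul (by omega)
    have e4 : m.choose j ≤ 2 ^ m := Nat.choose_le_two_pow m j
    have e5 : Q ^ j ≤ 2 ^ m := by
      calc Q ^ j ≤ (2 ^ Q) ^ j := Nat.pow_le_pow_left (Nat.lt_two_pow_self).le _
        _ = 2 ^ (Q * j) := (pow_mul _ _ _).symm
        _ ≤ 2 ^ m := Nat.pow_le_pow_right (by norm_num) hjQ
    have e6 : 2 ^ m * 2 ^ m * 2 ^ m ≤ 64 ^ (m - j) := by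
      calc 2 ^ m * 2 ^ m * 2 ^ m = 2 ^ (m + m + m) := by rw [pow_add, pow_add]
        _ ≤ 2 ^ (6 * (m - j)) := Nat.pow_le_pow_right (by norm_num) (by omega)
        _ = (2 ^ 6) ^ (m - j) := pow_mul _ _ _
        _ = _ := by norm_num
    have hpos : 0 < 2 ^ m * 2 ^ m := by positivity
    refine Nat.le_of_mul_le_mul_left ?_ hpos
    calc 2 ^ m * 2 ^ m * (2 ^ m * (n.choose j * b'.choose (m - j)))
        = (2 ^ m * 2 ^ m * 2 ^ m) * (n.choose j * b'.choose (m - j)) := by ring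
      _ ≤ 64 ^ (m - j) * (n.choose j * b'.choose (m - j)) := Nat.mul_le_mul_right _ e6
      _ = n.choose j * (64 ^ (m - j) * b'.choose (m - j)) := by ring
      _ ≤ (Q ^ j * b.choose j) * (b-j).choose (m-j) := Nat.mul_le_mul e1 e2
      _ = Q ^ j * (b.choose m * m.choose j) := by rw [e3]; ring
      _ ≤ 2 ^ m * (b.choose m * 2 ^ m) := Nat.mul_le_mul e5 (Nat.mul_le_mul_left _ e4)
      _ = _ := by ring
  have hs : s + 1 ≤ 2 ^ m := by
    have : s ≤ m := by nlinarith
    have := Nat.lt_two_pow_self (n := m)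
    omega
  have h5 : 2 ^ m * ∑ j ∈ Finset.range (s+1), n.choose j * b'.choose (m - j) ≤ 2 ^ m * b.choose m := by
    rw [Finset.mul_sum]
    calc _ ≤ ∑ j ∈ Finset.range (s+1), b.choose m := Finset.sum_le_sum hterm
      _ = (s+1) * b.choose m := by simp
      _ ≤ _ := Nat.mul_le_mul_right _ hs
  exact Nat.le_of_mul_le_mul_left h5 (by positivity)

open Classical in
lemma count_le {P : Finset ℕ → Prop} {n m s b : ℕ}
    (h : HasCont (fun I => P I ∧ I ⊆ Finset.Icc 1 n) s b) :
    (((Finset.Icc 1 n).powersetCard m).filter P).card ≤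
      ∑ j ∈ Finset.range (s+1), n.choose j * b.choose (m - j) := by
  obtain ⟨cont, hc⟩ := h
  have hsub : ((Finset.Icc 1 n).powersetCard m).filter P ⊆
      (Finset.range (s+1)).biUnion fun j => ((Finset.Icc 1 n).powersetCard j).biUnion fun S =>
        if (cont S).card ≤ b then ((cont S).powersetCard (m - j)).image (fun U => S ∪ U) else ∅ := by
    intro I hI
    rw [Finset.mem_filter, Finset.mem_powersetCard] at hI
    obtain ⟨S, h1, h2, h3⟩ := hc I ⟨hI.2, hI.1.1⟩
    obtain ⟨h4, h5⟩ := h3 S le_rfl h1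
    rw [Finset.mem_biUnion]
    refine ⟨S.card, Finset.mem_range.2 (by omega), ?_⟩
    rw [Finset.mem_biUnion]
    refine ⟨S, Finset.mem_powersetCard.2 ⟨h1.trans hI.1.1, rfl⟩, ?_⟩
    rw [if_pos h5, Finset.mem_image]
    refine ⟨I \ S, Finset.mem_powersetCard.2 ⟨Finset.sdiff_subset.trans h4, ?_⟩,
      Finset.union_sdiff_of_subset h1⟩
    rw [Finset.card_sdiff_of_subset h1, hI.1.2]
  refine (Finset.card_le_card hsub).trans (Finset.card_biUnion_le.trans (Finset.sum_le_sum fun j _ => ?_))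
  refine Finset.card_biUnion_le.trans ?_
  calc _ ≤ ∑ S ∈ (Finset.Icc 1 n).powersetCard j, b.choose (m - j) := by
        refine Finset.sum_le_sum fun S _ => ?_
        split_ifs with hS
        · refine Finset.card_image_le.trans ?_
          rw [Finset.card_powersetCard]
          exact Nat.choose_le_choose _ hS
        · simp
    _ = _ := by simp

open Classical in
lemma count_zero {P : Finset ℕ → Prop} {n m s b : ℕ}
    (h : HasCont (fun I => P I ∧ I ⊆ Finset.Icc 1 n) s b) (hm : b < m) :
    (((Finset.Icc 1 n).powersetCard m).filter P).card = 0 := by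
  obtain ⟨cont, hc⟩ := h
  rw [Finset.card_eq_zero, Finset.filter_eq_empty_iff]
  intro I hI hP
  rw [Finset.mem_powersetCard] at hI
  obtain ⟨S, h1, h2, h3⟩ := hc I ⟨hP, hI.1⟩
  obtain ⟨h4, h5⟩ := h3 I h1 le_rfl
  have := Finset.card_le_card h4
  omega

/-- asymptotics of the parameters -/
lemma params (k r : ℕ) (hk : 1 ≤ k) (hr : 1 ≤ r) (δ : ℝ) (hδ : 0 < δ) (D0 : ℕ) :
    ∃ n₀ : ℕ, ∀ n ≥ n₀, 0 < n ∧ ∃ (D M : ℕ) (L : ℝ), D ^ r ≤ n ∧ D0 ≤ D ∧ 1 ≤ L ∧ L ^ k = D ∧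
      (M:ℝ) ≤ δ * n ∧ (n:ℝ) ≤ L * M ∧
      (M:ℝ) ≤ 4 * (n : ℝ) ^ ((1 : ℝ) - 1 / ((k : ℝ) * (r : ℝ))) := by
  obtain ⟨K, hK⟩ := exists_nat_gt (max ((2/δ)^k) (2/δ))
  have hK1 : (2/δ)^k < K := (le_max_left _ _).trans_lt hK
  have hK2 : 2/δ < K := (le_max_right _ _).trans_lt hK
  set K' := max (max K D0) 1 with hK'
  refine ⟨K' ^ r, fun n hn => ?_⟩
  have hK'1 : 1 ≤ K' := le_max_right _ _
  have hKK : K ≤ K' := (le_max_left _ _).trans (le_max_left _ _)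
  have hDK : D0 ≤ K' := (le_max_right _ _).trans (le_max_left _ _)
  have hnK : K' ≤ n := (Nat.le_self_pow (by omega) K').trans hn
  have hn0 : 0 < n := by omega
  have hn' : (0:ℝ) < n := by exact_mod_cast hn0
  have hn1 : (1:ℝ) ≤ n := by exact_mod_cast hn0
  have hr' : (0:ℝ) < r := by exact_mod_cast hr
  have hk' : (0:ℝ) < k := by exact_mod_cast hk
  set y : ℝ := (n:ℝ) ^ (1 / (r:ℝ)) with hy
  have hy0 : 0 < y := Real.rpow_pos_of_pos hn' _
  have hyr : y ^ r = n := by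
    rw [hy, one_div]; exact Real.rpow_inv_natCast_pow hn'.le (by omega)
  have hyK : (K':ℝ) ≤ y := by
    refine le_of_pow_le_pow_left₀ (n := r) (by omega) hy0.le ?_
    rw [hyr]; exact_mod_cast hn
  set D := ⌊y⌋₊ with hD
  have hDy : (D:ℝ) ≤ y := Nat.floor_le hy0.le
  have hyD : y < D + 1 := Nat.lt_floor_add_one y
  have hK'D : K' ≤ D := Nat.le_floor hyK
  have hD1 : (1:ℝ) ≤ D := by exact_mod_cast hK'1.trans hK'D
  have hDn : D ^ r ≤ n := by
    have : (D:ℝ)^r ≤ n := by rw [← hyr]; gcongr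
    exact_mod_cast this
  set L : ℝ := (D:ℝ) ^ (1 / (k:ℝ)) with hL
  have hL1 : 1 ≤ L := Real.one_le_rpow hD1 (by positivity)
  have hL0 : 0 < L := by linarith
  have hLk : L ^ k = D := by
    rw [hL, one_div]; exact Real.rpow_inv_natCast_pow (by linarith) (by omega)
  have hLn : L ≤ n := by
    have h1 : L ≤ L ^ k := le_self_pow₀ hL1 (by omega)
    have h2 : D ≤ n := (Nat.le_self_pow (by omega) D).trans hDn
    have h2' : (D:ℝ) ≤ n := by exact_mod_cast h2
    linarith
  have hLd : 2 / δ ≤ L := by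
    refine le_of_pow_le_pow_left₀ (n := k) (by omega) hL0.le ?_
    rw [hLk]
    have : (K:ℝ) ≤ D := by exact_mod_cast hKK.trans hK'D
    linarith
  set M := ⌊n / L⌋₊ + 1 with hM
  have hMle : (M:ℝ) ≤ n / L + 1 := by
    rw [hM]; push_cast
    have := Nat.floor_le (show 0 ≤ n / L by positivity)
    linarith
  refine ⟨hn0, D, M, L, hDn, hDK.trans hK'D, hL1, hLk, ?_, ?_, ?_⟩
  · have h1 : n / L ≤ δ / 2 * n := by
      rw [div_le_iff₀ hL0]
      have : 1 ≤ δ / 2 * L := by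
        rw [div_le_iff₀ hδ] at hLd; linarith
      nlinarith
    have h2 : 1 ≤ δ / 2 * n := by
      have : (K:ℝ) ≤ n := by exact_mod_cast hKK.trans hnK
      have h3 : 2 / δ ≤ n := by linarith
      rw [div_le_iff₀ hδ] at h3; linarith
    linarith
  · have h1 : n / L ≤ M := by
      rw [hM]; push_cast
      exact (Nat.lt_floor_add_one _).le
    rw [div_le_iff₀ hL0] at h1
    linarith
  · have h1 : (1:ℝ) ≤ n / L := by rw [le_div_iff₀ hL0]; linarith
    have h2 : (n:ℝ) ^ (1 / ((k:ℝ) * r)) ≤ 2 * L := by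
      have e1 : (n:ℝ) ^ (1 / ((k:ℝ) * r)) = y ^ (1 / (k:ℝ)) := by
        rw [hy, ← Real.rpow_mul hn'.le]; congr 1; field_simp
      rw [e1]
      calc y ^ (1 / (k:ℝ)) ≤ (2 * (D:ℝ)) ^ (1 / (k:ℝ)) :=
            Real.rpow_le_rpow hy0.le (by linarith) (by positivity)
        _ = 2 ^ (1 / (k:ℝ)) * L := Real.mul_rpow (by norm_num) (by linarith)
        _ ≤ 2 * L := by
            refine mul_le_mul_of_nonneg_right ?_ hL0.le
            calc (2:ℝ) ^ (1 / (k:ℝ)) ≤ 2 ^ (1:ℝ) := by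
                  refine Real.rpow_le_rpow_of_exponent_le (by norm_num) ?_
                  rw [div_le_one hk']; exact_mod_cast hk
              _ = 2 := Real.rpow_one 2
    have h3 : n / L ≤ 2 * (n:ℝ) ^ ((1:ℝ) - 1 / ((k:ℝ) * r)) := by
      rw [Real.rpow_sub hn', Real.rpow_one, mul_div_assoc', div_le_div_iff₀ hL0 (Real.rpow_pos_of_pos hn' _)]
      nlinarith
    linarith

open Classical in
theorem main_count (β : ℝ) (hβ : 0 < β) (k r : ℕ) (hk : 1 ≤ k) (hr : 1 ≤ r) :
    ∃ (C : ℝ) (n₀ : ℕ), ∀ n : ℕ, n₀ ≤ n → ∀ m : ℕ,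
      C * (n : ℝ) ^ ((1 : ℝ) - 1 / ((k : ℝ) * (r : ℝ))) ≤ (m : ℝ) →
      (((Finset.Icc 1 n).powersetCard m).filter (Ind k r)).card ≤ Nat.choose ⌊β * (n : ℝ)⌋₊ m := by
  obtain ⟨t, δ, D0, hδ, H⟩ := cont_rounds k r hk hr (β/256) (by positivity)
  obtain ⟨n₁, hp⟩ := params k r hk hr δ hδ D0
  obtain ⟨Q, hQ⟩ := exists_nat_gt (4/β)
  obtain ⟨n₂, hn₂⟩ := exists_nat_gt (4/β)
  refine ⟨4 * t * k * (Q + 2), max n₁ n₂, fun n hn m hm => ?_⟩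
  obtain ⟨hn0, D, M, L, e1, e2, e3, e4, e5, e6, e7⟩ := hp n ((le_max_left _ _).trans hn)
  have hn' : (0:ℝ) < n := by exact_mod_cast hn0
  have hc := H n D M hn0 e1 e2 L e3 e4 e5 e6
  set b' := ⌊β / 256 * (n:ℝ)⌋₊ with hb'
  set b := ⌊β * (n:ℝ)⌋₊ with hb
  set s := t * (k * M) with hs
  rcases lt_or_ge b' m with hmb | hmb
  · rw [count_zero hc hmb]; exact Nat.zero_le _
  refine (count_le hc).trans ?_
  have hsm : s * (Q + 2) ≤ m := by
    have h1 : ((s * (Q + 2) : ℕ) : ℝ) ≤ m := by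
      refine le_trans ?_ hm
      rw [hs]; push_cast
      calc (t:ℝ) * (k * M) * (Q + 2) ≤ t * (k * (4 * (n : ℝ) ^ ((1 : ℝ) - 1 / ((k : ℝ) * (r : ℝ))))) * (Q+2) := by
            gcongr
        _ = _ := by ring
    exact_mod_cast h1
  have hsm' : s ≤ m := by nlinarith
  have hb'1 : (b':ℝ) ≤ β / 256 * n := Nat.floor_le (by positivity)
  have hb1 : β * n < b + 1 := Nat.lt_floor_add_one _
  have hn2 : 4 ≤ β * n := by
    have h1 : (n₂:ℝ) ≤ n := by exact_mod_cast (le_max_right _ _).trans hn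
    have h2 : 4 / β ≤ n := by linarith
    rw [div_le_iff₀ hβ] at h2; linarith
  have hsb : (s:ℝ) ≤ b' := by exact_mod_cast hsm'.trans hmb
  have hc1 : 64 * b' + s ≤ b := by
    have : (64 * b' + s : ℝ) ≤ b := by linarith
    exact_mod_cast this
  refine final_sum (Q := Q) hc1 ?_ hsm hmb
  have h2 : s ≤ b := by omega
  have : (n:ℝ) ≤ ((Q * (b - s) : ℕ) : ℝ) := by
    push_cast [Nat.cast_sub h2]
    have h3 : β * n / 4 ≤ b - s := by linarith
    rw [div_lt_iff₀ hβ] at hQ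
    have hQ0 : (0:ℝ) ≤ Q := by positivity
    calc (n:ℝ) ≤ (Q * β) * n / 4 := by nlinarith
      _ = Q * (β * n / 4) := by ring
      _ ≤ _ := by gcongr
  exact_mod_cast this

end PSz
end Part16

attribute [local instance] Classical.propDecidable

/-- Theorem 4.4: counting `m`-subsets of `{1, …, n}` containing no configuration of the
form `{a, a + d^r, a + 2d^r, …, a + k·d^r}` with `a, d` positive integers. -/
theorem count_sets_no_power_AP (β : ℝ) (hβ : 0 < β) (k r : ℕ) (hk : 1 ≤ k) (hr : 1 ≤ r) :
    ∃ (C : ℝ) (n₀ : ℕ), ∀ n : ℕ, n₀ ≤ n → ∀ m : ℕ,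
      C * (n : ℝ) ^ ((1 : ℝ) - 1 / ((k : ℝ) * (r : ℝ))) ≤ (m : ℝ) →
      (((Finset.Icc 1 n).powersetCard m).filter
          (fun A : Finset ℕ =>
            ¬ ∃ a d : ℕ, 0 < a ∧ 0 < d ∧ ∀ i ≤ k, a + i * d ^ r ∈ A)).card
        ≤ Nat.choose ⌊β * (n : ℝ)⌋₊ m := by
  obtain ⟨C, n₀, h⟩ := PSz.main_count β hβ k r hk hr
  refine ⟨C, n₀, fun n hn m hm => le_of_eq_of_le ?_ (h n hn m hm)⟩
  congr 1
  ext A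
  rw [Finset.mem_filter, Finset.mem_filter]
  exact Iff.rfl
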